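/- Every centrally symmetric convex body K in ℝ³ satisfies |K|·|K°| ≥ 32/3, with equality if and only if K or K° is a parallelepiped (i.e., K is a linear image of the cube [-1,1]³ or of the cross-polytope B₁³). -/

import Mathlib

section
open MeasureTheory
set_option linter.all false
open scoped RealInnerProductSpace

namespace Mahler
/-- an explicit dot product -/
class Dot (E : Type) [NormedAddCommGroup E] [NormedSpace ℝ E] where
  dot : E →ₗ[ℝ] E →ₗ[ℝ] ℝ
  symm : ∀ x y, dot x y = dot y x
  rep : ∀ f : E →ₗ[ℝ] ℝ, ∃ y, ∀ x, dot x y = f x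
  low : ∀ x, ‖x‖ ^ 2 ≤ dot x x
  up : ∃ C, 0 < C ∧ ∀ x y, |dot x y| ≤ C * (‖x‖ * ‖y‖)

noncomputable instance : Dot ℝ where
  dot := LinearMap.mul ℝ ℝ
  symm x y := by simp [mul_comm]
  rep f := ⟨f 1, fun x => by
    have := f.map_smul x 1
    simp at this
    simp [this]⟩
  low x := by simp [sq]
  up := ⟨1, one_pos, fun x y => by simp [abs_mul]⟩

noncomputable instance {E F : Type} [NormedAddCommGroup E] [NormedSpace ℝ E] [NormedAddCommGroup F]
    [NormedSpace ℝ F] [Dot E] [Dot F] : Dot (E × F) where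
  dot := (Dot.dot (E := E)).compl₁₂ (LinearMap.fst ℝ E F) (LinearMap.fst ℝ E F) +
    (Dot.dot (E := F)).compl₁₂ (LinearMap.snd ℝ E F) (LinearMap.snd ℝ E F)
  symm x y := by simp [Dot.symm x.1 y.1, Dot.symm x.2 y.2]
  rep f := by
    obtain ⟨y, hy⟩ := Dot.rep (f ∘ₗ LinearMap.inl ℝ E F)
    obtain ⟨z, hz⟩ := Dot.rep (f ∘ₗ LinearMap.inr ℝ E F)
    refine ⟨(y, z), fun x => ?_⟩
    simp [hy, hz, ← map_add]
  low x := by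
    have h1 := Dot.low x.1
    have h2 := Dot.low x.2
    simp only [LinearMap.add_apply, LinearMap.compl₁₂_apply, LinearMap.fst_apply, LinearMap.snd_apply]
    rw [Prod.norm_def]
    rcases le_total ‖x.1‖ ‖x.2‖ with h | h
    · rw [max_eq_right h]; nlinarith [sq_nonneg ‖x.1‖]
    · rw [max_eq_left h]; nlinarith [sq_nonneg ‖x.2‖]
  up := by
    obtain ⟨C, hC, h⟩ := Dot.up (E := E)
    obtain ⟨D, hD, h'⟩ := Dot.up (E := F)
    refine ⟨C + D, by positivity, fun x y => ?_⟩
    simp only [LinearMap.add_apply, LinearMap.compl₁₂_apply, LinearMap.fst_apply, LinearMap.snd_apply]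
    have h1 := h x.1 y.1
    have h2 := h' x.2 y.2
    have a1 : ‖x.1‖ * ‖y.1‖ ≤ ‖x‖ * ‖y‖ := by gcongr; exact norm_fst_le x; exact norm_fst_le y
    have a2 : ‖x.2‖ * ‖y.2‖ ≤ ‖x‖ * ‖y‖ := by gcongr; exact norm_snd_le x; exact norm_snd_le y
    calc _ ≤ _ := abs_add_le _ _
      _ ≤ C * (‖x‖ * ‖y‖) + D * (‖x‖ * ‖y‖) := by gcongr <;> nlinarith
      _ = _ := by ring

theorem dot_real (x y : ℝ) : Dot.dot x y = x * y := rfl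
theorem dot_prod {E F : Type} [NormedAddCommGroup E] [NormedSpace ℝ E] [NormedAddCommGroup F]
    [NormedSpace ℝ F] [Dot E] [Dot F] (x y : E × F) :
    Dot.dot x y = Dot.dot x.1 y.1 + Dot.dot x.2 y.2 := rfl

variable {E : Type} [NormedAddCommGroup E] [NormedSpace ℝ E]

structure Body (K : Set E) : Prop where
  compact : IsCompact K
  conv : Convex ℝ K
  symm : ∀ x ∈ K, -x ∈ K
  zero : (0 : E) ∈ interior K

theorem Body.closed {K : Set E} (h : Body K) : IsClosed K := h.compact.isClosed
theorem Body.zero_mem {K : Set E} (h : Body K) : (0 : E) ∈ K := interior_subset h.zero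
theorem Body.smul_mem {K : Set E} (h : Body K) {x : E} (hx : x ∈ K) {t : ℝ} (h0 : |t| ≤ 1) :
    t • x ∈ K := by
  rcases abs_le.1 h0 with ⟨h1, h2⟩
  have := h.conv hx (h.symm x hx) (a := (1 + t)/2) (b := (1-t)/2) (by linarith) (by linarith) (by ring)
  convert this using 1
  module
theorem Body.comb {K : Set E} (h : Body K) {x y : E} (hx : x ∈ K) (hy : y ∈ K) {s t : ℝ}
    (h0 : |s| + |t| ≤ 1) :
    s • x + t • y ∈ K := by
  rcases eq_or_ne (|s| + |t|) 0 with h1 | h1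
  · have hs : s = 0 := by
      have := abs_nonneg s; have := abs_nonneg t; exact abs_eq_zero.1 (by linarith)
    have ht : t = 0 := by
      have := abs_nonneg s; have := abs_nonneg t; exact abs_eq_zero.1 (by linarith)
    simp [hs, ht, h.zero_mem]
  have hx' : ((SignType.sign s : ℝ) * (1 : ℝ)) • x ∈ K := h.smul_mem (E := E) (t := SignType.sign s * (1:ℝ)) hx (by
    rcases lt_trichotomy s 0 with hs | hs | hs <;> simp [hs])
  have hy' : ((SignType.sign t : ℝ) * (1 : ℝ)) • y ∈ K := h.smul_mem (E := E) (t := SignType.sign t * (1:ℝ)) hy (by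
    rcases lt_trichotomy t 0 with hs | hs | hs <;> simp [hs])
  have hp : 0 < |s| + |t| := lt_of_le_of_ne (by positivity) h1.symm
  have := h.smul_mem (h.conv hx' hy' (a := |s| / (|s|+|t|)) (b := |t| / (|s|+|t|)) (by positivity) (by positivity) (by field_simp)) (t := |s|+|t|) (by rwa [abs_of_pos hp])
  convert this using 1
  rw [smul_add, smul_smul, smul_smul, smul_smul, smul_smul]
  congr 2
  · field_simp; simp
  · field_simp; simp

section fd
variable [FiniteDimensional ℝ E]

theorem Body.preimage {F : Type} [NormedAddCommGroup F] [NormedSpace ℝ F] 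
    {K : Set F} (h : Body K) (e : E ≃ₗ[ℝ] F) : Body (e ⁻¹' K) := by
  haveI : FiniteDimensional ℝ F := LinearEquiv.finiteDimensional e
  let e' : E ≃L[ℝ] F := e.toContinuousLinearEquiv
  have he : (e ⁻¹' K) = e' ⁻¹' K := rfl
  refine ⟨?_, h.conv.linear_preimage e.toLinearMap, fun x hx => ?_, ?_⟩
  · rw [he]; exact e'.toHomeomorph.isCompact_preimage.2 h.compact
  · simp only [Set.mem_preimage, map_neg] at *; exact h.symm _ hx
  · rw [he]
    have : e' ⁻¹' interior K ⊆ interior (e' ⁻¹' K) := preimage_interior_subset_interior_preimage e'.continuous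
    apply this
    simp [h.zero]

variable [Dot E]

def pol (K : Set E) : Set E := {y | ∀ x ∈ K, Dot.dot x y ≤ 1}

theorem mem_pol {K : Set E} {y : E} : y ∈ pol K ↔ ∀ x ∈ K, Dot.dot x y ≤ 1 := Iff.rfl

theorem pol_abs {K : Set E} (h : Body K) {x y : E} (hx : x ∈ K) (hy : y ∈ pol K) :
    |Dot.dot x y| ≤ 1 := by
  rw [abs_le]
  have h1 := hy x hx
  have h2 := hy _ (h.symm x hx)
  simp at h2
  constructor <;> linarith

theorem continuous_dot (x : E) : Continuous fun y : E => Dot.dot x y :=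
  LinearMap.continuous_of_finiteDimensional _

theorem continuous_dot' (y : E) : Continuous fun x : E => Dot.dot x y := by
  simp_rw [Dot.symm _ y]; exact continuous_dot y

theorem Body.pol {K : Set E} (h : Body K) : Body (pol K) := by
  have hcl : IsClosed (Mahler.pol K) := by
    have : Mahler.pol K = ⋂ x ∈ K, {y | Dot.dot x y ≤ 1} := by ext; simp [Mahler.pol]
    rw [this]
    exact isClosed_biInter fun x _ => isClosed_le (continuous_dot x) continuous_const
  refine ⟨?_, ?_, ?_, ?_⟩
  · obtain ⟨r, hr, hrK⟩ := Metric.isOpen_iff.1 isOpen_interior 0 h.zero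
    apply Metric.isCompact_of_isClosed_isBounded hcl
    apply (Metric.isBounded_closedBall (x := (0 : E)) (r := 2 / r)).subset
    intro y hy
    rw [mem_closedBall_zero_iff]
    rcases eq_or_ne y 0 with rfl | hy0
    · simp; positivity
    have hn : 0 < ‖y‖ := norm_pos_iff.2 hy0
    have : ((r / 2) / ‖y‖) • y ∈ K := by
      apply interior_subset
      apply hrK
      rw [mem_ball_zero_iff, norm_smul, Real.norm_of_nonneg (by positivity)]
      field_simp; norm_num
    have h1 := hy _ this
    have h2 := Dot.low y
    simp only [map_smul, LinearMap.smul_apply, smul_eq_mul] at h1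
    have h3 : r / 2 / ‖y‖ * ‖y‖ ^ 2 ≤ 1 := le_trans (by gcongr) h1
    have h4 : r / 2 / ‖y‖ * ‖y‖ ^ 2 = r / 2 * ‖y‖ := by field_simp
    rw [h4] at h3
    rw [le_div_iff₀ hr]; linarith
  · intro y hy z hz a b ha hb hab x hx
    have := hy x hx; have := hz x hx
    simp only [map_add, map_smul, smul_eq_mul]
    nlinarith
  · intro y hy x hx
    have := hy _ (h.symm x hx)
    simpa using this
  · obtain ⟨C, hC, hup⟩ := Dot.up (E := E)
    obtain ⟨R, hR⟩ := h.compact.isBounded.exists_norm_le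
    rw [mem_interior]
    refine ⟨Metric.ball 0 (1 / (C * (|R| + 1))), ?_, Metric.isOpen_ball, Metric.mem_ball_self (by positivity)⟩
    intro y hy x hx
    rw [mem_ball_zero_iff, lt_div_iff₀ (by positivity)] at hy
    have h1 := hup x y
    have h2 : ‖x‖ ≤ |R| + 1 := (hR x hx).trans (by linarith [le_abs_self R])
    calc Dot.dot x y ≤ |Dot.dot x y| := le_abs_self _
      _ ≤ _ := h1
      _ ≤ C * ((|R|+1) * ‖y‖) := by gcongr
      _ ≤ 1 := by nlinarith

theorem sep {K : Set E} (hc : Convex ℝ K) (hcl : IsClosed K) (h0 : (0:E) ∈ K) {x : E} (hx : x ∉ K) :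
    ∃ y ∈ pol K, 1 < Dot.dot x y := by
  obtain ⟨f, u, hf, hu⟩ := geometric_hahn_banach_closed_point hc hcl hx
  have hu0 : 0 < u := by simpa using hf 0 h0
  obtain ⟨y, hy⟩ := Dot.rep (f : E →ₗ[ℝ] ℝ)
  refine ⟨u⁻¹ • y, fun z hz => ?_, ?_⟩
  · have := hf z hz
    simp only [map_smul, smul_eq_mul, hy, ContinuousLinearMap.coe_coe]
    rw [inv_mul_le_iff₀ hu0]; linarith
  · simp only [map_smul, smul_eq_mul, hy, ContinuousLinearMap.coe_coe]
    rw [lt_inv_mul_iff₀ hu0]; linarith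

theorem pol_pol {K : Set E} (h : Body K) : pol (pol K) = K := by
  ext x
  constructor
  · intro hx
    by_contra hxK
    obtain ⟨y, hy, h1⟩ := sep h.conv h.closed h.zero_mem hxK
    have := hx y hy
    rw [Dot.symm] at this
    linarith
  · intro hx y hy
    rw [Dot.symm]; exact hy x hx

theorem pol_preimage {F : Type} [NormedAddCommGroup F] [NormedSpace ℝ F] [Dot F]
    (A B : E ≃ₗ[ℝ] F) (hAB : ∀ x y, Dot.dot (A x) (B y) = Dot.dot x y) (K : Set F) :
    pol (A ⁻¹' K) = B ⁻¹' (pol K) := by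
  ext y
  simp only [mem_pol, Set.mem_preimage]
  constructor
  · intro h x hx
    have := h (A.symm x) (by simpa using hx)
    rw [← hAB] at this
    simpa using this
  · intro h x hx
    rw [← hAB]; exact h _ hx

/-- points of the boundary have support functionals -/
theorem exists_support {K : Set E} (h : Body K) {x : E} (hx : x ∉ interior K) (hxK : x ∈ K) :
    ∃ y ∈ pol K, Dot.dot x y = 1 := by
  obtain ⟨f, hf⟩ := geometric_hahn_banach_open_point h.conv.interior isOpen_interior hx
  have hle : ∀ z ∈ K, f z ≤ f x := by
    intro z hz
    have : K ⊆ closure (interior K) := by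
      rw [h.conv.closure_interior_eq_closure_of_nonempty_interior ⟨0, h.zero⟩]; exact subset_closure
    have hz' := this hz
    exact (closure_minimal (fun w hw => (hf w hw).le) (isClosed_le f.continuous continuous_const)) hz'
  have h0 : 0 < f x := by simpa using hf 0 h.zero
  obtain ⟨y, hy⟩ := Dot.rep (f : E →ₗ[ℝ] ℝ)
  refine ⟨(f x)⁻¹ • y, fun z hz => ?_, ?_⟩
  · simp only [map_smul, smul_eq_mul, hy, ContinuousLinearMap.coe_coe]
    rw [inv_mul_le_iff₀ h0]; linarith [hle z hz]
  · simp only [map_smul, smul_eq_mul, hy, ContinuousLinearMap.coe_coe]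
    field_simp

end fd

section meas
variable [MeasureSpace E] [BorelSpace E] 
theorem Body.measurable {K : Set E} (h : Body K) : MeasurableSet K := h.closed.measurableSet
variable [IsFiniteMeasureOnCompacts (volume : Measure E)]
theorem Body.lt_top {K : Set E} (h : Body K) : volume K < ⊤ := h.compact.measure_lt_top
theorem Body.ne_top {K : Set E} (h : Body K) : volume K ≠ ⊤ := h.lt_top.ne
variable [(volume : Measure E).IsOpenPosMeasure]
theorem Body.pos {K : Set E} (h : Body K) : 0 < volume.real K := by
  rw [measureReal_def]
  apply ENNReal.toReal_pos _ h.ne_top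
  exact (Measure.measure_pos_of_mem_nhds volume (mem_interior_iff_mem_nhds.1 h.zero)).ne'
end meas

end Mahler

end

section
open MeasureTheory
open scoped RealInnerProductSpace
set_option linter.all false

namespace Mahler

section general
variable {E F : Type} [NormedAddCommGroup E] [NormedSpace ℝ E] [FiniteDimensional ℝ E]
  [NormedAddCommGroup F] [NormedSpace ℝ F] [FiniteDimensional ℝ F]

theorem Body.comap {K : Set F} (h : Body K) (j : E →ₗ[ℝ] F) (hj : Function.Injective j) :
    Body (j ⁻¹' K) := by
  have hemb := LinearMap.isClosedEmbedding_of_injective (LinearMap.ker_eq_bot.2 hj)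
  refine ⟨hemb.isCompact_preimage h.compact, h.conv.linear_preimage j, fun x hx => ?_, ?_⟩
  · simp only [Set.mem_preimage, map_neg] at *; exact h.symm _ hx
  · have : j ⁻¹' interior K ⊆ interior (j ⁻¹' K) :=
      preimage_interior_subset_interior_preimage hemb.continuous
    apply this
    simp [h.zero]

theorem pol_comap [Dot E] [Dot F] {K : Set F} (h : Body K) (j : E →ₗ[ℝ] F) (P : F →ₗ[ℝ] E)
    (hP : ∀ x y, Dot.dot (j x) y = Dot.dot x (P y)) : pol (j ⁻¹' K) = P '' (pol K) := by
  apply Set.Subset.antisymm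
  · intro z hz
    by_contra hzn
    have hc : IsCompact (P '' pol K) := h.pol.compact.image (LinearMap.continuous_of_finiteDimensional P)
    obtain ⟨w, hw, h1⟩ := sep (h.pol.conv.linear_image P) hc.isClosed
      ⟨0, h.pol.zero_mem, by simp⟩ hzn
    have : j w ∈ K := by
      rw [← pol_pol h]
      intro y hy
      have := hw (P y) ⟨y, hy, rfl⟩
      rwa [Dot.symm, ← hP, Dot.symm] at this
    have := hz w this
    rw [Dot.symm] at this
    linarith
  · rintro _ ⟨y, hy, rfl⟩ x hx
    rw [← hP]; exact hy _ hx

end general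

section cone
variable {F : Type} [NormedAddCommGroup F] [NormedSpace ℝ F] [FiniteDimensional ℝ F]
  [MeasureSpace F] [BorelSpace F] [(volume : Measure F).IsAddHaarMeasure]

def cone (h : ℝ) (x : F) (S : Set F) : Set (ℝ × F) :=
  {p | 0 < p.1 ∧ p.1 < h ∧ (1 - p.1 / h)⁻¹ • (p.2 - (p.1 / h) • x) ∈ S}

theorem cone_meas (h : ℝ) (x : F) {S : Set F} (hS : MeasurableSet S) : MeasurableSet (cone h x S) := by
  unfold cone
  apply MeasurableSet.inter
  · exact measurableSet_lt measurable_const measurable_fst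
  apply MeasurableSet.inter
  · exact measurableSet_lt measurable_fst measurable_const
  · have : Measurable fun p : ℝ × F => (1 - p.1 / h)⁻¹ • (p.2 - (p.1 / h) • x) := by fun_prop
    exact this hS

theorem cone_vol {h : ℝ} (hh : 0 ≤ h) (x : F) {S : Set F} (hS : MeasurableSet S) :
    volume (cone h x S) = ENNReal.ofReal (h / (Module.finrank ℝ F + 1)) * volume S := by
  rcases hh.eq_or_lt with rfl | hh
  · have : cone 0 x S = ∅ := by
      ext p; simp only [cone, Set.mem_setOf_eq, Set.mem_empty_iff_false, iff_false]
      rintro ⟨h1, h2, -⟩; linarith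
    simp [this]
  rw [Measure.volume_eq_prod, Measure.prod_apply (cone_meas h x hS)]
  have key : ∀ u : ℝ, volume (Prod.mk u ⁻¹' cone h x S) =
      (Set.Ioo 0 h).indicator (fun u => ENNReal.ofReal ((1 - u / h) ^ Module.finrank ℝ F) * volume S) u := by
    intro u
    by_cases hu : u ∈ Set.Ioo 0 h
    · rw [Set.indicator_of_mem hu]
      have hc : 0 < 1 - u / h := by rw [sub_pos, div_lt_one hh]; exact hu.2
      have : Prod.mk u ⁻¹' cone h x S = (fun w => w + (-((u / h) • x))) ⁻¹' (((1 - u / h)⁻¹ • ·) ⁻¹' S) := by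
        ext w
        simp [cone, hu.1, hu.2, sub_eq_add_neg]
      rw [this, measure_preimage_add_right, Measure.addHaar_preimage_smul _ (inv_ne_zero hc.ne')]
      congr 2
      rw [inv_pow, inv_inv, abs_of_pos (by positivity)]
    · rw [Set.indicator_of_notMem hu]
      have : Prod.mk u ⁻¹' cone h x S = ∅ := by
        ext w
        simp only [cone, Set.mem_preimage, Set.mem_setOf_eq, Set.mem_empty_iff_false, iff_false]
        rintro ⟨h1, h2, -⟩; exact hu ⟨h1, h2⟩
      simp [this]
  simp_rw [key]
  rw [lintegral_indicator measurableSet_Ioo, lintegral_mul_const _ (by fun_prop)]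
  congr 1
  rw [← ofReal_integral_eq_lintegral_ofReal]
  · congr 1
    rw [← integral_Ioc_eq_integral_Ioo, ← intervalIntegral.integral_of_le hh.le]
    have := intervalIntegral.integral_comp_sub_div (a := 0) (b := h) (fun y : ℝ => y ^ Module.finrank ℝ F) hh.ne' 1
    rw [this]
    simp only [hh.ne', div_self, sub_self, zero_div, sub_zero, integral_pow, ne_eq, not_false_eq_true]
    simp
    field_simp
  · apply (Continuous.integrableOn_Icc (by fun_prop)).mono_set Set.Ioo_subset_Icc_self
  · filter_upwards [self_mem_ae_restrict measurableSet_Ioo] with u hu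
    have hc : 0 < 1 - u / h := by rw [sub_pos, div_lt_one hh]; exact hu.2
    positivity

/-- thickening in the first coordinate -/
def thick (s : ℝ) (L : Set (ℝ × F)) : Set (ℝ × F) := {p | ∃ r : ℝ, |r| ≤ s ∧ (p.1 - r, p.2) ∈ L}

theorem thick_compact {s : ℝ} {L : Set (ℝ × F)} (hL : IsCompact L) : IsCompact (thick s L) := by
  have : thick s L = (fun q : ℝ × (ℝ × F) => (q.2.1 + q.1, q.2.2)) '' (Set.Icc (-s) s ×ˢ L) := by
    ext ⟨u, w⟩
    constructor
    · rintro ⟨r, hr, h⟩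
      exact ⟨(r, (u - r, w)), ⟨abs_le.1 hr, h⟩, by simp⟩
    · rintro ⟨⟨r, u', w'⟩, ⟨hr, h⟩, h2⟩
      simp only [Prod.mk.injEq] at h2
      obtain ⟨rfl, rfl⟩ := h2
      exact ⟨r, abs_le.2 hr, by simpa using h⟩
  rw [this]
  exact (isCompact_Icc.prod hL).image (by fun_prop)

theorem fiber_thick {s : ℝ} (hs : 0 ≤ s) {A : Set ℝ} (hA : IsCompact A) (hne : A.Nonempty) :
    volume A + ENNReal.ofReal (2 * s) ≤ volume {u | ∃ r : ℝ, |r| ≤ s ∧ u - r ∈ A} := by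
  obtain ⟨M, hM, hmax⟩ := hA.exists_isGreatest hne
  have h1 : (fun u => u + s) ⁻¹' A ∪ Set.Ioc (M - s) (M + s) ⊆ {u | ∃ r : ℝ, |r| ≤ s ∧ u - r ∈ A} := by
    rintro u (hu | hu)
    · exact ⟨-s, by simp [abs_of_nonneg hs], by simpa using hu⟩
    · exact ⟨u - M, abs_le.2 ⟨by linarith [hu.1], by linarith [hu.2]⟩, by simpa using hM⟩
  refine le_trans ?_ (measure_mono h1)
  rw [measure_union _ measurableSet_Ioc]
  · rw [measure_preimage_add_right, Real.volume_Ioc]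
    gcongr; linarith
  · rw [Set.disjoint_left]
    intro u hu hu'
    have := hmax hu
    linarith [hu'.1]

theorem thick_vol {s : ℝ} (hs : 0 ≤ s) {L : Set (ℝ × F)} (hL : IsCompact L) :
    volume L + ENNReal.ofReal (2 * s) * volume (Prod.snd '' L) ≤ volume (thick s L) := by
  have hP : IsCompact (Prod.snd '' L) := hL.image continuous_snd
  rw [Measure.volume_eq_prod, Measure.prod_apply_symm hL.measurableSet,
    Measure.prod_apply_symm (thick_compact hL).measurableSet]
  have h2 : ENNReal.ofReal (2 * s) * volume (Prod.snd '' L) =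
      ∫⁻ w, (Prod.snd '' L).indicator (fun _ => ENNReal.ofReal (2 * s)) w := by
    rw [lintegral_indicator hP.measurableSet]; simp
  rw [h2, ← lintegral_add_right _ (measurable_const.indicator hP.measurableSet)]
  apply lintegral_mono
  intro w
  by_cases hw : w ∈ Prod.snd '' L
  · simp only [Set.indicator_of_mem hw]
    obtain ⟨p, hp, rfl⟩ := hw
    refine fiber_thick hs (A := (fun x => (x, p.2)) ⁻¹' L) ?_ ⟨p.1, hp⟩
    have : (fun x => (x, p.2)) ⁻¹' L = Prod.fst '' (L ∩ {q | q.2 = p.2}) := by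
      ext u
      constructor
      · intro h; exact ⟨(u, p.2), ⟨h, rfl⟩, rfl⟩
      · rintro ⟨⟨a, b⟩, ⟨h1, h2⟩, rfl⟩
        simp only [Set.mem_setOf_eq] at h2
        subst h2; exact h1
    rw [this]
    exact (hL.inter_right (isClosed_eq continuous_snd continuous_const)).image continuous_fst
  · simp only [Set.indicator_of_notMem hw, add_zero]
    have : (fun x => (x, w)) ⁻¹' L = ∅ := by
      ext u; simp only [Set.mem_preimage, Set.mem_empty_iff_false, iff_false]
      intro h; exact hw ⟨_, h, rfl⟩
    simp [this]

end cone

abbrev V2 := ℝ × ℝ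
abbrev V := ℝ × ℝ × ℝ

theorem dot2 (x y : V2) : Dot.dot x y = x.1 * y.1 + x.2 * y.2 := rfl
theorem dot3 (x y : V) : Dot.dot x y = x.1 * y.1 + (x.2.1 * y.2.1 + x.2.2 * y.2.2) := rfl

def sg (b : Bool) : ℝ := if b then 1 else -1
@[simp] theorem sg_true : sg true = 1 := rfl
@[simp] theorem sg_false : sg false = -1 := rfl
theorem sg_mul_self (b : Bool) : sg b * sg b = 1 := by cases b <;> simp
@[simp] theorem sg_mul_sg_mul (b : Bool) (x : ℝ) : sg b * (sg b * x) = x := by cases b <;> simp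
theorem abs_sg (b : Bool) : |sg b| = 1 := by cases b <;> simp
theorem exists_sg (x : ℝ) : ∃ b, sg b * x = |x| := by
  rcases le_total 0 x with h | h
  · exact ⟨true, by simp [abs_of_nonneg h]⟩
  · exact ⟨false, by simp [abs_of_nonpos h]⟩
theorem exists_sg_nonneg (x : ℝ) : ∃ b, 0 ≤ sg b * x := by
  obtain ⟨b, h⟩ := exists_sg x; exact ⟨b, h ▸ abs_nonneg x⟩
theorem mp_sg (b : Bool) : MeasurePreserving (fun x : ℝ => sg b * x) := by
  cases b
  · simpa using Measure.measurePreserving_neg (volume : Measure ℝ)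
  · simp only [sg_true, one_mul]; exact MeasurePreserving.id _

/-- sign flips -/
def flip3 (a b c : Bool) : V ≃ₗ[ℝ] V where
  toFun x := (sg a * x.1, sg b * x.2.1, sg c * x.2.2)
  invFun x := (sg a * x.1, sg b * x.2.1, sg c * x.2.2)
  map_add' x y := by ext <;> simp <;> ring
  map_smul' x y := by ext <;> simp <;> ring
  left_inv x := by simp
  right_inv x := by simp
def flip2 (a b : Bool) : V2 ≃ₗ[ℝ] V2 where
  toFun x := (sg a * x.1, sg b * x.2)
  invFun x := (sg a * x.1, sg b * x.2)
  map_add' x y := by ext <;> simp <;> ring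
  map_smul' x y := by ext <;> simp <;> ring
  left_inv x := by simp
  right_inv x := by simp
def cyc : V ≃ₗ[ℝ] V where
  toFun x := (x.2.1, x.2.2, x.1)
  invFun x := (x.2.2, x.1, x.2.1)
  map_add' x y := by ext <;> simp
  map_smul' x y := by ext <;> simp
  left_inv x := by simp
  right_inv x := by simp
def swp : V2 ≃ₗ[ℝ] V2 where
  toFun x := (x.2, x.1)
  invFun x := (x.2, x.1)
  map_add' x y := by ext <;> simp
  map_smul' x y := by ext <;> simp
  left_inv x := by simp
  right_inv x := by simp
@[simp] theorem flip3_apply (a b c : Bool) (x : V) : flip3 a b c x = (sg a * x.1, sg b * x.2.1, sg c * x.2.2) := rfl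
@[simp] theorem flip2_apply (a b : Bool) (x : V2) : flip2 a b x = (sg a * x.1, sg b * x.2) := rfl
@[simp] theorem cyc_apply (x : V) : cyc x = (x.2.1, x.2.2, x.1) := rfl
@[simp] theorem swp_apply (x : V2) : swp x = (x.2, x.1) := rfl

theorem mp_flip3 (a b c : Bool) : MeasurePreserving (flip3 a b c) :=
  (mp_sg a).prod ((mp_sg b).prod (mp_sg c))
theorem mp_flip2 (a b : Bool) : MeasurePreserving (flip2 a b) := (mp_sg a).prod (mp_sg b)
theorem mp_swp : MeasurePreserving swp := Measure.measurePreserving_swap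
theorem mp_cyc : MeasurePreserving cyc :=
  (volume_preserving_prodAssoc (α₁ := ℝ) (β₁ := ℝ) (γ₁ := ℝ)).comp (Measure.measurePreserving_swap (μ := (volume : Measure ℝ)) (ν := (volume : Measure (ℝ × ℝ))))

theorem vol_pre {E : Type} [NormedAddCommGroup E] [NormedSpace ℝ E] [FiniteDimensional ℝ E]
    [MeasureSpace E] [BorelSpace E] {e : E ≃ₗ[ℝ] E}
    (he : MeasurePreserving e) (S : Set E) : volume (e ⁻¹' S) = volume S := 
  he.measure_preimage_emb (e.toContinuousLinearEquiv.toHomeomorph.measurableEmbedding) S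

theorem pol_flip3 (a b c : Bool) (K : Set V) : pol (flip3 a b c ⁻¹' K) = flip3 a b c ⁻¹' pol K :=
  pol_preimage _ _ (fun x y => by cases a <;> cases b <;> cases c <;> simp [dot3]) K
theorem pol_flip2 (a b : Bool) (K : Set V2) : pol (flip2 a b ⁻¹' K) = flip2 a b ⁻¹' pol K :=
  pol_preimage _ _ (fun x y => by cases a <;> cases b <;> simp [dot2]) K
theorem pol_cyc (K : Set V) : pol (cyc ⁻¹' K) = cyc ⁻¹' pol K :=
  pol_preimage _ _ (fun x y => by simp [dot3]; ring) K
theorem pol_swp (K : Set V2) : pol (swp ⁻¹' K) = swp ⁻¹' pol K :=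
  pol_preimage _ _ (fun x y => by simp [dot2]; ring) K

end Mahler

end

section
open MeasureTheory
open scoped RealInnerProductSpace
set_option linter.all false

namespace Mahler

theorem lim0 {S : ℝ} {g : ℝ → ℝ} (hg : Continuous g) (h : ∀ t, 0 < t → t ≤ 1 → S ≤ g t) : S ≤ g 0 := by
  have h1 : Filter.Tendsto g (nhdsWithin 0 (Set.Ioi 0)) (nhds (g 0)) :=
    (hg.tendsto 0).mono_left nhdsWithin_le_nhds
  refine ge_of_tendsto h1 ?_
  filter_upwards [Ioo_mem_nhdsGT (show (0:ℝ) < 1 by norm_num)] with t ht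
  exact h t ht.1 ht.2.le

def j1 : V2 →ₗ[ℝ] V where
  toFun x := (0, x.1, x.2)
  map_add' x y := by ext <;> simp
  map_smul' x y := by ext <;> simp
def j2 : V2 →ₗ[ℝ] V where
  toFun x := (x.2, 0, x.1)
  map_add' x y := by ext <;> simp
  map_smul' x y := by ext <;> simp
def j3 : V2 →ₗ[ℝ] V where
  toFun x := (x.1, x.2, 0)
  map_add' x y := by ext <;> simp
  map_smul' x y := by ext <;> simp
def p1 : V →ₗ[ℝ] V2 where
  toFun x := (x.2.1, x.2.2)
  map_add' x y := by ext <;> simp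
  map_smul' x y := by ext <;> simp
def p2 : V →ₗ[ℝ] V2 where
  toFun x := (x.2.2, x.1)
  map_add' x y := by ext <;> simp
  map_smul' x y := by ext <;> simp
def p3 : V →ₗ[ℝ] V2 where
  toFun x := (x.1, x.2.1)
  map_add' x y := by ext <;> simp
  map_smul' x y := by ext <;> simp
@[simp] theorem j1_apply (x : V2) : j1 x = (0, x.1, x.2) := rfl
@[simp] theorem j2_apply (x : V2) : j2 x = (x.2, 0, x.1) := rfl
@[simp] theorem j3_apply (x : V2) : j3 x = (x.1, x.2, 0) := rfl
@[simp] theorem p1_apply (x : V) : p1 x = (x.2.1, x.2.2) := rfl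
@[simp] theorem p2_apply (x : V) : p2 x = (x.2.2, x.1) := rfl
@[simp] theorem p3_apply (x : V) : p3 x = (x.1, x.2.1) := rfl
theorem j1_inj : Function.Injective j1 := by
  rintro ⟨a, b⟩ ⟨c, d⟩ h; simp at h; simp [h]
theorem j2_inj : Function.Injective j2 := by
  rintro ⟨a, b⟩ ⟨c, d⟩ h; simp at h; simp [h]
theorem j3_inj : Function.Injective j3 := by
  rintro ⟨a, b⟩ ⟨c, d⟩ h; simp at h; simp [h]

def sec1 (K : Set V) : Set V2 := j1 ⁻¹' K
def sec2 (K : Set V) : Set V2 := j2 ⁻¹' K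
def sec3 (K : Set V) : Set V2 := j3 ⁻¹' K

theorem mem_sec1 {K : Set V} {x : V2} : x ∈ sec1 K ↔ (0, x.1, x.2) ∈ K := Iff.rfl
theorem mem_sec2 {K : Set V} {x : V2} : x ∈ sec2 K ↔ (x.2, 0, x.1) ∈ K := Iff.rfl
theorem mem_sec3 {K : Set V} {x : V2} : x ∈ sec3 K ↔ (x.1, x.2, 0) ∈ K := Iff.rfl

theorem pol_sec1 {K : Set V} (h : Body K) : pol (sec1 K) = p1 '' pol K :=
  pol_comap h _ _ fun x y => by simp [dot2, dot3]
theorem pol_sec2 {K : Set V} (h : Body K) : pol (sec2 K) = p2 '' pol K :=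
  pol_comap h _ _ fun x y => by simp [dot2, dot3]; ring
theorem pol_sec3 {K : Set V} (h : Body K) : pol (sec3 K) = p3 '' pol K :=
  pol_comap h _ _ fun x y => by simp [dot2, dot3]

structure Equi2 (C : Set V2) : Prop where
  body : Body C
  quad : ∀ a b, volume.real (C ∩ {x | 0 < sg a * x.1 ∧ 0 < sg b * x.2}) = volume.real C / 4
  e1 : ((1, 0) : V2) ∈ C
  e2 : ((0, 1) : V2) ∈ C
  y1 : ∃ y ∈ pol C, y.1 = 1
  y2 : ∃ y ∈ pol C, y.2 = 1

structure Equi (K : Set V) : Prop where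
  body : Body K
  oct : ∀ a b c, volume.real (K ∩ {x | 0 < sg a * x.1 ∧ 0 < sg b * x.2.1 ∧ 0 < sg c * x.2.2})
    = volume.real K / 8
  s1 : Equi2 (sec1 K)
  s2 : Equi2 (sec2 K)
  s3 : Equi2 (sec3 K)

theorem real_pre {E : Type} [NormedAddCommGroup E] [NormedSpace ℝ E] [FiniteDimensional ℝ E]
    [MeasureSpace E] [BorelSpace E] {e : E ≃ₗ[ℝ] E}
    (he : MeasurePreserving e) (S : Set E) : volume.real (e ⁻¹' S) = volume.real S := by
  simp [measureReal_def, vol_pre he]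

theorem sg_xor (a b : Bool) : sg (a == b) = sg a * sg b := by cases a <;> cases b <;> simp

theorem Equi2.flip {C : Set V2} (h : Equi2 C) (a b : Bool) : Equi2 (flip2 a b ⁻¹' C) where
  body := h.body.preimage _
  quad c d := by
    have : flip2 a b ⁻¹' C ∩ {x | 0 < sg c * x.1 ∧ 0 < sg d * x.2} =
      flip2 a b ⁻¹' (C ∩ {x | 0 < sg (c == a) * x.1 ∧ 0 < sg (d == b) * x.2}) := by
      ext x
      simp [sg_xor, mul_assoc]
    rw [this, real_pre (mp_flip2 a b), real_pre (mp_flip2 a b), h.quad]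
  e1 := by
    have := h.body.symm _ h.e1
    have h1 := h.e1
    cases a <;> simp_all
  e2 := by
    have := h.body.symm _ h.e2
    have h1 := h.e2
    cases b <;> simp_all
  y1 := by
    obtain ⟨⟨y1, y2⟩, hy, h1⟩ := h.y1
    rw [pol_flip2]
    cases a
    · exact ⟨flip2 true (!b) (y1, y2), by cases b <;> simpa using h.body.pol.symm _ hy, by simpa using h1⟩
    · exact ⟨flip2 true b (y1, y2), by cases b <;> simpa using hy, by simpa using h1⟩
  y2 := by
    obtain ⟨⟨y1, y2⟩, hy, h1⟩ := h.y2
    rw [pol_flip2]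
    cases b
    · exact ⟨flip2 (!a) true (y1, y2), by cases a <;> simpa using h.body.pol.symm _ hy, by simpa using h1⟩
    · exact ⟨flip2 a true (y1, y2), by cases a <;> simpa using hy, by simpa using h1⟩

theorem Equi.flip {K : Set V} (h : Equi K) (a b c : Bool) : Equi (flip3 a b c ⁻¹' K) where
  body := h.body.preimage _
  oct d e f := by
    have : flip3 a b c ⁻¹' K ∩ {x | 0 < sg d * x.1 ∧ 0 < sg e * x.2.1 ∧ 0 < sg f * x.2.2} =
      flip3 a b c ⁻¹' (K ∩ {x | 0 < sg (d == a) * x.1 ∧ 0 < sg (e == b) * x.2.1 ∧ 0 < sg (f == c) * x.2.2}) := by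
      ext x
      simp [sg_xor, mul_assoc]
    rw [this, real_pre (mp_flip3 a b c), real_pre (mp_flip3 a b c), h.oct]
  s1 := by
    have : sec1 (flip3 a b c ⁻¹' K) = flip2 b c ⁻¹' (sec1 K) := by ext; simp [sec1]
    rw [this]; exact h.s1.flip _ _
  s2 := by
    have : sec2 (flip3 a b c ⁻¹' K) = flip2 c a ⁻¹' (sec2 K) := by ext; simp [sec2]
    rw [this]; exact h.s2.flip _ _
  s3 := by
    have : sec3 (flip3 a b c ⁻¹' K) = flip2 a b ⁻¹' (sec3 K) := by ext; simp [sec3]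
    rw [this]; exact h.s3.flip _ _

theorem Equi.cyc {K : Set V} (h : Equi K) : Equi (cyc ⁻¹' K) where
  body := h.body.preimage _
  oct d e f := by
    have : Mahler.cyc ⁻¹' K ∩ {x | 0 < sg d * x.1 ∧ 0 < sg e * x.2.1 ∧ 0 < sg f * x.2.2} =
      Mahler.cyc ⁻¹' (K ∩ {x | 0 < sg e * x.1 ∧ 0 < sg f * x.2.1 ∧ 0 < sg d * x.2.2}) := by
      ext x
      simp; tauto
    rw [this, real_pre mp_cyc, real_pre mp_cyc, h.oct]
  s1 := h.s3
  s2 := h.s1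
  s3 := h.s2

theorem cone_mem {F : Type} [NormedAddCommGroup F] [NormedSpace ℝ F] {h : ℝ} {x : F} {S : Set F}
    {p : ℝ × F} (hp : p ∈ cone h x S) : ∃ t : ℝ, 0 < t ∧ t < 1 ∧ 0 < h ∧ ∃ s ∈ S,
    p = (t * h, (1 - t) • s + t • x) := by
  obtain ⟨h1, h2, h3⟩ := hp
  have hh : 0 < h := h1.trans h2
  refine ⟨p.1 / h, by positivity, (div_lt_one hh).2 h2, hh, _, h3, ?_⟩
  have hc : 0 < 1 - p.1 / h := by rw [sub_pos, div_lt_one hh]; exact h2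
  ext
  · simp; field_simp
  · simp only; rw [smul_smul, mul_inv_cancel₀ hc.ne', one_smul]; simp

theorem quad_meas (a b : ℝ) : MeasurableSet {x : V2 | 0 < a * x.1 ∧ 0 < b * x.2} :=
  (measurableSet_lt (f := fun _ => (0:ℝ)) (g := fun x : V2 => a * x.1) measurable_const (by fun_prop)).inter
    (measurableSet_lt (f := fun _ => (0:ℝ)) (g := fun x : V2 => b * x.2) measurable_const (by fun_prop))

theorem oct_meas (a b c : ℝ) : MeasurableSet {x : V | 0 < a * x.1 ∧ 0 < b * x.2.1 ∧ 0 < c * x.2.2} :=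
  (measurableSet_lt (f := fun _ => (0:ℝ)) (g := fun x : V => a * x.1) measurable_const (by fun_prop)).inter
    ((measurableSet_lt (f := fun _ => (0:ℝ)) (g := fun x : V => b * x.2.1) measurable_const (by fun_prop)).inter
    (measurableSet_lt (f := fun _ => (0:ℝ)) (g := fun x : V => c * x.2.2) measurable_const (by fun_prop)))

theorem two_le {E : Type} [MeasureSpace E] {A B C : Set E} (hB : MeasurableSet B) (hC : volume C ≠ ⊤)
    (h1 : A ⊆ C) (h2 : B ⊆ C)
    (hAB : ∀ x ∈ A, x ∈ B → False) : volume.real A + volume.real B ≤ volume.real C := by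
  have hd : Disjoint A B := Set.disjoint_left.2 hAB
  rw [← measureReal_union hd hB (measure_ne_top_of_subset h1 hC) (measure_ne_top_of_subset h2 hC)]
  exact measureReal_mono (Set.union_subset h1 h2) hC

theorem cone_real {F : Type} [NormedAddCommGroup F] [NormedSpace ℝ F] [FiniteDimensional ℝ F]
    [MeasureSpace F] [BorelSpace F] [(volume : Measure F).IsAddHaarMeasure]
    {h : ℝ} (hh : 0 ≤ h) (x : F) {S : Set F} (hS : MeasurableSet S) :
    volume.real (cone h x S) = h / (Module.finrank ℝ F + 1) * volume.real S := by
  rw [measureReal_def, cone_vol hh x hS, ENNReal.toReal_mul, ENNReal.toReal_ofReal (by positivity), measureReal_def]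

theorem Equi2.cones {C : Set V2} (h : Equi2 C) {x : V2} (hx : x ∈ C) (h1 : 0 ≤ x.1) (h2 : 0 ≤ x.2) :
    ∃ U : Set V2, MeasurableSet U ∧ U ⊆ C ∩ {x | 0 < sg true * x.1 ∧ 0 < sg true * x.2} ∧
    volume.real U = (x.1 + x.2) / 2 ∧ ∀ p ∈ U, ∃ t : ℝ, 0 ≤ t ∧ t ≤ 1 ∧ ∃ k ∈ C, 0 ≤ k.1 ∧ 0 ≤ k.2 ∧
      k.1 * k.2 = 0 ∧ p = (1 - t) • k + t • x := by
  have ax : ∀ s : ℝ, s ∈ Set.Ioo (0:ℝ) 1 → ((0, s) : V2) ∈ C := by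
    intro s hs
    have := h.body.smul_mem h.e2 (t := s) (abs_le.2 ⟨by linarith [hs.1], hs.2.le⟩)
    simpa using this
  have ay : ∀ s : ℝ, s ∈ Set.Ioo (0:ℝ) 1 → ((s, 0) : V2) ∈ C := by
    intro s hs
    have := h.body.smul_mem h.e1 (t := s) (abs_le.2 ⟨by linarith [hs.1], hs.2.le⟩)
    simpa using this
  have hA := cone_real h1 x.2 (measurableSet_Ioo (a := (0:ℝ)) (b := 1))
  have hB := cone_real h2 x.1 (measurableSet_Ioo (a := (0:ℝ)) (b := 1))
  rw [← real_pre mp_swp] at hB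
  have mA := cone_meas x.1 x.2 (measurableSet_Ioo (a := (0:ℝ)) (b := 1))
  have mB := swp.toContinuousLinearEquiv.continuous.measurable (cone_meas x.2 x.1 (measurableSet_Ioo (a := (0:ℝ)) (b := 1)))
  set A := cone x.1 x.2 (Set.Ioo 0 1)
  set B := swp ⁻¹' cone x.2 x.1 (Set.Ioo 0 1)
  have kA : ∀ p ∈ A, ∃ t : ℝ, 0 < t ∧ t < 1 ∧ 0 < x.1 ∧ ∃ s ∈ Set.Ioo (0:ℝ) 1, p = (t * x.1, (1 - t) * s + t * x.2) := by
    intro p hp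
    obtain ⟨t, t0, t1, hh, s, hs, rfl⟩ := cone_mem hp
    exact ⟨t, t0, t1, hh, s, hs, by ext <;> simp⟩
  have kB : ∀ p ∈ B, ∃ t : ℝ, 0 < t ∧ t < 1 ∧ 0 < x.2 ∧ ∃ s ∈ Set.Ioo (0:ℝ) 1, p = ((1 - t) * s + t * x.1, t * x.2) := by
    intro p hp
    obtain ⟨t, t0, t1, hh, s, hs, hp⟩ := cone_mem hp
    simp at hp
    exact ⟨t, t0, t1, hh, s, hs, by ext <;> simp [hp]⟩
  have hd : Disjoint A B := by
    refine Set.disjoint_left.2 fun p hp hp' => ?_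
    obtain ⟨t, t0, t1, hh, s, hs, rfl⟩ := kA p hp
    obtain ⟨t', t0', t1', hh', s', hs', hp'⟩ := kB _ hp'
    simp at hp'
    have a1 : 0 < (1 - t) * s := mul_pos (by linarith) hs.1
    have a2 : 0 < (1 - t') * s' := mul_pos (by linarith) hs'.1
    have b1 : t * x.1 = (1 - t') * s' + t' * x.1 := hp'.1
    have b2 : (1 - t) * s + t * x.2 = t' * x.2 := hp'.2
    have c1 : t' < t := by by_contra hc; push Not at hc; nlinarith
    have c2 : t < t' := by by_contra hc; push Not at hc; nlinarith
    linarith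
  have sub : A ∪ B ⊆ C ∩ {x | 0 < sg true * x.1 ∧ 0 < sg true * x.2} := by
    rintro p (hp | hp)
    · obtain ⟨t, t0, t1, hh, s, hs, rfl⟩ := kA p hp
      refine ⟨?_, ?_, ?_⟩
      · have := h.body.conv (ax s hs) hx (a := 1 - t) (b := t) (by linarith) (by linarith) (by ring)
        convert this using 1; ext <;> simp
      · simp; positivity
      · have := hs.1; simp
        have : 0 < (1 - t) * s := mul_pos (by linarith) this
        positivity
    · obtain ⟨t, t0, t1, hh, s, hs, rfl⟩ := kB p hp
      refine ⟨?_, ?_, ?_⟩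
      · have := h.body.conv (ay s hs) hx (a := 1 - t) (b := t) (by linarith) (by linarith) (by ring)
        convert this using 1; ext <;> simp
      · have := hs.1; simp
        have : 0 < (1 - t) * s := mul_pos (by linarith) this
        positivity
      · simp; positivity
  have nt := measure_ne_top_of_subset (sub.trans Set.inter_subset_left) h.body.ne_top
  refine ⟨A ∪ B, mA.union mB, sub, ?_, ?_⟩
  · rw [measureReal_union hd mB (measure_ne_top_of_subset Set.subset_union_left nt)
      (measure_ne_top_of_subset Set.subset_union_right nt), hA, hB]
    simp; ring
  · rintro p (hp | hp)
    · obtain ⟨t, t0, t1, hh, s, hs, rfl⟩ := kA p hp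
      exact ⟨t, t0.le, t1.le, (0, s), ax s hs, le_rfl, hs.1.le, by simp, by ext <;> simp⟩
    · obtain ⟨t, t0, t1, hh, s, hs, rfl⟩ := kB p hp
      exact ⟨t, t0.le, t1.le, (s, 0), ay s hs, hs.1.le, le_rfl, by simp, by ext <;> simp⟩

theorem Equi2.lin0 {C : Set V2} (h : Equi2 C) {x : V2} (hx : x ∈ C) (h1 : 0 ≤ x.1) (h2 : 0 ≤ x.2) :
    x.1 + x.2 ≤ volume.real C / 2 := by
  obtain ⟨U, -, hU, hv, -⟩ := h.cones hx h1 h2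
  have := measureReal_mono hU (measure_ne_top_of_subset Set.inter_subset_left h.body.ne_top)
  rw [h.quad, hv] at this
  linarith

theorem Equi2.lin {C : Set V2} (h : Equi2 C) {x : V2} (hx : x ∈ C) :
    |x.1| + |x.2| ≤ volume.real C / 2 := by
  obtain ⟨a, ha⟩ := exists_sg x.1
  obtain ⟨b, hb⟩ := exists_sg x.2
  have := (h.flip a b).lin0 (x := flip2 a b x) (by simpa using hx) (by simp [ha]) (by simp [hb])
  simpa [ha, hb, real_pre (mp_flip2 a b)] using this

def Q : Set V2 := {x | 0 < 1 * x.1 ∧ 0 < 1 * x.2}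
theorem Q_mem {x : V2} : x ∈ Q ↔ 0 < x.1 ∧ 0 < x.2 := by simp [Q]

theorem Equi.cones {K : Set V} (h : Equi K) {x : V} (hx : x ∈ K) (h1 : 0 ≤ x.1) (h2 : 0 ≤ x.2.1)
    (h3 : 0 ≤ x.2.2) : 
    ∃ U : Set V, MeasurableSet U ∧ U ⊆ K ∩ {x | 0 < sg true * x.1 ∧ 0 < sg true * x.2.1 ∧ 0 < sg true * x.2.2} ∧
    volume.real U = (x.1 * volume.real (sec1 K) + x.2.1 * volume.real (sec2 K) +
    x.2.2 * volume.real (sec3 K)) / 12 ∧ 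
    ∀ p ∈ U, ∃ t : ℝ, 0 ≤ t ∧ t ≤ 1 ∧ ∃ k ∈ K, 0 ≤ k.1 ∧ 0 ≤ k.2.1 ∧ 0 ≤ k.2.2 ∧
      k.1 * k.2.1 * k.2.2 = 0 ∧ p = (1 - t) • k + t • x := by
  have q1 := h.s1.quad true true
  have q2 := h.s2.quad true true
  have q3 := h.s3.quad true true
  simp only [sg_true] at q1 q2 q3
  have m1 := h.s1.body.measurable.inter (quad_meas 1 1)
  have m2 := h.s2.body.measurable.inter (quad_meas 1 1)
  have m3 := h.s3.body.measurable.inter (quad_meas 1 1)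
  have hA := cone_real h1 (x.2.1, x.2.2) m1
  have hB := cone_real h2 (x.2.2, x.1) m2
  have hC := cone_real h3 (x.1, x.2.1) m3
  rw [← real_pre mp_cyc] at hB
  rw [← real_pre mp_cyc, ← real_pre mp_cyc] at hC
  rw [q1] at hA
  rw [q2] at hB
  rw [q3] at hC
  set A := cone x.1 (x.2.1, x.2.2) (sec1 K ∩ {x | 0 < 1 * x.1 ∧ 0 < 1 * x.2}) with hAdef
  set B := Mahler.cyc ⁻¹' cone x.2.1 (x.2.2, x.1) (sec2 K ∩ {x | 0 < 1 * x.1 ∧ 0 < 1 * x.2}) with hBdef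
  set C := Mahler.cyc ⁻¹' (Mahler.cyc ⁻¹' cone x.2.2 (x.1, x.2.1) (sec3 K ∩ {x | 0 < 1 * x.1 ∧ 0 < 1 * x.2})) with hCdef
  have cc := Mahler.cyc.toContinuousLinearEquiv.continuous.measurable
  have mB : MeasurableSet B := cc (cone_meas _ _ m2)
  have mC : MeasurableSet C := cc (cc (cone_meas _ _ m3))
  have kA : ∀ p ∈ A, ∃ t, 0 < t ∧ t < 1 ∧ 0 < x.1 ∧ ∃ u v, 0 < u ∧ 0 < v ∧ (0, u, v) ∈ K ∧
      p = (t * x.1, (1 - t) * u + t * x.2.1, (1 - t) * v + t * x.2.2) := by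
    intro p hp
    obtain ⟨t, t0, t1, hh, ⟨u, v⟩, ⟨hs, hs'⟩, rfl⟩ := cone_mem hp
    simp at hs'
    exact ⟨t, t0, t1, hh, u, v, hs'.1, hs'.2, hs, by ext <;> simp⟩
  have kB : ∀ p ∈ B, ∃ t, 0 < t ∧ t < 1 ∧ 0 < x.2.1 ∧ ∃ u v, 0 < u ∧ 0 < v ∧ (v, 0, u) ∈ K ∧
      p = ((1 - t) * v + t * x.1, t * x.2.1, (1 - t) * u + t * x.2.2) := by
    intro p hp
    obtain ⟨t, t0, t1, hh, ⟨u, v⟩, ⟨hs, hs'⟩, hp⟩ := cone_mem hp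
    simp at hs' hp
    exact ⟨t, t0, t1, hh, u, v, hs'.1, hs'.2, hs, by ext <;> simp [hp]⟩
  have kC : ∀ p ∈ C, ∃ t, 0 < t ∧ t < 1 ∧ 0 < x.2.2 ∧ ∃ u v, 0 < u ∧ 0 < v ∧ (u, v, 0) ∈ K ∧
      p = ((1 - t) * u + t * x.1, (1 - t) * v + t * x.2.1, t * x.2.2) := by
    intro p hp
    obtain ⟨t, t0, t1, hh, ⟨u, v⟩, ⟨hs, hs'⟩, hp⟩ := cone_mem hp
    simp at hs' hp
    exact ⟨t, t0, t1, hh, u, v, hs'.1, hs'.2, hs, by ext <;> simp [hp]⟩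
  have sub : A ∪ B ∪ C ⊆ K ∩ {x | 0 < sg true * x.1 ∧ 0 < sg true * x.2.1 ∧ 0 < sg true * x.2.2} := by
    rintro p ((hp | hp) | hp)
    · obtain ⟨t, t0, t1, hh, u, v, hu, hv, hK, rfl⟩ := kA p hp
      have := h.body.conv hK hx (a := 1 - t) (b := t) (by linarith) (by linarith) (by ring)
      have a1 : 0 < (1 - t) * u := mul_pos (by linarith) hu
      have a2 : 0 < (1 - t) * v := mul_pos (by linarith) hv
      refine ⟨by convert this using 1; ext <;> simp, ?_, ?_, ?_⟩ <;> simp <;> positivity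
    · obtain ⟨t, t0, t1, hh, u, v, hu, hv, hK, rfl⟩ := kB p hp
      have := h.body.conv hK hx (a := 1 - t) (b := t) (by linarith) (by linarith) (by ring)
      have a1 : 0 < (1 - t) * u := mul_pos (by linarith) hu
      have a2 : 0 < (1 - t) * v := mul_pos (by linarith) hv
      refine ⟨by convert this using 1; ext <;> simp, ?_, ?_, ?_⟩ <;> simp <;> positivity
    · obtain ⟨t, t0, t1, hh, u, v, hu, hv, hK, rfl⟩ := kC p hp
      have := h.body.conv hK hx (a := 1 - t) (b := t) (by linarith) (by linarith) (by ring)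
      have a1 : 0 < (1 - t) * u := mul_pos (by linarith) hu
      have a2 : 0 < (1 - t) * v := mul_pos (by linarith) hv
      refine ⟨by convert this using 1; ext <;> simp, ?_, ?_, ?_⟩ <;> simp <;> positivity
  have nt := measure_ne_top_of_subset (sub.trans Set.inter_subset_left) h.body.ne_top
  have d1 : Disjoint A B := by
    refine Set.disjoint_left.2 fun p hp hp' => ?_
    obtain ⟨t, t0, t1, hh, u, v, hu, hv, hK, rfl⟩ := kA p hp
    obtain ⟨t', t0', t1', hh', u', v', hu', hv', hK', hp'⟩ := kB _ hp'
    simp at hp'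
    obtain ⟨b1, b2, b3⟩ := hp'
    have a1 : 0 < (1 - t) * u := mul_pos (by linarith) hu
    have a1' : 0 < (1 - t') * v' := mul_pos (by linarith) hv'
    have c1 : t' < t := by by_contra hc; push Not at hc; nlinarith
    nlinarith
  have d2 : Disjoint (A ∪ B) C := by
    refine Set.disjoint_left.2 fun p hp hp' => ?_
    obtain ⟨t', t0', t1', hh', u', v', hu', hv', hK', hp'⟩ := kC _ hp'
    have a1' : 0 < (1 - t') * u' := mul_pos (by linarith) hu'
    have a2' : 0 < (1 - t') * v' := mul_pos (by linarith) hv'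
    rcases hp with hp | hp
    · obtain ⟨t, t0, t1, hh, u, v, hu, hv, hK, rfl⟩ := kA p hp
      simp at hp'
      obtain ⟨b1, b2, b3⟩ := hp'
      have a2 : 0 < (1 - t) * v := mul_pos (by linarith) hv
      have c1 : t' < t := by by_contra hc; push Not at hc; nlinarith
      nlinarith
    · obtain ⟨t, t0, t1, hh, u, v, hu, hv, hK, rfl⟩ := kB p hp
      simp at hp'
      obtain ⟨b1, b2, b3⟩ := hp'
      have a1 : 0 < (1 - t) * u := mul_pos (by linarith) hu
      have c1 : t' < t := by by_contra hc; push Not at hc; nlinarith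
      nlinarith
  have mA : MeasurableSet A := cone_meas _ _ m1
  have nAB := measure_ne_top_of_subset Set.subset_union_left nt
  refine ⟨A ∪ B ∪ C, (mA.union mB).union mC, sub, ?_, ?_⟩
  · rw [measureReal_union d2 mC nAB (measure_ne_top_of_subset Set.subset_union_right nt),
      measureReal_union d1 mB (measure_ne_top_of_subset Set.subset_union_left nAB)
      (measure_ne_top_of_subset Set.subset_union_right nAB), hA, hB, hC]
    simp; ring
  · rintro p ((hp | hp) | hp)
    · obtain ⟨t, t0, t1, hh, u, v, hu, hv, hK, rfl⟩ := kA p hp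
      exact ⟨t, t0.le, t1.le, _, hK, le_rfl, hu.le, hv.le, by simp, by ext <;> simp⟩
    · obtain ⟨t, t0, t1, hh, u, v, hu, hv, hK, rfl⟩ := kB p hp
      exact ⟨t, t0.le, t1.le, _, hK, hv.le, le_rfl, hu.le, by simp, by ext <;> simp⟩
    · obtain ⟨t, t0, t1, hh, u, v, hu, hv, hK, rfl⟩ := kC p hp
      exact ⟨t, t0.le, t1.le, _, hK, hu.le, hv.le, le_rfl, by simp, by ext <;> simp⟩

theorem Equi.lin0 {K : Set V} (h : Equi K) {x : V} (hx : x ∈ K) (h1 : 0 ≤ x.1) (h2 : 0 ≤ x.2.1)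
    (h3 : 0 ≤ x.2.2) : x.1 * volume.real (sec1 K) + x.2.1 * volume.real (sec2 K) +
    x.2.2 * volume.real (sec3 K) ≤ 3 / 2 * volume.real K := by
  obtain ⟨U, -, hU, hv, -⟩ := h.cones hx h1 h2 h3
  have := measureReal_mono hU (measure_ne_top_of_subset Set.inter_subset_left h.body.ne_top)
  rw [h.oct, hv] at this
  linarith

theorem Equi.lin {K : Set V} (h : Equi K) {x : V} (hx : x ∈ K) :
    |x.1| * volume.real (sec1 K) + |x.2.1| * volume.real (sec2 K) +
    |x.2.2| * volume.real (sec3 K) ≤ 3 / 2 * volume.real K := by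
  obtain ⟨a, ha⟩ := exists_sg x.1
  obtain ⟨b, hb⟩ := exists_sg x.2.1
  obtain ⟨c, hc⟩ := exists_sg x.2.2
  have := (h.flip a b c).lin0 (x := flip3 a b c x) (by simpa using hx) (by simp [ha]) (by simp [hb]) (by simp [hc])
  have e1 : sec1 (flip3 a b c ⁻¹' K) = flip2 b c ⁻¹' (sec1 K) := by ext; simp [sec1]
  have e2 : sec2 (flip3 a b c ⁻¹' K) = flip2 c a ⁻¹' (sec2 K) := by ext; simp [sec2]
  have e3 : sec3 (flip3 a b c ⁻¹' K) = flip2 a b ⁻¹' (sec3 K) := by ext; simp [sec3]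
  rw [e1, e2, e3, real_pre (mp_flip2 _ _), real_pre (mp_flip2 _ _), real_pre (mp_flip2 _ _), real_pre (mp_flip3 _ _ _)] at this
  simpa [ha, hb, hc] using this

end Mahler

end

section
open MeasureTheory
open scoped RealInnerProductSpace Pointwise
set_option linter.all false

namespace Mahler

instance : (volume : Measure V2).IsAddHaarMeasure :=
  Measure.prod.instIsAddHaarMeasure (volume : Measure ℝ) (volume : Measure ℝ)
instance : (volume : Measure V).IsAddHaarMeasure :=
  Measure.prod.instIsAddHaarMeasure (volume : Measure ℝ) (volume : Measure V2)

def mink {E : Type} [AddCommGroup E] [Module ℝ E] (L : Set E) (t : ℝ) (B : Set E) : Set E :=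
  {p | ∃ l ∈ L, ∃ b ∈ B, p = l + t • b}

theorem mink_le {E : Type} [NormedAddCommGroup E] [NormedSpace ℝ E] [FiniteDimensional ℝ E]
    [MeasureSpace E] [BorelSpace E] [(volume : Measure E).IsAddHaarMeasure]
    {L B : Set E} (hL : Convex ℝ L) (hB : B ⊆ L) {t : ℝ} (ht : 0 ≤ t) :
    volume (mink L t B) ≤ ENNReal.ofReal ((1 + t) ^ Module.finrank ℝ E) * volume L := by
  have : mink L t B ⊆ (1 + t) • L := by
    rintro p ⟨l, hl, b, hb, rfl⟩
    refine ⟨(1/(1+t)) • l + (t/(1+t)) • b, hL hl (hB hb) (by positivity) (by positivity) (by field_simp), ?_⟩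
    simp only [smul_add, smul_smul]
    congr 2
    · field_simp; simp
    · field_simp
  refine (measure_mono this).trans ?_
  rw [Measure.addHaar_smul, abs_of_nonneg (by positivity)]

def box3 (c1 c2 c3 : ℝ) : Set V := {x | |x.1| ≤ c1 ∧ |x.2.1| ≤ c2 ∧ |x.2.2| ≤ c3}
def box2 (c1 c2 : ℝ) : Set V2 := {x | |x.1| ≤ c1 ∧ |x.2| ≤ c2}

theorem mink3 {L : Set V} (hL : IsCompact L) {c1 c2 c3 t : ℝ} (h1 : 0 ≤ c1) (h2 : 0 ≤ c2) (h3 : 0 ≤ c3)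
    (ht : 0 < t) : volume L + ENNReal.ofReal (2 * (t * c1)) * volume (p1 '' L) +
      ENNReal.ofReal (2 * (t * c2)) * volume (p2 '' L) +
      ENNReal.ofReal (2 * (t * c3)) * volume (p3 '' L) ≤ volume (mink L t (box3 c1 c2 c3)) := by
  have a1 := thick_vol (mul_nonneg ht.le h1) hL
  have k1 : IsCompact (thick (t * c1) L) := thick_compact hL
  have k1' : IsCompact (cyc.symm ⁻¹' (thick (t * c1) L)) :=
    cyc.symm.toContinuousLinearEquiv.toHomeomorph.isCompact_preimage.2 k1
  have a2 := thick_vol (mul_nonneg ht.le h2) k1'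
  have k2 : IsCompact (cyc ⁻¹' (thick (t * c2) (cyc.symm ⁻¹' (thick (t * c1) L)))) :=
    cyc.toContinuousLinearEquiv.toHomeomorph.isCompact_preimage.2 (thick_compact k1')
  have k2' : IsCompact (cyc ⁻¹' (cyc ⁻¹' (thick (t * c2) (cyc.symm ⁻¹' (thick (t * c1) L))))) :=
    cyc.toContinuousLinearEquiv.toHomeomorph.isCompact_preimage.2 k2
  have a3 := thick_vol (mul_nonneg ht.le h3) k2'
  have sub1 : L ⊆ thick (t * c1) L := fun p hp => ⟨0, by simp; positivity, by simpa using hp⟩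
  have mps : MeasurePreserving cyc.symm := by
    have := mp_cyc.symm (cyc.toContinuousLinearEquiv.toHomeomorph.toMeasurableEquiv)
    exact this
  rw [vol_pre mps] at a2
  rw [vol_pre mp_cyc, vol_pre mp_cyc] at a3
  have q1 : volume (p1 '' L) ≤ volume (Prod.snd '' L) := by
    apply measure_mono
    rintro _ ⟨p, hp, rfl⟩; exact ⟨p, hp, rfl⟩
  have q2 : volume (p2 '' L) ≤ volume (Prod.snd '' (cyc.symm ⁻¹' (thick (t * c1) L))) := by
    apply measure_mono
    rintro _ ⟨p, hp, rfl⟩; exact ⟨cyc p, sub1 hp, rfl⟩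
  have q3 : volume (p3 '' L) ≤ volume (Prod.snd '' (cyc ⁻¹' (cyc ⁻¹' (thick (t * c2) (cyc.symm ⁻¹' (thick (t * c1) L)))))) := by
    apply measure_mono
    rintro _ ⟨p, hp, rfl⟩
    refine ⟨(p.2.2, p.1, p.2.1), ?_, rfl⟩
    refine ⟨0, by simp; positivity, ?_⟩
    obtain ⟨r, hr, h⟩ := sub1 hp
    simp only [sub_zero]
    exact ⟨r, hr, h⟩
  have fin : volume (thick (t * c3) (cyc ⁻¹' (cyc ⁻¹' (thick (t * c2) (cyc.symm ⁻¹' (thick (t * c1) L)))))) ≤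
      volume (mink L t (box3 c1 c2 c3)) := by
    rw [← vol_pre mps]
    apply measure_mono
    rintro ⟨x, y, z⟩ ⟨r3, hr3, ⟨r2, hr2, ⟨r1, hr1, h⟩⟩⟩
    refine ⟨_, h, (r1 / t, r2 / t, r3 / t), ?_, ?_⟩
    · simp only [box3, Set.mem_setOf_eq, abs_div, abs_of_pos ht, div_le_iff₀ ht]
      exact ⟨by linarith, by linarith, by linarith⟩
    · have e1 : cyc.symm (x, y, z) = (z, x, y) := rfl
      have e2 : ∀ a b c : ℝ, cyc.symm (a, b, c) = (c, a, b) := fun _ _ _ => rfl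
      ext <;> simp [e2] <;> field_simp <;> ring
  calc _ ≤ _ := add_le_add (add_le_add (add_le_add le_rfl (mul_le_mul_right q1 _)) (mul_le_mul_right q2 _)) (mul_le_mul_right q3 _)
    _ ≤ _ := add_le_add (add_le_add a1 le_rfl) le_rfl
    _ ≤ _ := add_le_add a2 le_rfl
    _ ≤ _ := a3
    _ ≤ _ := fin

theorem mink2 {L : Set V2} (hL : IsCompact L) {c1 c2 t : ℝ} (h1 : 0 ≤ c1) (h2 : 0 ≤ c2) 
    (ht : 0 < t) : volume L + ENNReal.ofReal (2 * (t * c1)) * volume (Prod.snd '' L) +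
      ENNReal.ofReal (2 * (t * c2)) * volume (Prod.fst '' L) ≤ volume (mink L t (box2 c1 c2)) := by
  have a1 := thick_vol (mul_nonneg ht.le h1) hL
  have k1 : IsCompact (thick (t * c1) L) := thick_compact hL
  have k1' : IsCompact (swp ⁻¹' (thick (t * c1) L)) :=
    swp.toContinuousLinearEquiv.toHomeomorph.isCompact_preimage.2 k1
  have a2 := thick_vol (mul_nonneg ht.le h2) k1'
  have sub1 : L ⊆ thick (t * c1) L := fun p hp => ⟨0, by simp; positivity, by simpa using hp⟩
  rw [vol_pre mp_swp] at a2
  have q2 : volume (Prod.fst '' L) ≤ volume (Prod.snd '' (swp ⁻¹' (thick (t * c1) L))) := by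
    apply measure_mono
    rintro _ ⟨p, hp, rfl⟩; exact ⟨swp p, by simpa using sub1 hp, rfl⟩
  have fin : volume (thick (t * c2) (swp ⁻¹' (thick (t * c1) L))) ≤
      volume (mink L t (box2 c1 c2)) := by
    rw [← vol_pre mp_swp]
    apply measure_mono
    rintro ⟨x, y⟩ ⟨r2, hr2, ⟨r1, hr1, h⟩⟩
    refine ⟨_, h, (r1 / t, r2 / t), ?_, ?_⟩
    · simp only [box2, Set.mem_setOf_eq, abs_div, abs_of_pos ht, div_le_iff₀ ht]
      exact ⟨by linarith, by linarith⟩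
    · ext <;> simp <;> field_simp <;> ring
  calc _ ≤ _ := add_le_add (add_le_add le_rfl le_rfl) (mul_le_mul_right q2 _)
    _ ≤ _ := add_le_add a1 le_rfl
    _ ≤ _ := a2
    _ ≤ _ := fin

theorem mink_ne_top {E : Type} [NormedAddCommGroup E] [NormedSpace ℝ E] [FiniteDimensional ℝ E]
    [MeasureSpace E] [BorelSpace E] [(volume : Measure E).IsAddHaarMeasure]
    {L B : Set E} (hL : Body L) (hB : B ⊆ L) {t : ℝ} (ht : 0 ≤ t) : volume (mink L t B) ≠ ⊤ :=
  ne_top_of_le_ne_top (ENNReal.mul_ne_top ENNReal.ofReal_ne_top hL.ne_top) (mink_le hL.conv hB ht)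

theorem mink_le_real {E : Type} [NormedAddCommGroup E] [NormedSpace ℝ E] [FiniteDimensional ℝ E]
    [MeasureSpace E] [BorelSpace E] [(volume : Measure E).IsAddHaarMeasure]
    {L B : Set E} (hL : Body L) (hB : B ⊆ L) {t : ℝ} (ht : 0 ≤ t) :
    volume.real (mink L t B) ≤ (1 + t) ^ Module.finrank ℝ E * volume.real L := by
  have := ENNReal.toReal_mono (ENNReal.mul_ne_top ENNReal.ofReal_ne_top hL.ne_top) (mink_le hL.conv hB ht)
  rwa [ENNReal.toReal_mul, ENNReal.toReal_ofReal (by positivity)] at this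

theorem mink3_real {L : Set V} (hL : Body L) {c1 c2 c3 t : ℝ} (h1 : 0 ≤ c1) (h2 : 0 ≤ c2) (h3 : 0 ≤ c3)
    (hB : box3 c1 c2 c3 ⊆ L)
    (ht : 0 < t) : volume.real L + t * (2 * (c1 * volume.real (p1 '' L) + c2 * volume.real (p2 '' L) +
      c3 * volume.real (p3 '' L))) ≤ volume.real (mink L t (box3 c1 c2 c3)) := by
  have n1 : volume (p1 '' L) ≠ ⊤ := (hL.compact.image (LinearMap.continuous_of_finiteDimensional p1)).measure_lt_top.ne
  have n2 : volume (p2 '' L) ≠ ⊤ := (hL.compact.image (LinearMap.continuous_of_finiteDimensional p2)).measure_lt_top.ne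
  have n3 : volume (p3 '' L) ≠ ⊤ := (hL.compact.image (LinearMap.continuous_of_finiteDimensional p3)).measure_lt_top.ne
  have := ENNReal.toReal_mono (mink_ne_top hL hB ht.le) (mink3 hL.compact h1 h2 h3 ht)
  have m1 := ENNReal.mul_ne_top (ENNReal.ofReal_ne_top (r := 2 * (t * c1))) n1
  have m2 := ENNReal.mul_ne_top (ENNReal.ofReal_ne_top (r := 2 * (t * c2))) n2
  have m3 := ENNReal.mul_ne_top (ENNReal.ofReal_ne_top (r := 2 * (t * c3))) n3
  have s1 := ENNReal.add_ne_top.2 ⟨hL.ne_top, m1⟩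
  have s2 := ENNReal.add_ne_top.2 ⟨s1, m2⟩
  rw [ENNReal.toReal_add s2 m3, ENNReal.toReal_add s1 m2,
    ENNReal.toReal_add hL.ne_top m1, ENNReal.toReal_mul, ENNReal.toReal_mul, ENNReal.toReal_mul,
    ENNReal.toReal_ofReal (by positivity), ENNReal.toReal_ofReal (by positivity),
    ENNReal.toReal_ofReal (by positivity)] at this
  simp only [measureReal_def]
  linarith

theorem mink2_real {L : Set V2} (hL : Body L) {c1 c2 t : ℝ} (h1 : 0 ≤ c1) (h2 : 0 ≤ c2)
    (hB : box2 c1 c2 ⊆ L)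
    (ht : 0 < t) : volume.real L + t * (2 * (c1 * volume.real (Prod.snd '' L) + c2 * volume.real (Prod.fst '' L)))
       ≤ volume.real (mink L t (box2 c1 c2)) := by
  have n1 : volume (Prod.snd '' L) ≠ ⊤ := (hL.compact.image continuous_snd).measure_lt_top.ne
  have n2 : volume (Prod.fst '' L) ≠ ⊤ := (hL.compact.image continuous_fst).measure_lt_top.ne
  have := ENNReal.toReal_mono (mink_ne_top hL hB ht.le) (mink2 hL.compact h1 h2 ht)
  have m1 := ENNReal.mul_ne_top (ENNReal.ofReal_ne_top (r := 2 * (t * c1))) n1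
  have m2 := ENNReal.mul_ne_top (ENNReal.ofReal_ne_top (r := 2 * (t * c2))) n2
  have s1 := ENNReal.add_ne_top.2 ⟨hL.ne_top, m1⟩
  rw [ENNReal.toReal_add s1 m2,
    ENNReal.toReal_add hL.ne_top m1, ENNReal.toReal_mul, ENNReal.toReal_mul, 
    ENNReal.toReal_ofReal (by positivity), ENNReal.toReal_ofReal (by positivity)] at this
  simp only [measureReal_def]
  linarith

theorem bound3 {L : Set V} (hL : Body L) {c1 c2 c3 : ℝ} (h1 : 0 ≤ c1) (h2 : 0 ≤ c2) (h3 : 0 ≤ c3)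
    (hB : box3 c1 c2 c3 ⊆ L) :
    2 * (c1 * volume.real (p1 '' L) + c2 * volume.real (p2 '' L) + c3 * volume.real (p3 '' L)) ≤
      3 * volume.real L := by
  have := lim0 (S := 2 * (c1 * volume.real (p1 '' L) + c2 * volume.real (p2 '' L) + c3 * volume.real (p3 '' L)))
    (g := fun t => (3 + 3 * t + t ^ 2) * volume.real L) (by fun_prop) ?_
  · simpa using this
  · intro t ht ht1
    have a := mink3_real hL h1 h2 h3 hB ht
    have b := mink_le_real hL hB ht.le
    have : Module.finrank ℝ V = 3 := by simp
    rw [this] at b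
    have c := a.trans b
    by_contra hc
    push Not at hc
    nlinarith [mul_lt_mul_of_pos_left hc ht]

theorem bound2 {L : Set V2} (hL : Body L) {c1 c2 : ℝ} (h1 : 0 ≤ c1) (h2 : 0 ≤ c2) 
    (hB : box2 c1 c2 ⊆ L) :
    2 * (c1 * volume.real (Prod.snd '' L) + c2 * volume.real (Prod.fst '' L)) ≤
      2 * volume.real L := by
  have := lim0 (S := 2 * (c1 * volume.real (Prod.snd '' L) + c2 * volume.real (Prod.fst '' L)))
    (g := fun t => (2 + t) * volume.real L) (by fun_prop) ?_
  · simpa using this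
  · intro t ht ht1
    have a := mink2_real hL h1 h2 hB ht
    have b := mink_le_real hL hB ht.le
    have : Module.finrank ℝ V2 = 2 := by simp
    rw [this] at b
    have c := a.trans b
    by_contra hc
    push Not at hc
    nlinarith [mul_lt_mul_of_pos_left hc ht]

theorem proj_two_le {A : Set ℝ} (hA : IsCompact A) (hc : Convex ℝ A) (h1 : (1:ℝ) ∈ A) (h2 : (-1:ℝ) ∈ A) :
    2 ≤ volume.real A := by
  have : Set.Icc (-1:ℝ) 1 ⊆ A := hc.ordConnected.out h2 h1
  have h := measureReal_mono (μ := volume) this hA.measure_lt_top.ne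
  have e : volume.real (Set.Icc (-1:ℝ) 1) = 2 := by simp [measureReal_def]; norm_num
  linarith

theorem Equi2.vol_pos {C : Set V2} (h : Equi2 C) : 0 < volume.real C := h.body.pos
theorem Equi.vol_pos {C : Set V} (h : Equi C) : 0 < volume.real C := h.body.pos

theorem Equi2.box {C : Set V2} (h : Equi2 C) : box2 (2 / volume.real C) (2 / volume.real C) ⊆ pol C := by
  rintro y ⟨h1, h2⟩ x hx
  have hp := h.vol_pos
  have := h.lin hx
  rw [dot2]
  calc x.1 * y.1 + x.2 * y.2 ≤ |x.1| * |y.1| + |x.2| * |y.2| := by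
        refine add_le_add ?_ ?_ <;> rw [← abs_mul] <;> exact le_abs_self _
    _ ≤ |x.1| * (2 / volume.real C) + |x.2| * (2 / volume.real C) := by gcongr
    _ = (|x.1| + |x.2|) * (2 / volume.real C) := by ring
    _ ≤ (volume.real C / 2) * (2 / volume.real C) := by gcongr
    _ = 1 := by field_simp

theorem Equi2.projs {C : Set V2} (h : Equi2 C) : 2 ≤ volume.real (Prod.fst '' pol C) ∧
    2 ≤ volume.real (Prod.snd '' pol C) := by
  have hb := h.body.pol
  constructor
  · obtain ⟨y, hy, e⟩ := h.y1
    exact proj_two_le (hb.compact.image continuous_fst) (hb.conv.linear_image (LinearMap.fst ℝ ℝ ℝ))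
      ⟨y, hy, e⟩ ⟨-y, hb.symm y hy, by simp [e]⟩
  · obtain ⟨y, hy, e⟩ := h.y2
    exact proj_two_le (hb.compact.image continuous_snd) (hb.conv.linear_image (LinearMap.snd ℝ ℝ ℝ))
      ⟨y, hy, e⟩ ⟨-y, hb.symm y hy, by simp [e]⟩

theorem Equi2.mahler {C : Set V2} (h : Equi2 C) : 8 ≤ volume.real C * volume.real (pol C) := by
  have hp := h.vol_pos
  have := bound2 h.body.pol (by positivity) (by positivity) h.box
  obtain ⟨h1, h2⟩ := h.projs
  have h3 : 2 / volume.real C * 2 + 2 / volume.real C * 2 ≤ volume.real (pol C) := by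
    have : 2 / volume.real C * 2 + 2 / volume.real C * 2 ≤ 2 / volume.real C * volume.real (Prod.snd '' pol C) + 2 / volume.real C * volume.real (Prod.fst '' pol C) := by gcongr
    linarith
  have h4 : 2 / volume.real C * 2 + 2 / volume.real C * 2 = 8 / volume.real C := by ring
  rw [h4, div_le_iff₀ hp] at h3
  linarith

/-- the coefficients `N_i` -/
noncomputable def NN (C : Set V2) (K : Set V) : ℝ := 2 * volume.real C / (3 * volume.real K)

theorem Equi.linN {K : Set V} (h : Equi K) {x : V} (hx : x ∈ K) :
    |x.1| * NN (sec1 K) K + |x.2.1| * NN (sec2 K) K + |x.2.2| * NN (sec3 K) K ≤ 1 := by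
  have hp := h.vol_pos
  have := h.lin hx
  unfold NN
  have e : |x.1| * (2 * volume.real (sec1 K) / (3 * volume.real K)) + |x.2.1| * (2 * volume.real (sec2 K) / (3 * volume.real K)) + |x.2.2| * (2 * volume.real (sec3 K) / (3 * volume.real K)) = 2 * (|x.1| * volume.real (sec1 K) + |x.2.1| * volume.real (sec2 K) + |x.2.2| * volume.real (sec3 K)) / (3 * volume.real K) := by
    field_simp
  rw [e, div_le_one (by positivity)]
  linarith

theorem Equi.NN_pos {K : Set V} (h : Equi K) : 0 < NN (sec1 K) K ∧ 0 < NN (sec2 K) K ∧ 0 < NN (sec3 K) K := by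
  have hp := h.vol_pos
  have h1 := h.s1.vol_pos
  have h2 := h.s2.vol_pos
  have h3 := h.s3.vol_pos
  unfold NN
  refine ⟨?_, ?_, ?_⟩ <;> positivity

theorem Equi.box {K : Set V} (h : Equi K) : box3 (NN (sec1 K) K) (NN (sec2 K) K) (NN (sec3 K) K) ⊆ pol K := by
  rintro y ⟨h1, h2, h3⟩ x hx
  have := h.linN hx
  rw [dot3]
  calc x.1 * y.1 + (x.2.1 * y.2.1 + x.2.2 * y.2.2) ≤ |x.1| * |y.1| + (|x.2.1| * |y.2.1| + |x.2.2| * |y.2.2|) := by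
        refine add_le_add ?_ (add_le_add ?_ ?_) <;> rw [← abs_mul] <;> exact le_abs_self _
    _ ≤ |x.1| * NN (sec1 K) K + (|x.2.1| * NN (sec2 K) K + |x.2.2| * NN (sec3 K) K) := by gcongr
    _ ≤ 1 := by linarith

theorem Equi.chain {K : Set V} (h : Equi K) :
    2 * (NN (sec1 K) K * volume.real (pol (sec1 K)) + NN (sec2 K) K * volume.real (pol (sec2 K)) + NN (sec3 K) K * volume.real (pol (sec3 K))) ≤ 3 * volume.real (pol K) := by
  have := h.NN_pos
  rw [pol_sec1 h.body, pol_sec2 h.body, pol_sec3 h.body]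
  exact bound3 h.body.pol this.1.le this.2.1.le this.2.2.le h.box

theorem Equi.chain_mul {K : Set V} (h : Equi K) (C : Set V2) :
    NN C K * volume.real (pol C) * (3 * volume.real K) = 2 * (volume.real C * volume.real (pol C)) := by
  have hp := h.vol_pos
  unfold NN; field_simp

theorem Equi.mahler {K : Set V} (h : Equi K) : 32 / 3 ≤ volume.real K * volume.real (pol K) := by
  have hp := h.vol_pos
  have a := mul_le_mul_of_nonneg_right h.chain (show 0 ≤ 3 * volume.real K by positivity)
  have e1 := h.chain_mul (sec1 K)
  have e2 := h.chain_mul (sec2 K)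
  have e3 := h.chain_mul (sec3 K)
  have b1 := h.s1.mahler
  have b2 := h.s2.mahler
  have b3 := h.s3.mahler
  nlinarith

end Mahler

end

section
open MeasureTheory
open scoped RealInnerProductSpace Pointwise
set_option linter.all false

namespace Mahler

section hull
variable {E : Type} [NormedAddCommGroup E] [NormedSpace ℝ E]

def joinIter (s : Set E) : ℕ → Set E
  | 0 => s
  | (k+1) => (fun q : ℝ × E × E => (1 - q.1) • q.2.1 + q.1 • q.2.2) '' (Set.Icc 0 1 ×ˢ (s ×ˢ joinIter s k))

theorem joinIter_compact {s : Set E} (hs : IsCompact s) (k : ℕ) : IsCompact (joinIter s k) := by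
  induction k with
  | zero => exact hs
  | succ k ih => exact (isCompact_Icc.prod (hs.prod ih)).image (by fun_prop)

theorem joinIter_sub {s : Set E} (k : ℕ) : joinIter s k ⊆ convexHull ℝ s := by
  induction k with
  | zero => exact subset_convexHull ℝ s
  | succ k ih =>
    rintro _ ⟨⟨t, a, b⟩, ⟨ht, ha, hb⟩, rfl⟩
    exact convex_convexHull ℝ s (subset_convexHull ℝ s ha) (ih hb) (by linarith [ht.2]) ht.1 (by ring)

theorem sub_joinIter {s : Set E} (k : ℕ) : ∀ t : Finset E, (t : Set E) ⊆ s → t.card ≤ k + 1 →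
    convexHull ℝ (t : Set E) ⊆ joinIter s k := by
  classical
  induction k with
  | zero =>
    intro t ht hc
    have : (t : Set E).Subsingleton := by
      intro a ha b hb; exact Finset.card_le_one.1 (by simpa using hc) a ha b hb
    rw [this.convex.convexHull_eq]; exact ht
  | succ k ih =>
    intro t ht hc
    rcases t.eq_empty_or_nonempty with rfl | ⟨a, ha⟩
    · simp
    have has : a ∈ s := ht ha
    rcases (t.erase a).eq_empty_or_nonempty with he | hne
    · have : t = {a} := by
        rw [← Finset.insert_erase ha, he]; simp
      subst this
      simp only [Finset.coe_singleton, convexHull_singleton, Set.singleton_subset_iff]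
      refine ⟨(0, a, a), ⟨by simp, has, ?_⟩, by simp⟩
      exact ih {a} (by simpa using has) (by simp) (by simp)
    · have := ih (t.erase a) (fun x hx => ht (Finset.mem_of_mem_erase hx)) (by
        rw [Finset.card_erase_of_mem ha]; omega)
      intro x hx
      rw [← Finset.insert_erase ha, Finset.coe_insert, convexHull_insert (by exact_mod_cast hne)] at hx
      rw [mem_convexJoin] at hx
      obtain ⟨a', ha', b, hb, hx⟩ := hx
      rw [Set.mem_singleton_iff] at ha'; subst ha'
      obtain ⟨u, v, hu, hv, huv, rfl⟩ := hx
      refine ⟨(v, a', b), ⟨⟨hv, by linarith⟩, has, this hb⟩, ?_⟩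
      simp only; congr 2; linarith

theorem hull_compact [FiniteDimensional ℝ E] {s : Set E} (hs : IsCompact s) : IsCompact (convexHull ℝ s) := by
  have : convexHull ℝ s = joinIter s (Module.finrank ℝ E) := by
    apply Set.Subset.antisymm _ (joinIter_sub _)
    rw [convexHull_eq_union]
    simp only [Set.iUnion_subset_iff]
    intro t ht hai
    apply sub_joinIter _ t ht
    have := hai.card_le_finrank_succ
    have h2 := Submodule.finrank_le (vectorSpan ℝ (Set.range ((↑) : t → E)))
    simp only [Fintype.card_coe] at this
    omega
  rw [this]; exact joinIter_compact hs _

variable [FiniteDimensional ℝ E] [Dot E]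

theorem ext_in_Z {K : Set E} (hK : Body K) {h : E → ℝ} (hc : Continuous h)
    (hne : ∃ x ∈ K, h x = 1)
    (H : ∀ y0 ∈ pol K, (∃ x1 ∈ K, Dot.dot x1 y0 = 1) → ∃ x ∈ K, h x = 1 ∧ Dot.dot x y0 = 1)
    {x : E} (hx : x ∈ K) (hext : ∀ g, x + g ∈ K → x - g ∈ K → g = 0) : h x = 1 := by
  set A := K ∩ {x | h x = 1} with hA
  have hAc : IsCompact A := hK.compact.inter_right (isClosed_eq hc continuous_const)
  have hC := hull_compact hAc
  have hsub : convexHull ℝ A ⊆ K := convexHull_min Set.inter_subset_left hK.conv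
  have heq : convexHull ℝ A = K := by
    apply Set.Subset.antisymm hsub
    intro z hz
    by_contra hzn
    obtain ⟨f, u, hf, hu⟩ := geometric_hahn_banach_closed_point (convex_convexHull ℝ A) hC.isClosed hzn
    obtain ⟨x1, hx1, hmax⟩ := hK.compact.exists_isMaxOn ⟨z, hz⟩ f.continuous.continuousOn
    have hmax' : ∀ w ∈ K, f w ≤ f x1 := fun w hw => hmax hw
    obtain ⟨a, ha, ha1⟩ := hne
    have hau := hf a (subset_convexHull ℝ A ⟨ha, ha1⟩)
    have hzm := hmax' z hz
    have hM : 0 < f x1 := by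
      by_contra hM
      push Not at hM
      have h1 := hmax' _ (hK.symm a ha)
      simp at h1
      have h2 := hmax' z hz
      linarith
    obtain ⟨y, hy⟩ := Dot.rep (f : E →ₗ[ℝ] ℝ)
    obtain ⟨w, hw, hw1, hw2⟩ := H ((f x1)⁻¹ • y) (fun w hw => by
      simp only [map_smul, smul_eq_mul, hy, ContinuousLinearMap.coe_coe]
      rw [inv_mul_le_iff₀ hM]; linarith [hmax' w hw]) ⟨x1, hx1, by
      simp only [map_smul, smul_eq_mul, hy, ContinuousLinearMap.coe_coe]
      field_simp⟩
    simp only [map_smul, smul_eq_mul, hy, ContinuousLinearMap.coe_coe] at hw2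
    have := hf w (subset_convexHull ℝ A ⟨hw, hw1⟩)
    field_simp at hw2
    linarith
  have : x ∈ (convexHull ℝ A).extremePoints ℝ := by
    rw [heq, mem_extremePoints_iff_left]
    refine ⟨hx, fun x1 h1 x2 h2 hseg => ?_⟩
    obtain ⟨a, b, ha, hb, hab, rfl⟩ := hseg
    have key : (min a b) • (x1 - x2) = 0 := by
      have ma := min_le_left a b
      have mb := min_le_right a b
      have mp : 0 < min a b := lt_min ha hb
      apply hext
      · have := hK.conv h1 h2 (a := a + min a b) (b := b - min a b) (by linarith) (by linarith) (by linarith)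
        convert this using 1; module
      · have := hK.conv h1 h2 (a := a - min a b) (b := b + min a b) (by linarith) (by linarith) (by linarith)
        convert this using 1; module
    have mp : 0 < min a b := lt_min ha hb
    have h0 : x1 - x2 = 0 := (smul_eq_zero.1 key).resolve_left mp.ne'
    rw [sub_eq_zero] at h0
    subst h0
    rw [← add_smul, hab, one_smul]
  exact (extremePoints_convexHull_subset this).2

variable [MeasureSpace E] [BorelSpace E] [(volume : Measure E).IsAddHaarMeasure]

theorem stab {K B : Set E} (hK : Body K) (hB : B ⊆ pol K) {h : E → ℝ} (hc : Continuous h)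
    (hle : ∀ x ∈ K, h x ≤ 1) (hb : ∀ x, ∀ b ∈ B, Dot.dot x b ≤ h x) {y0 x1 : E} (hy0 : y0 ∈ pol K)
    (hx1 : x1 ∈ K) (h1 : Dot.dot x1 y0 = 1) (hno : ∀ x ∈ K, h x = 1 → Dot.dot x y0 ≠ 1) :
    ∃ δ v : ℝ, 0 < δ ∧ δ ≤ 1 ∧ 0 < v ∧ ∀ t, 0 < t → volume.real (mink (pol K) t B) ≤
      (1 + t) ^ Module.finrank ℝ E * (volume.real (pol K) - v) + (1 + t * (1 - δ)) ^ Module.finrank ℝ E * v := by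
  have hcF : IsCompact (K ∩ {x | Dot.dot x y0 = 1}) :=
    hK.compact.inter_right (isClosed_eq (continuous_dot' y0) continuous_const)
  obtain ⟨xm, ⟨hxmK, hxm1⟩, hxm⟩ := hcF.exists_isMaxOn ⟨x1, hx1, h1⟩ hc.continuousOn
  have hlt : h xm < 1 := lt_of_le_of_ne (hle xm hxmK) fun he => hno xm hxmK he hxm1
  set δ := min 1 ((1 - h xm) / 2) with hδ
  have hδ0 : 0 < δ := lt_min one_pos (by linarith)
  have hδ1 : δ ≤ 1 := min_le_left _ _
  have hδ2 : δ ≤ (1 - h xm) / 2 := min_le_right _ _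
  set U := K ∩ {x | 1 - δ ≤ h x} with hU
  have hUc : IsCompact U := hK.compact.inter_right (isClosed_le continuous_const hc)
  have hUlt : ∀ x ∈ U, Dot.dot x y0 < 1 := by
    rintro x ⟨hx, hxd⟩
    apply lt_of_le_of_ne (hy0 x hx)
    intro he
    have := hxm (show x ∈ K ∩ {x | Dot.dot x y0 = 1} from ⟨hx, he⟩)
    simp only [Set.mem_setOf_eq] at hxd this
    linarith
  set D : Set E := {y | ∀ x ∈ U, Dot.dot x y < Dot.dot x1 y} with hD
  have cdot : Continuous fun q : E × E => Dot.dot q.1 q.2 := by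
    let b := LinearMap.toContinuousBilinearMap (Dot.dot (E := E))
    exact b.continuous₂
  have hDo : IsOpen D := by
    rw [isOpen_iff_eventually]
    intro y hy
    apply hUc.eventually_forall_of_forall_eventually
    intro x hx
    apply (isOpen_lt (f := fun q : E × E => Dot.dot q.2 q.1) (g := fun q => Dot.dot x1 q.1) ?_ ?_).mem_nhds
    · exact hy x hx
    · exact cdot.comp continuous_swap
    · exact (continuous_dot x1).comp continuous_fst
  have hcone : ∀ s : ℝ, 0 < s → ∀ y ∈ D, s • y ∈ D := by
    intro s hs y hy x hx
    simp only [map_smul, smul_eq_mul]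
    exact mul_lt_mul_of_pos_left (hy x hx) hs
  have hP := hK.pol
  have hv : 0 < volume.real (pol K ∩ D) := by
    rw [measureReal_def]
    apply ENNReal.toReal_pos _ (measure_ne_top_of_subset Set.inter_subset_left hP.ne_top)
    refine (Measure.measure_pos_of_mem_nhds volume (x := (1/2 : ℝ) • y0) (Filter.inter_mem ?_ ?_)).ne'
    · rw [← mem_interior_iff_mem_nhds]
      have := hP.conv.combo_interior_self_mem_interior hP.zero hy0 (a := 1/2) (b := 1/2) (by norm_num) (by norm_num) (by norm_num)
      simpa using this
    · exact hDo.mem_nhds (hcone _ (by norm_num) y0 (fun x hx => by rw [h1]; exact hUlt x hx))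
  refine ⟨δ, volume.real (pol K ∩ D), hδ0, hδ1, hv, fun t ht => ?_⟩
  have nt : volume (pol K) ≠ ⊤ := hP.ne_top
  have e1 : volume.real (pol K) - volume.real (pol K ∩ D) = volume.real (pol K \ D) := by
    have := measureReal_inter_add_diff (μ := volume) (s := pol K) hDo.measurableSet nt
    linarith
  rw [e1]
  have hpos : 0 < 1 + t * (1 - δ) := by nlinarith
  have sub : mink (pol K) t B ⊆ ((1 + t) • (pol K \ D)) ∪ ((1 + t * (1 - δ)) • (pol K ∩ D)) := by
    rintro _ ⟨l, hl, b, hbB, rfl⟩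
    by_cases hmem : l + t • b ∈ D
    · right
      refine ⟨(1 + t * (1 - δ))⁻¹ • (l + t • b), ⟨?_, hcone _ (by positivity) _ hmem⟩, by
        simp only [smul_smul]; rw [mul_inv_cancel₀ hpos.ne', one_smul]⟩
      obtain ⟨xs, hxs, hmax⟩ := hK.compact.exists_isMaxOn ⟨x1, hx1⟩ (continuous_dot' (l + t • b)).continuousOn
      have hxsU : xs ∉ U := by
        intro hxsU
        have a1 := hmem xs hxsU
        have a2 := hmax hx1
        simp only [Set.mem_setOf_eq] at a2
        linarith
      have hh : h xs < 1 - δ := by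
        by_contra hcon; push Not at hcon; exact hxsU ⟨hxs, hcon⟩
      intro x hx
      have a2 := hmax hx
      simp only [Set.mem_setOf_eq] at a2
      rw [map_smul, smul_eq_mul, inv_mul_le_iff₀ hpos]
      have a3 : Dot.dot xs (l + t • b) ≤ 1 + t * (1 - δ) := by
        rw [map_add, map_smul, smul_eq_mul]
        have := hl xs hxs
        have := hb xs b hbB
        nlinarith
      linarith
    · left
      refine ⟨(1 + t)⁻¹ • (l + t • b), ⟨?_, fun hmem' => hmem ?_⟩, by
        simp only [smul_smul]; rw [mul_inv_cancel₀ (by positivity), one_smul]⟩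
      · have := hP.conv hl (hB hbB) (a := 1/(1+t)) (b := t/(1+t)) (by positivity) (by positivity) (by field_simp)
        convert this using 1
        rw [smul_add, smul_smul]; congr 2 <;> field_simp
      · have := hcone (1 + t) (by positivity) _ hmem'
        rwa [smul_smul, mul_inv_cancel₀ (by positivity), one_smul] at this
  have n1 : volume ((1 + t) • (pol K \ D)) ≠ ⊤ := by
    rw [Measure.addHaar_smul]
    exact ENNReal.mul_ne_top ENNReal.ofReal_ne_top (measure_ne_top_of_subset Set.diff_subset nt)
  have n2 : volume ((1 + t * (1 - δ)) • (pol K ∩ D)) ≠ ⊤ := by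
    rw [Measure.addHaar_smul]
    exact ENNReal.mul_ne_top ENNReal.ofReal_ne_top (measure_ne_top_of_subset Set.inter_subset_left nt)
  refine (measureReal_mono sub (measure_union_ne_top n1 n2)).trans ((measureReal_union_le _ _).trans ?_)
  simp only [measureReal_def, Measure.addHaar_smul, ENNReal.toReal_mul]
  rw [ENNReal.toReal_ofReal (abs_nonneg _), ENNReal.toReal_ofReal (abs_nonneg _), abs_of_nonneg (by positivity), abs_of_nonneg (by positivity)]
end hull

/-- equality case, three dimensions -/
theorem ext3 {K : Set V} (hK : Body K) {c1 c2 c3 : ℝ} (h1 : 0 ≤ c1) (h2 : 0 ≤ c2) (h3 : 0 ≤ c3)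
    (hle : ∀ x ∈ K, |x.1| * c1 + |x.2.1| * c2 + |x.2.2| * c3 ≤ 1)
    (hB : box3 c1 c2 c3 ⊆ pol K)
    (heq : 3 * volume.real (pol K) ≤ 
      2 * (c1 * volume.real (p1 '' pol K) + c2 * volume.real (p2 '' pol K) + c3 * volume.real (p3 '' pol K)))
    {x : V} (hx : x ∈ K) (hext : ∀ g, x + g ∈ K → x - g ∈ K → g = 0) :
    |x.1| * c1 + |x.2.1| * c2 + |x.2.2| * c3 = 1 := by
  have hc : Continuous fun x : V => |x.1| * c1 + |x.2.1| * c2 + |x.2.2| * c3 := by fun_prop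
  have H : ∀ y0 ∈ pol K, (∃ x1 ∈ K, Dot.dot x1 y0 = 1) → ∃ x ∈ K, (|x.1| * c1 + |x.2.1| * c2 + |x.2.2| * c3) = 1 ∧ Dot.dot x y0 = 1 := by
    intro y0 hy0 ⟨x1, hx1, hd⟩
    by_contra hno
    push Not at hno
    obtain ⟨δ, v, hδ, hδ1, hv, hst⟩ := stab hK hB hc hle (fun x b hb => by
      obtain ⟨b1, b2, b3⟩ := hb
      rw [dot3]
      calc x.1 * b.1 + (x.2.1 * b.2.1 + x.2.2 * b.2.2) ≤ |x.1| * |b.1| + (|x.2.1| * |b.2.1| + |x.2.2| * |b.2.2|) := by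
            refine add_le_add ?_ (add_le_add ?_ ?_) <;> rw [← abs_mul] <;> exact le_abs_self _
        _ ≤ |x.1| * c1 + (|x.2.1| * c2 + |x.2.2| * c3) := by gcongr
        _ = _ := by ring) hy0 hx1 hd hno
    have := lim0 (S := 3 * volume.real (pol K)) (g := fun t => (3 + 3 * t + t ^ 2) * (volume.real (pol K) - v) + (3 * (1 - δ) + 3 * t * (1 - δ)^2 + t ^ 2 * (1 - δ)^3) * v) (by fun_prop) ?_
    · simp at this
      nlinarith [mul_pos hδ hv]
    · intro t ht ht1
      have a := mink3_real hK.pol h1 h2 h3 hB ht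
      have b := hst t ht
      have hf : Module.finrank ℝ V = 3 := by simp
      rw [hf] at b
      have c := a.trans b
      by_contra hc
      push Not at hc
      nlinarith [mul_lt_mul_of_pos_left hc ht]
  refine ext_in_Z hK hc ?_ H hx hext
  obtain ⟨w, hw, hmax⟩ := hK.compact.exists_isMaxOn ⟨0, hK.zero_mem⟩ (continuous_dot' ((1, 0, 0) : V)).continuousOn
  have hpos : 0 < Dot.dot w ((1, 0, 0) : V) := by
    obtain ⟨r, hr, hrK⟩ := Metric.isOpen_iff.1 isOpen_interior 0 hK.zero
    have : ((r / 2, 0, 0) : V) ∈ K := by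
      apply interior_subset; apply hrK
      rw [mem_ball_zero_iff]; simp [Prod.norm_def, abs_of_pos hr]; linarith
    have := hmax this
    simp [dot3] at this
    simp [dot3]; linarith
  obtain ⟨x, hx, hx1, -⟩ := H ((Dot.dot w ((1, 0, 0) : V))⁻¹ • ((1, 0, 0) : V)) (fun z hz => by
    rw [map_smul, smul_eq_mul, inv_mul_le_iff₀ hpos, mul_one]; exact hmax hz) ⟨w, hw, by
    rw [map_smul, smul_eq_mul, inv_mul_cancel₀ hpos.ne']⟩
  exact ⟨x, hx, hx1⟩

/-- equality case, two dimensions -/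
theorem ext2 {K : Set V2} (hK : Body K) {c1 c2 : ℝ} (h1 : 0 ≤ c1) (h2 : 0 ≤ c2)
    (hle : ∀ x ∈ K, |x.1| * c1 + |x.2| * c2 ≤ 1)
    (hB : box2 c1 c2 ⊆ pol K)
    (heq : 2 * volume.real (pol K) ≤ 
      2 * (c1 * volume.real (Prod.snd '' pol K) + c2 * volume.real (Prod.fst '' pol K)))
    {x : V2} (hx : x ∈ K) (hext : ∀ g, x + g ∈ K → x - g ∈ K → g = 0) :
    |x.1| * c1 + |x.2| * c2 = 1 := by
  have hc : Continuous fun x : V2 => |x.1| * c1 + |x.2| * c2 := by fun_prop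
  have H : ∀ y0 ∈ pol K, (∃ x1 ∈ K, Dot.dot x1 y0 = 1) → ∃ x ∈ K, (|x.1| * c1 + |x.2| * c2) = 1 ∧ Dot.dot x y0 = 1 := by
    intro y0 hy0 ⟨x1, hx1, hd⟩
    by_contra hno
    push Not at hno
    obtain ⟨δ, v, hδ, hδ1, hv, hst⟩ := stab hK hB hc hle (fun x b hb => by
      obtain ⟨b1, b2⟩ := hb
      rw [dot2]
      calc x.1 * b.1 + x.2 * b.2 ≤ |x.1| * |b.1| + |x.2| * |b.2| := by
            refine add_le_add ?_ ?_ <;> rw [← abs_mul] <;> exact le_abs_self _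
        _ ≤ |x.1| * c1 + |x.2| * c2 := by gcongr) hy0 hx1 hd hno
    have := lim0 (S := 2 * volume.real (pol K)) (g := fun t => (2 + t) * (volume.real (pol K) - v) + (2 * (1 - δ) + t * (1 - δ)^2) * v) (by fun_prop) ?_
    · simp at this
      nlinarith [mul_pos hδ hv]
    · intro t ht ht1
      have a := mink2_real hK.pol h1 h2 hB ht
      have b := hst t ht
      have hf : Module.finrank ℝ V2 = 2 := by simp
      rw [hf] at b
      have c := a.trans b
      by_contra hc
      push Not at hc
      nlinarith [mul_lt_mul_of_pos_left hc ht]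
  refine ext_in_Z hK hc ?_ H hx hext
  obtain ⟨w, hw, hmax⟩ := hK.compact.exists_isMaxOn ⟨0, hK.zero_mem⟩ (continuous_dot' ((1, 0) : V2)).continuousOn
  have hpos : 0 < Dot.dot w ((1, 0) : V2) := by
    obtain ⟨r, hr, hrK⟩ := Metric.isOpen_iff.1 isOpen_interior 0 hK.zero
    have : ((r / 2, 0) : V2) ∈ K := by
      apply interior_subset; apply hrK
      rw [mem_ball_zero_iff]; simp [Prod.norm_def, abs_of_pos hr]; linarith
    have := hmax this
    simp [dot2] at this
    simp [dot2]; linarith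
  obtain ⟨x, hx, hx1, -⟩ := H ((Dot.dot w ((1, 0) : V2))⁻¹ • ((1, 0) : V2)) (fun z hz => by
    rw [map_smul, smul_eq_mul, inv_mul_le_iff₀ hpos, mul_one]; exact hmax hz) ⟨w, hw, by
    rw [map_smul, smul_eq_mul, inv_mul_cancel₀ hpos.ne']⟩
  exact ⟨x, hx, hx1⟩

end Mahler

end

section
open MeasureTheory
open scoped RealInnerProductSpace
set_option linter.all false

namespace Mahler

theorem fill {E : Type} [NormedAddCommGroup E] [NormedSpace ℝ E] [FiniteDimensional ℝ E] [MeasureSpace E]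
    [BorelSpace E] [(volume : Measure E).IsAddHaarMeasure] {K O U D : Set E} (hc : Convex ℝ K) (hf : volume K ≠ ⊤)
    (hO : IsOpen O)
    (hU : MeasurableSet U) (hUK : U ⊆ K ∩ O) (hv : volume.real U = volume.real (K ∩ O)) (hD : IsClosed D) (hUD : U ⊆ D)
    {p q : E} (hp : p ∈ K) (hq : q ∈ interior K) (hpq : ∀ s : ℝ, 0 < s → s < 1 → (1 - s) • p + s • q ∈ O) : p ∈ D := by
  by_contra hpD
  have hcont : Continuous fun s : ℝ => (1 - s) • p + s • q := by fun_prop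
  have h1 : ∀ᶠ s in nhdsWithin (0:ℝ) (Set.Ioi 0), (1 - s) • p + s • q ∈ Dᶜ := by
    apply (hcont.tendsto 0).mono_left nhdsWithin_le_nhds
    apply hD.isOpen_compl.mem_nhds
    simpa using hpD
  obtain ⟨s, hs1, hs2⟩ := (h1.and (Ioo_mem_nhdsGT (show (0:ℝ) < 1 by norm_num))).exists
  set W := interior K ∩ O ∩ Dᶜ
  have hW : IsOpen W := (isOpen_interior.inter hO).inter hD.isOpen_compl
  have hWn : W.Nonempty := ⟨_, ⟨hc.combo_self_interior_mem_interior hp hq (by linarith [hs2.2]) hs2.1 (by ring),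
    hpq s hs2.1 hs2.2⟩, hs1⟩
  have hpos := hW.measure_pos volume hWn
  have hWK : W ⊆ K ∩ O := fun x hx => ⟨interior_subset hx.1.1, hx.1.2⟩
  have nt := measure_ne_top_of_subset (Set.inter_subset_left (s := K) (t := O)) hf
  have := two_le (A := U) (B := W) hW.measurableSet nt hUK hWK
    (fun x hx hx' => hx'.2 (hUD hx))
  rw [hv] at this
  have h2 : 0 < volume.real W := ENNReal.toReal_pos hpos.ne' (measure_ne_top_of_subset hWK nt)
  linarith

theorem Equi2.fill {C : Set V2} (h : Equi2 C) {x : V2} (hx : x ∈ C) (h1 : 0 ≤ x.1) (h2 : 0 ≤ x.2)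
    (hz : x.1 + x.2 = volume.real C / 2) {p : V2} (hp : p ∈ C) (hp1 : 0 ≤ p.1) (hp2 : 0 ≤ p.2) :
    ∃ t : ℝ, 0 ≤ t ∧ t ≤ 1 ∧ ∃ k ∈ C, 0 ≤ k.1 ∧ 0 ≤ k.2 ∧ k.1 * k.2 = 0 ∧ p = (1 - t) • k + t • x := by
  obtain ⟨U, hU, hUK, hv, hUD⟩ := h.cones hx h1 h2
  have hk : IsCompact ((fun z : ℝ × V2 => (1 - z.1) • z.2 + z.1 • x) ''
      (Set.Icc (0:ℝ) 1 ×ˢ (C ∩ {k | 0 ≤ k.1 ∧ 0 ≤ k.2 ∧ k.1 * k.2 = 0}))) := by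
    refine (isCompact_Icc.prod (h.body.compact.inter_right ?_)).image (by fun_prop)
    simp only [Set.setOf_and]
    refine IsClosed.inter ?_ (IsClosed.inter ?_ ?_)
    · exact isClosed_le (by fun_prop) (by fun_prop)
    · exact isClosed_le (by fun_prop) (by fun_prop)
    · exact isClosed_eq (by fun_prop) (by fun_prop)
  have hO : IsOpen {x : V2 | 0 < sg true * x.1 ∧ 0 < sg true * x.2} := by
    simp only [Set.setOf_and]
    refine IsOpen.inter ?_ ?_ <;> exact isOpen_lt (by fun_prop) (by fun_prop)
  obtain ⟨q, hq, hq1, hq2⟩ : ∃ q ∈ interior C, 0 < q.1 ∧ 0 < q.2 := by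
    have hcont : Continuous fun s : ℝ => ((s, s) : V2) := by fun_prop
    have : ∀ᶠ s in nhdsWithin (0:ℝ) (Set.Ioi 0), ((s, s) : V2) ∈ interior C := by
      apply (hcont.tendsto 0).mono_left nhdsWithin_le_nhds
      exact isOpen_interior.mem_nhds h.body.zero
    obtain ⟨s, hs1, hs2⟩ := (this.and self_mem_nhdsWithin).exists
    exact ⟨_, hs1, hs2, hs2⟩
  have := Mahler.fill h.body.conv h.body.ne_top hO hU hUK (by rw [hv, h.quad]; linarith) hk.isClosed ?_ hp hq ?_
  · obtain ⟨⟨t, k⟩, ⟨⟨ht0, ht1⟩, hkC, hk1, hk2, hk3⟩, rfl⟩ := this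
    exact ⟨t, ht0, ht1, k, hkC, hk1, hk2, hk3, rfl⟩
  · intro p hp
    obtain ⟨t, ht0, ht1, k, hkC, hk1, hk2, hk3, rfl⟩ := hUD p hp
    exact ⟨(t, k), ⟨⟨ht0, ht1⟩, hkC, hk1, hk2, hk3⟩, rfl⟩
  · intro s hs hs1
    have : 0 < 1 - s := by linarith
    refine ⟨?_, ?_⟩ <;> simp <;> positivity

theorem Equi.fill {K : Set V} (h : Equi K) {x : V} (hx : x ∈ K) (h1 : 0 ≤ x.1) (h2 : 0 ≤ x.2.1) (h3 : 0 ≤ x.2.2)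
    (hz : x.1 * NN (sec1 K) K + x.2.1 * NN (sec2 K) K + x.2.2 * NN (sec3 K) K = 1)
    {p : V} (hp : p ∈ K) (hp1 : 0 ≤ p.1) (hp2 : 0 ≤ p.2.1) (hp3 : 0 ≤ p.2.2) :
    ∃ t : ℝ, 0 ≤ t ∧ t ≤ 1 ∧ ∃ k ∈ K, 0 ≤ k.1 ∧ 0 ≤ k.2.1 ∧ 0 ≤ k.2.2 ∧ k.1 * k.2.1 * k.2.2 = 0 ∧
      p = (1 - t) • k + t • x := by
  obtain ⟨U, hU, hUK, hv, hUD⟩ := h.cones hx h1 h2 h3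
  have hk : IsCompact ((fun z : ℝ × V => (1 - z.1) • z.2 + z.1 • x) ''
      (Set.Icc (0:ℝ) 1 ×ˢ (K ∩ {k | 0 ≤ k.1 ∧ 0 ≤ k.2.1 ∧ 0 ≤ k.2.2 ∧ k.1 * k.2.1 * k.2.2 = 0}))) := by
    refine (isCompact_Icc.prod (h.body.compact.inter_right ?_)).image (by fun_prop)
    simp only [Set.setOf_and]
    refine IsClosed.inter ?_ (IsClosed.inter ?_ (IsClosed.inter ?_ ?_))
    · exact isClosed_le (by fun_prop) (by fun_prop)
    · exact isClosed_le (by fun_prop) (by fun_prop)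
    · exact isClosed_le (by fun_prop) (by fun_prop)
    · exact isClosed_eq (by fun_prop) (by fun_prop)
  have hO : IsOpen {x : V | 0 < sg true * x.1 ∧ 0 < sg true * x.2.1 ∧ 0 < sg true * x.2.2} := by
    simp only [Set.setOf_and]
    refine IsOpen.inter ?_ (IsOpen.inter ?_ ?_) <;> exact isOpen_lt (by fun_prop) (by fun_prop)
  obtain ⟨q, hq, hq1, hq2, hq3⟩ : ∃ q ∈ interior K, 0 < q.1 ∧ 0 < q.2.1 ∧ 0 < q.2.2 := by
    have hcont : Continuous fun s : ℝ => ((s, s, s) : V) := by fun_prop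
    have : ∀ᶠ s in nhdsWithin (0:ℝ) (Set.Ioi 0), ((s, s, s) : V) ∈ interior K := by
      apply (hcont.tendsto 0).mono_left nhdsWithin_le_nhds
      exact isOpen_interior.mem_nhds h.body.zero
    obtain ⟨s, hs1, hs2⟩ := (this.and self_mem_nhdsWithin).exists
    exact ⟨_, hs1, hs2, hs2, hs2⟩
  have hp0 := h.vol_pos
  have := Mahler.fill h.body.conv h.body.ne_top hO hU hUK ?_ hk.isClosed ?_ hp hq ?_
  · obtain ⟨⟨t, k⟩, ⟨⟨ht0, ht1⟩, hkC, hk1, hk2, hk3, hk4⟩, rfl⟩ := this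
    exact ⟨t, ht0, ht1, k, hkC, hk1, hk2, hk3, hk4, rfl⟩
  · rw [hv, h.oct]
    unfold NN at hz
    field_simp at hz
    linarith
  · intro p hp
    obtain ⟨t, ht0, ht1, k, hkC, hk1, hk2, hk3, hk4, rfl⟩ := hUD p hp
    exact ⟨(t, k), ⟨⟨ht0, ht1⟩, hkC, hk1, hk2, hk3, hk4⟩, rfl⟩
  · intro s hs hs1
    have : 0 < 1 - s := by linarith
    refine ⟨?_, ?_, ?_⟩ <;> simp <;> positivity

structure Eq2 (C : Set V2) : Prop extends Equi2 C where
  eq : volume.real C * volume.real (pol C) = 8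

structure Eq3 (K : Set V) : Prop extends Equi K where
  eq : volume.real K * volume.real (pol K) = 32 / 3

theorem Eq2.flip {C : Set V2} (h : Eq2 C) (a b : Bool) : Eq2 (flip2 a b ⁻¹' C) where
  toEqui2 := h.toEqui2.flip a b
  eq := by rw [pol_flip2, real_pre (mp_flip2 a b), real_pre (mp_flip2 a b), h.eq]

theorem Eq3.flip {C : Set V} (h : Eq3 C) (a b c : Bool) : Eq3 (flip3 a b c ⁻¹' C) where
  toEqui := h.toEqui.flip a b c
  eq := by rw [pol_flip3, real_pre (mp_flip3 a b c), real_pre (mp_flip3 a b c), h.eq]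

theorem Eq3.cyc {C : Set V} (h : Eq3 C) : Eq3 (cyc ⁻¹' C) where
  toEqui := h.toEqui.cyc
  eq := by rw [pol_cyc, real_pre mp_cyc, real_pre mp_cyc, h.eq]

theorem Equi2.swp {C : Set V2} (h : Equi2 C) : Equi2 (swp ⁻¹' C) where
  body := h.body.preimage _
  quad c d := by
    have : Mahler.swp ⁻¹' C ∩ {x | 0 < sg c * x.1 ∧ 0 < sg d * x.2} =
      Mahler.swp ⁻¹' (C ∩ {x | 0 < sg d * x.1 ∧ 0 < sg c * x.2}) := by
      ext x
      simp; tauto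
    rw [this, real_pre mp_swp, real_pre mp_swp, h.quad]
  e1 := h.e2
  e2 := h.e1
  y1 := by
    obtain ⟨⟨y1, y2⟩, hy, h1⟩ := h.y2
    rw [pol_swp]
    exact ⟨(y2, y1), by simpa using hy, h1⟩
  y2 := by
    obtain ⟨⟨y1, y2⟩, hy, h1⟩ := h.y1
    rw [pol_swp]
    exact ⟨(y2, y1), by simpa using hy, h1⟩

theorem Eq2.swp {C : Set V2} (h : Eq2 C) : Eq2 (swp ⁻¹' C) where
  toEqui2 := h.toEqui2.swp
  eq := by rw [pol_swp, real_pre mp_swp, real_pre mp_swp, h.eq]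

theorem Eq3.secs {K : Set V} (h : Eq3 K) : Eq2 (sec1 K) ∧ Eq2 (sec2 K) ∧ Eq2 (sec3 K) := by
  have hp := h.vol_pos
  have a := mul_le_mul_of_nonneg_right h.chain (show 0 ≤ 3 * volume.real K by positivity)
  have e1 := h.chain_mul (sec1 K)
  have e2 := h.chain_mul (sec2 K)
  have e3 := h.chain_mul (sec3 K)
  have b1 := h.s1.mahler
  have b2 := h.s2.mahler
  have b3 := h.s3.mahler
  have := h.eq
  exact ⟨⟨h.s1, by nlinarith⟩, ⟨h.s2, by nlinarith⟩, ⟨h.s3, by nlinarith⟩⟩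

theorem Eq3.ext {K : Set V} (h : Eq3 K) {x : V} (hx : x ∈ K) (hext : ∀ g, x + g ∈ K → x - g ∈ K → g = 0) :
    |x.1| * NN (sec1 K) K + |x.2.1| * NN (sec2 K) K + |x.2.2| * NN (sec3 K) K = 1 := by
  have hp := h.vol_pos
  have hn := h.NN_pos
  refine ext3 h.body hn.1.le hn.2.1.le hn.2.2.le (fun x hx => h.linN hx) h.box ?_ hx hext
  rw [← pol_sec1 h.body, ← pol_sec2 h.body, ← pol_sec3 h.body]
  have e1 := h.chain_mul (sec1 K)
  have e2 := h.chain_mul (sec2 K)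
  have e3 := h.chain_mul (sec3 K)
  rw [h.secs.1.eq] at e1
  rw [h.secs.2.1.eq] at e2
  rw [h.secs.2.2.eq] at e3
  have := h.eq
  refine le_of_mul_le_mul_right ?_ (show 0 < 3 * volume.real K by positivity)
  nlinarith

theorem Eq2.ext {C : Set V2} (h : Eq2 C) {x : V2} (hx : x ∈ C) (hext : ∀ g, x + g ∈ C → x - g ∈ C → g = 0) :
    |x.1| + |x.2| = volume.real C / 2 := by
  have hp := h.vol_pos
  have := ext2 h.body (c1 := 2 / volume.real C) (c2 := 2 / volume.real C) (by positivity) (by positivity) ?_ h.box ?_ hx hext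
  · field_simp at this; linarith
  · intro x hx
    have := h.lin hx
    have e : |x.1| * (2 / volume.real C) + |x.2| * (2 / volume.real C) = (|x.1| + |x.2|) / (volume.real C / 2) := by
      field_simp
    rw [e, div_le_one (by positivity)]; exact this
  · obtain ⟨h1, h2⟩ := h.projs
    have h3 : volume.real (pol C) = 2 / volume.real C * 2 + 2 / volume.real C * 2 := by
      have := h.eq
      field_simp; linarith
    have : 2 / volume.real C * 2 + 2 / volume.real C * 2 ≤ 2 / volume.real C * volume.real (Prod.snd '' pol C) + 2 / volume.real C * volume.real (Prod.fst '' pol C) := by gcongr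
    linarith

end Mahler

end

section
open MeasureTheory
open scoped RealInnerProductSpace
set_option linter.all false

namespace Mahler

def sqr (m : ℝ) : Set V2 := {x | |x.1 + m * x.2| ≤ 1 ∧ |x.2 - m * x.1| ≤ 1}

theorem Equi2.tri {C : Set V2} (h : Equi2 C) (hw : 2 < volume.real C) : ((1, 1) : V2) ∉ pol C := by
  intro hy
  have hq := h.quad true true
  have hc := cone_real (zero_le_one) (0:ℝ) (measurableSet_Ioc (a := (0:ℝ)) (b := 1))
  have hs : C ∩ {x | 0 < sg true * x.1 ∧ 0 < sg true * x.2} ⊆ cone 1 0 (Set.Ioc (0:ℝ) 1) := by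
    rintro ⟨a, b⟩ ⟨hx, h1, h2⟩
    have := hy _ hx
    simp [dot2] at this h1 h2
    have h3 : 0 < 1 - a := by linarith
    refine ⟨h1, by simp; linarith, ?_⟩
    simp
    refine ⟨by positivity, ?_⟩
    rw [inv_mul_le_one₀ h3]; linarith
  have hf : volume (cone 1 0 (Set.Ioc (0:ℝ) 1)) ≠ ⊤ := by
    intro hh
    rw [measureReal_def, hh] at hc
    norm_num at hc
  have := measureReal_mono hs hf
  rw [hq, hc] at this
  simp at this
  linarith

theorem Equi2.ylt {C : Set V2} (h : Equi2 C) (hw : 2 < volume.real C) {m : ℝ} (hy : ((1, m) : V2) ∈ pol C) :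
    |m| < 1 := by
  have h1 : |m| ≤ 1 := by
    have := pol_abs h.body h.e2 hy
    simpa [dot2] using this
  refine lt_of_le_of_ne h1 fun h2 => ?_
  rcases (abs_eq (by norm_num : (0:ℝ) ≤ 1)).1 h2 with rfl | rfl
  · exact h.tri hw hy
  · refine (h.flip true false).tri (by rwa [real_pre (mp_flip2 _ _)]) ?_
    rw [pol_flip2]; simpa using hy

/-- the endpoint of the edge through `e1`. -/
theorem Eq2.vert {C : Set V2} (h : Eq2 C) (hw : 2 < volume.real C) {m : ℝ} (hy : ((1, m) : V2) ∈ pol C) :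
    ∃ s, 0 < s ∧ 0 < 1 - m * s ∧ ((1 - m * s, s) : V2) ∈ C ∧ 1 + (1 - m) * s = volume.real C / 2 := by
  have hm := abs_lt.1 (h.ylt hw hy)
  -- e1 is not extreme
  obtain ⟨g, hg1, hg2, hg0⟩ : ∃ g, ((1, 0) : V2) + g ∈ C ∧ ((1, 0) : V2) - g ∈ C ∧ g ≠ 0 := by
    by_contra hc
    push Not at hc
    have := h.ext h.e1 hc
    simp at this; linarith
  have hline : ∀ s g, ((1 - m * s, s) : V2) + g ∈ C → ((1 - m * s, s) : V2) - g ∈ C → g.1 = - m * g.2 := by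
    intro s g h1 h2
    have a := hy _ h1
    have b := hy _ h2
    simp [dot2] at a b
    linarith
  have hgl := hline 0 g (by simpa using hg1) (by simpa using hg2)
  set S := {s : ℝ | ((1 - m * s, s) : V2) ∈ C} with hS
  have hSc : IsCompact S := by
    have hcl : IsClosed S := h.body.closed.preimage (show Continuous fun s : ℝ => ((1 - m * s, s) : V2) by fun_prop)
    obtain ⟨R, hR⟩ := h.body.compact.isBounded.exists_norm_le
    refine (isCompact_Icc (a := -R) (b := R)).of_isClosed_subset hcl fun s hs => ?_
    have := (norm_snd_le _).trans (hR _ hs)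
    simpa [abs_le] using this
  have hmem : ∀ s, s ∈ S ↔ ((1 - m * s, s) : V2) ∈ C := fun s => Iff.rfl
  obtain ⟨s, hs, hmax⟩ := hSc.exists_isMaxOn ⟨0, by rw [hmem]; simpa using h.e1⟩ continuous_id.continuousOn
  have hmax : ∀ s' ∈ S, s' ≤ s := fun s' h' => hmax h'
  have hs0 : 0 < s := by
    have hg2' : g.2 ≠ 0 := by
      intro h0
      apply hg0
      ext
      · simp [hgl, h0]
      · exact h0
    have a1 : g.2 ∈ S := by rw [hmem]; convert hg1 using 1; ext <;> simp [hgl]; ring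
    have a2 : - g.2 ∈ S := by rw [hmem]; convert hg2 using 1; ext <;> simp [hgl]
    have b1 := hmax _ a1
    have b2 := hmax _ a2
    rcases lt_or_gt_of_ne hg2' with h' | h' <;> linarith
  have hext := h.ext ((hmem s).1 hs) (by
    intro g h1 h2
    have hl := hline s g h1 h2
    have a1 : s + g.2 ∈ S := by rw [hmem]; convert h1 using 1; ext <;> simp [hl]; ring
    have a2 : s - g.2 ∈ S := by rw [hmem]; convert h2 using 1; ext <;> simp [hl]; ring
    have b1 := hmax _ a1
    have b2 := hmax _ a2
    have : g.2 = 0 := by linarith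
    ext <;> simp [hl, this])
  have hpos : 0 < 1 - m * s := by
    by_contra hc
    push Not at hc
    have hm0 : 0 < m := by by_contra h'; push Not at h'; nlinarith
    have h3 : ((0, 1 / m) : V2) ∈ C := by
      have hms : 0 < m * s := mul_pos hm0 hs0
      have := h.body.conv h.e1 ((hmem s).1 hs) (a := 1 - 1 / (m * s)) (b := 1 / (m * s))
        (by rw [sub_nonneg, div_le_one hms]; linarith) (by positivity) (by ring)
      convert this using 1
      ext <;> simp <;> field_simp <;> ring
    obtain ⟨y, hyp, hy2⟩ := h.y2
    have := hyp _ h3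
    simp [dot2, hy2] at this
    have h4 := mul_inv_cancel₀ hm0.ne'
    nlinarith
  refine ⟨s, hs0, hpos, hs, ?_⟩
  rw [abs_of_pos hpos, abs_of_pos hs0] at hext
  linarith

theorem Eq2.vert_eq {C : Set V2} (h : Eq2 C) (hw : 2 < volume.real C) {m k : ℝ} (hy : ((1, m) : V2) ∈ pol C)
    (hk : ((k, 1) : V2) ∈ pol C) : ∃ p ∈ C, p.1 + m * p.2 = 1 ∧ k * p.1 + p.2 = 1 ∧ p.1 + p.2 = volume.real C / 2 := by
  obtain ⟨s, hs, hs', hsC, hsw⟩ := h.vert hw hy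
  have hk' : ((1, k) : V2) ∈ pol (Mahler.swp ⁻¹' C) := by rw [pol_swp]; simpa using hk
  obtain ⟨u, hu, hu', huC, huw⟩ := h.swp.vert (by rwa [real_pre mp_swp]) hk'
  rw [real_pre mp_swp] at huw
  simp at huC
  obtain ⟨t, ht0, ht1, κ, hκ, hk1, hk2, hk3, he⟩ := h.fill hsC hs'.le hs.le (by simp; linarith) huC hu.le hu'.le
  have : κ.1 + κ.2 ≤ 1 := by
    obtain ⟨y, hyp, hy1⟩ := h.y1
    obtain ⟨y', hyp', hy1'⟩ := h.y2
    have a := hyp _ hκ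
    have b := hyp' _ hκ
    simp [dot2, hy1, hy1'] at a b
    rcases mul_eq_zero.1 hk3 with h0 | h0 <;> simp [h0] at a b ⊢ <;> linarith
  have e1 := congrArg Prod.fst he
  have e2 := congrArg Prod.snd he
  simp at e1 e2
  have : t = 1 := by
    by_contra hne
    have : t < 1 := lt_of_le_of_ne ht1 hne
    nlinarith
  subst this
  simp at e1 e2
  refine ⟨_, hsC, by simp, by simp; rw [← e1, ← e2]; ring, by simp; linarith⟩

theorem Eq2.struct {C : Set V2} (h : Eq2 C) : ∃ m, |m| ≤ 1 ∧ volume.real C = 4 / (1 + m ^ 2) ∧ C = sqr m := by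
  have h2 : 2 ≤ volume.real C := by
    have := h.lin h.e1
    simp at this; linarith
  rcases eq_or_lt_of_le h2 with hw | hw
  · refine ⟨1, by simp, by rw [← hw]; norm_num, ?_⟩
    apply Set.Subset.antisymm
    · intro x hx
      have := h.lin hx
      rw [← hw] at this
      refine ⟨?_, ?_⟩
      · have := abs_add_le x.1 x.2
        simp; linarith
      · have := abs_sub x.2 x.1
        simp; linarith
    · rintro x ⟨h1, h2⟩
      have := h.body.comb h.e1 h.e2 (s := x.1) (t := x.2) (by
        simp at h1 h2
        rw [abs_le] at h1 h2
        rcases abs_cases x.1 with ⟨a, -⟩ | ⟨a, -⟩ <;> rcases abs_cases x.2 with ⟨b, -⟩ | ⟨b, -⟩ <;> linarith)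
      convert this using 1; ext <;> simp
  · obtain ⟨⟨y1, m⟩, hy, hy1⟩ := h.y1
    obtain ⟨⟨k, y2⟩, hk, hk1⟩ := h.y2
    simp at hy1 hk1
    subst hy1 hk1
    have hm := h.ylt hw hy
    have hk0 : |k| < 1 := h.swp.ylt (by rwa [real_pre mp_swp]) (by rw [pol_swp]; simpa using hk)
    obtain ⟨p, hp, p1, p2, p3⟩ := h.vert_eq hw hy hk
    obtain ⟨q, hq, q1, q2, q3⟩ := (h.flip true false).vert_eq (m := -m) (k := -k) 
      (by rwa [real_pre (mp_flip2 _ _)]) (by rw [pol_flip2]; simpa using hy) 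
      (by rw [pol_flip2]; simpa using h.body.pol.symm _ hk)
    rw [real_pre (mp_flip2 _ _)] at q3
    simp at hq
    set B := volume.real C / 2 with hB
    have hm' := abs_lt.1 hm
    have hk' := abs_lt.1 hk0
    -- (1-m) p2 = B - 1, (1-k) p1 = B - 1
    have i1 : (1 - m) * p.2 = B - 1 := by linarith
    have i2 : (1 - k) * p.1 = B - 1 := by linarith
    have i3 : (1 + m) * q.2 = B - 1 := by linarith
    have i4 : (1 + k) * q.1 = B - 1 := by linarith
    have j1 : (B - 1) * (2 - m - k) = B * ((1 - m) * (1 - k)) := by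
      calc _ = (1 - k) * (B - 1) + (1 - m) * (B - 1) := by ring
        _ = (1 - k) * ((1 - m) * p.2) + (1 - m) * ((1 - k) * p.1) := by rw [i1, i2]
        _ = _ := by rw [← p3]; ring
    have j2 : (B - 1) * (2 + m + k) = B * ((1 + m) * (1 + k)) := by
      calc _ = (1 + k) * (B - 1) + (1 + m) * (B - 1) := by ring
        _ = (1 + k) * ((1 + m) * q.2) + (1 + m) * ((1 + k) * q.1) := by rw [i3, i4]
        _ = _ := by rw [← q3]; ring
    have hkm : k = -m := by linarith
    subst hkm
    have hBm : B * (1 + m ^ 2) = 2 := by nlinarith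
    refine ⟨m, hm.le, ?_, ?_⟩
    · rw [eq_div_iff (by positivity)]; rw [hB] at hBm; linarith
    · apply Set.Subset.antisymm
      · intro x hx
        have a := pol_abs h.body hx hy
        have b := pol_abs h.body hx hk
        simp only [dot2] at a b
        refine ⟨?_, ?_⟩
        · convert a using 2; ring
        · convert b using 2; ring
      · rintro x ⟨h1, h2⟩
        set ξ := x.1 + m * x.2
        set η := x.2 - m * x.1
        have := h.body.comb hp hq (s := (ξ + η) / 2) (t := (ξ - η) / 2) (by
          rw [abs_le] at h1 h2
          rcases abs_cases ((ξ + η) / 2) with ⟨a, -⟩ | ⟨a, -⟩ <;> rcases abs_cases ((ξ - η) / 2) with ⟨b, -⟩ | ⟨b, -⟩ <;> linarith)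
        convert this using 1
        have hs : 0 < 1 + m ^ 2 := by positivity
        have u1 : (1 + m ^ 2) * p.1 = 1 - m := by linear_combination p1 - m * p2
        have u2 : (1 + m ^ 2) * p.2 = 1 + m := by linear_combination m * p1 + p2
        have u3 : (1 + m ^ 2) * q.1 = 1 + m := by linear_combination q1 + m * q2
        have u4 : (1 + m ^ 2) * q.2 = 1 - m := by linear_combination -m * q1 + q2
        ext
        · simp
          apply mul_left_cancel₀ hs.ne'
          linear_combination - (ξ + η) / 2 * u1 - (ξ - η) / 2 * u3
        · simp
          apply mul_left_cancel₀ hs.ne'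
          linear_combination - (ξ + η) / 2 * u2 + (ξ - η) / 2 * u4

end Mahler

end

section
open MeasureTheory
open scoped RealInnerProductSpace
set_option linter.all false

namespace Mahler

theorem mem_sqr {m : ℝ} {x : V2} : x ∈ sqr m ↔ |x.1 + m * x.2| ≤ 1 ∧ |x.2 - m * x.1| ≤ 1 := Iff.rfl

theorem sqr_v (m : ℝ) : (((1 - m) / (1 + m ^ 2), (1 + m) / (1 + m ^ 2)) : V2) ∈ sqr m := by
  have hs : 0 < 1 + m ^ 2 := by positivity
  rw [mem_sqr]
  constructor
  · rw [show (1 - m) / (1 + m ^ 2) + m * ((1 + m) / (1 + m ^ 2)) = 1 by field_simp; ring]; simp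
  · rw [show (1 + m) / (1 + m ^ 2) - m * ((1 - m) / (1 + m ^ 2)) = 1 by field_simp; ring]; simp

theorem sqr_v' (m : ℝ) : (((1 + m) / (1 + m ^ 2), (m - 1) / (1 + m ^ 2)) : V2) ∈ sqr m := by
  have hs : 0 < 1 + m ^ 2 := by positivity
  rw [mem_sqr]
  constructor
  · rw [show (1 + m) / (1 + m ^ 2) + m * ((m - 1) / (1 + m ^ 2)) = 1 by field_simp; ring]; simp
  · rw [show (m - 1) / (1 + m ^ 2) - m * ((1 + m) / (1 + m ^ 2)) = -1 by field_simp; ring]; simp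

theorem sqr_pol {m : ℝ} (hb : Body (sqr m)) (y : V2) : y ∈ pol (sqr m) ↔
    |(1 - m) * y.1 + (1 + m) * y.2| ≤ 1 + m ^ 2 ∧ |(1 + m) * y.1 + (m - 1) * y.2| ≤ 1 + m ^ 2 := by
  have hs : 0 < 1 + m ^ 2 := by positivity
  constructor
  · intro hy
    have a := pol_abs hb (sqr_v m) hy
    have b := pol_abs hb (sqr_v' m) hy
    simp only [dot2] at a b
    rw [show (1 - m) / (1 + m ^ 2) * y.1 + (1 + m) / (1 + m ^ 2) * y.2 = ((1 - m) * y.1 + (1 + m) * y.2) / (1 + m ^ 2) by ring,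
      abs_div, abs_of_pos hs, div_le_one hs] at a
    rw [show (1 + m) / (1 + m ^ 2) * y.1 + (m - 1) / (1 + m ^ 2) * y.2 = ((1 + m) * y.1 + (m - 1) * y.2) / (1 + m ^ 2) by ring,
      abs_div, abs_of_pos hs, div_le_one hs] at b
    exact ⟨a, b⟩
  · rintro ⟨h1, h2⟩ x ⟨h3, h4⟩
    rw [dot2]
    set ξ := x.1 + m * x.2 with hξ
    set η := x.2 - m * x.1 with hη
    set A := (1 - m) * y.1 + (1 + m) * y.2 with hA
    set B := (1 + m) * y.1 + (m - 1) * y.2 with hB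
    have e : (1 + m ^ 2) * (x.1 * y.1 + x.2 * y.2) = (ξ + η) / 2 * A + (ξ - η) / 2 * B := by
      rw [hξ, hη, hA, hB]; ring
    have f : (ξ + η) / 2 * A + (ξ - η) / 2 * B ≤ 1 + m ^ 2 := by
      have a1 : (ξ + η) / 2 * A ≤ |(ξ + η) / 2| * (1 + m ^ 2) := by
        refine (le_abs_self _).trans ?_
        rw [abs_mul]; gcongr
      have a2 : (ξ - η) / 2 * B ≤ |(ξ - η) / 2| * (1 + m ^ 2) := by
        refine (le_abs_self _).trans ?_
        rw [abs_mul]; gcongr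
      have a3 : |(ξ + η) / 2| + |(ξ - η) / 2| ≤ 1 := by
        rw [abs_le] at h3 h4
        rcases abs_cases ((ξ + η) / 2) with ⟨a, -⟩ | ⟨a, -⟩ <;> rcases abs_cases ((ξ - η) / 2) with ⟨b, -⟩ | ⟨b, -⟩ <;> linarith
      nlinarith
    rw [← e] at f
    by_contra hc
    push Not at hc
    nlinarith

theorem sqr_y1 {m : ℝ} (hb : Body (sqr m)) (hm : |m| < 1) {c : ℝ} (h : ((1, c) : V2) ∈ pol (sqr m)) : c = m := by
  rw [sqr_pol hb] at h
  obtain ⟨h1, h2⟩ := h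
  rw [abs_le] at h1 h2
  rw [abs_lt] at hm
  simp at h1 h2
  apply le_antisymm
  · by_contra hc; push Not at hc; nlinarith
  · by_contra hc; push Not at hc; nlinarith

theorem sqr_y2 {m : ℝ} (hb : Body (sqr m)) (hm : |m| < 1) {c : ℝ} (h : ((c, 1) : V2) ∈ pol (sqr m)) : c = -m := by
  rw [sqr_pol hb] at h
  obtain ⟨h1, h2⟩ := h
  rw [abs_le] at h1 h2
  rw [abs_lt] at hm
  simp at h1 h2
  apply le_antisymm
  · by_contra hc; push Not at hc; nlinarith
  · by_contra hc; push Not at hc; nlinarith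

structure Dat (K : Set V) (m1 m2 m3 : ℝ) : Prop extends Eq3 K where
  l1 : |m1| ≤ 1
  l2 : |m2| ≤ 1
  l3 : |m3| ≤ 1
  h1 : sec1 K = sqr m1
  h2 : sec2 K = sqr m2
  h3 : sec3 K = sqr m3
  hN : ∃ c, 0 < c ∧ NN (sec1 K) K = c / (1 + m1 ^ 2) ∧ NN (sec2 K) K = c / (1 + m2 ^ 2) ∧ NN (sec3 K) K = c / (1 + m3 ^ 2)

theorem Eq3.dat {K : Set V} (h : Eq3 K) : ∃ m1 m2 m3, Dat K m1 m2 m3 := by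
  obtain ⟨m1, l1, v1, h1⟩ := h.secs.1.struct
  obtain ⟨m2, l2, v2, h2⟩ := h.secs.2.1.struct
  obtain ⟨m3, l3, v3, h3⟩ := h.secs.2.2.struct
  have hp := h.vol_pos
  refine ⟨m1, m2, m3, h, l1, l2, l3, h1, h2, h3, 8 / (3 * volume.real K), by positivity, ?_, ?_, ?_⟩ <;>
    unfold NN <;> simp only [v1, v2, v3] <;> field_simp <;> norm_num

theorem NN_cyc (C : Set V2) (K : Set V) : NN C (cyc ⁻¹' K) = NN C K := by
  unfold NN; rw [real_pre mp_cyc]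

theorem Dat.cyc {K : Set V} {m1 m2 m3 : ℝ} (h : Dat K m1 m2 m3) : Dat (cyc ⁻¹' K) m3 m1 m2 where
  toEq3 := h.toEq3.cyc
  l1 := h.l3
  l2 := h.l1
  l3 := h.l2
  h1 := h.h3
  h2 := h.h1
  h3 := h.h2
  hN := by
    obtain ⟨c, hc, c1, c2, c3⟩ := h.hN
    refine ⟨c, hc, ?_, ?_, ?_⟩ <;> rw [NN_cyc]
    · exact c3
    · exact c1
    · exact c2

theorem sg_sq (a : Bool) : sg a ^ 2 = 1 := by cases a <;> simp

theorem flip_sqr (a b : Bool) (m : ℝ) : flip2 a b ⁻¹' sqr m = sqr (sg a * sg b * m) := by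
  ext x
  simp only [Set.mem_preimage, mem_sqr, flip2_apply]
  have ha := sg_sq a
  have hb := sg_sq b
  rw [show sg a * x.1 + m * (sg b * x.2) = sg a * (x.1 + sg a * sg b * m * x.2) by linear_combination - m * sg b * x.2 * ha,
    show sg b * x.2 - m * (sg a * x.1) = sg b * (x.2 - sg a * sg b * m * x.1) by linear_combination m * sg a * x.1 * hb, abs_mul,
    abs_mul, abs_sg, abs_sg, one_mul, one_mul]

theorem Dat.flip {K : Set V} {m1 m2 m3 : ℝ} (h : Dat K m1 m2 m3) (a b c : Bool) :
    Dat (flip3 a b c ⁻¹' K) (sg b * sg c * m1) (sg c * sg a * m2) (sg a * sg b * m3) := by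
  have e1 : sec1 (flip3 a b c ⁻¹' K) = flip2 b c ⁻¹' (sec1 K) := by ext; simp [sec1]
  have e2 : sec2 (flip3 a b c ⁻¹' K) = flip2 c a ⁻¹' (sec2 K) := by ext; simp [sec2]
  have e3 : sec3 (flip3 a b c ⁻¹' K) = flip2 a b ⁻¹' (sec3 K) := by ext; simp [sec3]
  refine ⟨h.toEq3.flip a b c, ?_, ?_, ?_, ?_, ?_, ?_, ?_⟩
  · simpa [abs_mul, abs_sg] using h.l1
  · simpa [abs_mul, abs_sg] using h.l2
  · simpa [abs_mul, abs_sg] using h.l3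
  · rw [e1, h.h1, flip_sqr]
  · rw [e2, h.h2, flip_sqr]
  · rw [e3, h.h3, flip_sqr]
  · obtain ⟨d, hd, c1, c2, c3⟩ := h.hN
    refine ⟨d, hd, ?_, ?_, ?_⟩ <;> simp only [mul_pow, sg_sq, one_mul, e1, e2, e3] <;> unfold NN <;>
      rw [real_pre (mp_flip3 _ _ _), real_pre (mp_flip2 _ _)]
    · exact c1
    · exact c2
    · exact c3

theorem Dat.mem1 {K : Set V} {m1 m2 m3 : ℝ} (h : Dat K m1 m2 m3) {b c : ℝ} :
    (0, b, c) ∈ K ↔ |b + m1 * c| ≤ 1 ∧ |c - m1 * b| ≤ 1 := by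
  have : (0, b, c) ∈ K ↔ (b, c) ∈ sec1 K := Iff.rfl
  rw [this, h.h1]; rfl
theorem Dat.mem2 {K : Set V} {m1 m2 m3 : ℝ} (h : Dat K m1 m2 m3) {a c : ℝ} :
    (a, 0, c) ∈ K ↔ |c + m2 * a| ≤ 1 ∧ |a - m2 * c| ≤ 1 := by
  have : (a, 0, c) ∈ K ↔ (c, a) ∈ sec2 K := Iff.rfl
  rw [this, h.h2]; rfl
theorem Dat.mem3 {K : Set V} {m1 m2 m3 : ℝ} (h : Dat K m1 m2 m3) {a b : ℝ} :
    (a, b, 0) ∈ K ↔ |a + m3 * b| ≤ 1 ∧ |b - m3 * a| ≤ 1 := by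
  have : (a, b, 0) ∈ K ↔ (a, b) ∈ sec3 K := Iff.rfl
  rw [this, h.h3]; rfl

/-- contradiction hypothesis for Case 0 -/
structure Case0 (K : Set V) (m1 m2 m3 : ℝ) : Prop extends Dat K m1 m2 m3 where
  k1 : |m1| < 1
  k2 : |m2| < 1
  k3 : |m3| < 1
  b1 : ∀ a b c, (a, b, c) ∈ K → a + m3 * b - m2 * c ≤ 1
  b2 : ∀ a b c, (a, b, c) ∈ K → b + m1 * c - m3 * a ≤ 1
  b3 : ∀ a b c, (a, b, c) ∈ K → c + m2 * a - m1 * b ≤ 1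
  nq : ∀ a b c, (a, b, c) ∈ K → a + m3 * b - m2 * c = 1 → b + m1 * c - m3 * a = 1 → c + m2 * a - m1 * b = 1 → False

theorem Case0.cyc {K : Set V} {m1 m2 m3 : ℝ} (h : Case0 K m1 m2 m3) : Case0 (cyc ⁻¹' K) m3 m1 m2 where
  toDat := h.toDat.cyc
  k1 := h.k3
  k2 := h.k1
  k3 := h.k2
  b1 a b c hx := h.b3 b c a hx
  b2 a b c hx := h.b1 b c a hx
  b3 a b c hx := h.b2 b c a hx
  nq a b c hx h1 h2 h3 := h.nq b c a hx h2 h3 h1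

section
variable {K : Set V} {m1 m2 m3 : ℝ}

theorem Dat.v1 (h : Dat K m1 m2 m3) : (0, (1 - m1) / (1 + m1 ^ 2), (1 + m1) / (1 + m1 ^ 2)) ∈ K := by
  rw [h.mem1]; exact sqr_v m1
theorem Dat.v2 (h : Dat K m1 m2 m3) : ((1 + m2) / (1 + m2 ^ 2), 0, (1 - m2) / (1 + m2 ^ 2)) ∈ K := by
  rw [h.mem2]; exact sqr_v m2
theorem Dat.v3 (h : Dat K m1 m2 m3) : ((1 - m3) / (1 + m3 ^ 2), (1 + m3) / (1 + m3 ^ 2), 0) ∈ K := by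
  rw [h.mem3]; exact sqr_v m3

theorem Case0.z1 (h : Case0 K m1 m2 m3) : m3 * (1 - m1) - m2 * (1 + m1) < 1 + m1 ^ 2 := by
  have hs : 0 < 1 + m1 ^ 2 := by positivity
  have hv := h.toDat.v1
  have e : 0 + m3 * ((1 - m1) / (1 + m1 ^ 2)) - m2 * ((1 + m1) / (1 + m1 ^ 2)) =
    (m3 * (1 - m1) - m2 * (1 + m1)) / (1 + m1 ^ 2) := by ring
  by_contra hc
  push Not at hc
  refine h.nq _ _ _ hv (le_antisymm (h.b1 _ _ _ hv) ?_) ?_ ?_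
  · rw [e, le_div_iff₀ hs]; linarith
  · field_simp; ring
  · field_simp; ring

theorem Case0.z2 (h : Case0 K m1 m2 m3) : m1 * (1 - m2) - m3 * (1 + m2) < 1 + m2 ^ 2 := h.cyc.cyc.z1
theorem Case0.z3 (h : Case0 K m1 m2 m3) : m2 * (1 - m3) - m1 * (1 + m3) < 1 + m3 ^ 2 := h.cyc.z1

theorem Case0.plane1 (h : Case0 K m1 m2 m3) {b c : ℝ} (hx : (0, b, c) ∈ K) (hc : 0 ≤ c)
    (e1 : m3 * b - m2 * c = 1) (e2 : b + m1 * c = 1) : False := by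
  have hs : 0 < 1 + m1 ^ 2 := by positivity
  have hz := h.z1
  have hk := (h.toDat.mem1.1 hx).2
  have hk := (abs_le.1 hk).2
  have k3 := abs_lt.1 h.k3
  have hb : b = 1 - m1 * c := by linarith
  subst hb
  have hr : c * (1 + m1 ^ 2) ≤ 1 + m1 := by nlinarith
  rcases le_or_gt (m1 * m3 + m2) 0 with h0 | h0
  · nlinarith [mul_le_mul_of_nonpos_right hr h0]
  · nlinarith [mul_nonneg hc h0.le]

theorem Case0.plane2 (h : Case0 K m1 m2 m3) {a c : ℝ} (hx : (a, 0, c) ∈ K) (hc : 0 ≤ c)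
    (e1 : a - m2 * c = 1) (e2 : m1 * c - m3 * a = 1) : False := by
  have hs : 0 < 1 + m2 ^ 2 := by positivity
  have hz := h.z2
  have hk := (h.toDat.mem2.1 hx).1
  have hk := (abs_le.1 hk).2
  have k3 := abs_lt.1 h.k3
  have ha : a = 1 + m2 * c := by linarith
  subst ha
  have hr : c * (1 + m2 ^ 2) ≤ 1 - m2 := by nlinarith
  rcases le_or_gt (m1 - m2 * m3) 0 with h0 | h0
  · nlinarith [mul_nonneg hc (neg_nonneg.2 h0)]
  · nlinarith [mul_le_mul_of_nonneg_right hr h0.le]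

theorem xi_zero {a b c : ℝ} (e1 : a + m3 * b - m2 * c = 0) (e2 : b + m1 * c - m3 * a = 0)
    (e3 : c + m2 * a - m1 * b = 0) : a = 0 ∧ b = 0 ∧ c = 0 := by
  have : a ^ 2 + b ^ 2 + c ^ 2 = 0 := by linear_combination a * e1 + b * e2 + c * e3
  refine ⟨?_, ?_, ?_⟩ <;> apply pow_eq_zero_iff (two_ne_zero) |>.1 <;> nlinarith [sq_nonneg a, sq_nonneg b, sq_nonneg c]

theorem Case0.edge (h : Case0 K m1 m2 m3) : ∃ a b c, (a, b, c) ∈ K ∧ 0 ≤ a ∧ 0 ≤ b ∧ 0 ≤ c ∧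
    a + m3 * b - m2 * c = 1 ∧ b + m1 * c - m3 * a = 1 ∧
    (∀ g, (a, b, c) + g ∈ K → (a, b, c) - g ∈ K → g = 0) := by
  have hs : 0 < 1 + m3 ^ 2 := by positivity
  have k3 := abs_lt.1 h.k3
  set S := K ∩ {x : V | x.1 + m3 * x.2.1 - m2 * x.2.2 = 1 ∧ x.2.1 + m1 * x.2.2 - m3 * x.1 = 1} with hS
  have hSc : IsCompact S := by
    refine h.body.compact.inter_right ?_
    rw [Set.setOf_and]
    exact (isClosed_eq (by fun_prop) (by fun_prop)).inter (isClosed_eq (by fun_prop) (by fun_prop))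
  have hv := h.toDat.v3
  set p := (1 - m3) / (1 + m3 ^ 2) with hp
  set q := (1 + m3) / (1 + m3 ^ 2) with hq
  have hp0 : 0 < p := div_pos (by linarith) hs
  have hq0 : 0 < q := div_pos (by linarith) hs
  have e1 : p + m3 * q = 1 := by rw [hp, hq]; field_simp; ring
  have e2 : q - m3 * p = 1 := by rw [hp, hq]; field_simp; ring
  have hvS : (p, q, 0) ∈ S := ⟨hv, by simp [e1], by simp [e2]⟩
  obtain ⟨⟨a, b, c⟩, ⟨hx, x1, x2⟩, hmax⟩ := hSc.exists_isMaxOn ⟨_, hvS⟩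
    (f := fun x : V => x.2.2 + m2 * x.1 - m1 * x.2.1) (by fun_prop)
  simp at x1 x2
  have hc : 0 ≤ c := by
    have hv' := hmax hvS
    simp at hv'
    by_contra hc
    push Not at hc
    have : (a - p) ^ 2 + (b - q) ^ 2 + c ^ 2 = c * ((c + m2 * a - m1 * b) - (m2 * p - m1 * q)) := by
      linear_combination (a - p) * (x1 - e1) + (b - q) * (x2 - e2)
    nlinarith [sq_nonneg (a - p), sq_nonneg (b - q)]
  have hseg : ∀ l : ℝ, 0 ≤ l → l ≤ 1 → ((1 - l) * p + l * a, (1 - l) * q + l * b, l * c) ∈ K := by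
    intro l h0 h1
    have := h.body.conv hv hx (a := 1 - l) (b := l) (by linarith) h0 (by ring)
    convert this using 1; ext <;> simp
  have ha : 0 ≤ a := by
    by_contra ha
    push Not at ha
    have hd : 0 < p - a := by linarith
    have hl := hseg (p / (p - a)) (by positivity) (by rw [div_le_one hd]; linarith)
    rw [show (1 - p / (p - a)) * p + p / (p - a) * a = 0 by field_simp; ring] at hl
    set l := p / (p - a) with hld
    have hl0 : 0 < l := by positivity
    have hla : l * (p - a) = p := by rw [hld]; field_simp
    refine h.plane1 hl (by positivity) ?_ ?_
    · linear_combination l * x1 + (1 - l) * e1 + hla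
    · linear_combination l * x2 + (1 - l) * e2 - m3 * hla
  have hb : 0 ≤ b := by
    by_contra hb
    push Not at hb
    have hd : 0 < q - b := by linarith
    have hl := hseg (q / (q - b)) (by positivity) (by rw [div_le_one hd]; linarith)
    rw [show (1 - q / (q - b)) * q + q / (q - b) * b = 0 by field_simp; ring] at hl
    set l := q / (q - b) with hld
    have hl0 : 0 < l := by positivity
    have hla : l * (q - b) = q := by rw [hld]; field_simp
    refine h.plane2 hl (by positivity) ?_ ?_
    · linear_combination l * x1 + (1 - l) * e1 + m3 * hla
    · linear_combination l * x2 + (1 - l) * e2 + hla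
  refine ⟨a, b, c, hx, ha, hb, hc, x1, x2, ?_⟩
  rintro ⟨u, v, w⟩ g1 g2
  simp only [Prod.mk_add_mk, Prod.mk_sub_mk] at g1 g2
  have i1 := h.b1 _ _ _ g1
  have i2 := h.b1 _ _ _ g2
  have i3 := h.b2 _ _ _ g1
  have i4 := h.b2 _ _ _ g2
  have f1 : u + m3 * v - m2 * w = 0 := by nlinarith
  have f2 : v + m1 * w - m3 * u = 0 := by nlinarith
  have j1 : (a + u, b + v, c + w) ∈ S := ⟨g1, by simp; linarith, by simp; linarith⟩
  have j2 : (a - u, b - v, c - w) ∈ S := ⟨g2, by simp; linarith, by simp; linarith⟩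
  have t1 := hmax j1
  have t2 := hmax j2
  simp at t1 t2
  obtain ⟨r1, r2, r3⟩ := xi_zero f1 f2 (show w + m2 * u - m1 * v = 0 by linarith)
  simp [r1, r2, r3]

theorem Case0.vZ (h : Case0 K m1 m2 m3) :
    (1 - m3) / (1 + m3 ^ 2) * NN (sec1 K) K + (1 + m3) / (1 + m3 ^ 2) * NN (sec2 K) K = 1 := by
  have hs : 0 < 1 + m3 ^ 2 := by positivity
  obtain ⟨a, b, c, hx, ha, hb, hc, x1, x2, hext⟩ := h.edge
  obtain ⟨c', a', b', hx', hc', ha', hb', x1', x2', hext'⟩ := h.cyc.edge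
  have hx' : (a', b', c') ∈ K := hx'
  have hZ := h.ext hx hext
  have hZ' := h.cyc.ext (x := (c', a', b')) hx' hext'
  simp only [abs_of_nonneg, ha, hb, hc, ha', hb', hc', NN_cyc] at hZ hZ'
  have hZ' : a' * NN (sec1 K) K + b' * NN (sec2 K) K + c' * NN (sec3 K) K = 1 := by
    have e1 : sec1 (Mahler.cyc ⁻¹' K) = sec3 K := rfl
    have e2 : sec2 (Mahler.cyc ⁻¹' K) = sec1 K := rfl
    have e3 : sec3 (Mahler.cyc ⁻¹' K) = sec2 K := rfl
    rw [e1, e2, e3] at hZ'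
    linarith
  obtain ⟨t, t0, t1, ⟨k1, k2, k3⟩, hk, hk1, hk2, hk3, hk4, he⟩ := h.fill (x := (a', b', c')) hx' ha' hb' hc' hZ' hx ha hb hc
  simp only [Prod.smul_mk, Prod.mk_add_mk, smul_eq_mul, Prod.mk.injEq] at he
  obtain ⟨he1, he2, he3⟩ := he
  have hne : ¬ (a = a' ∧ b = b' ∧ c = c') := by
    rintro ⟨rfl, rfl, rfl⟩
    exact h.nq _ _ _ hx x1 x2 x1'
  have ht : t = 0 := by
    by_contra ht
    have ht0 : 0 < t := lt_of_le_of_ne t0 (Ne.symm ht)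
    apply hne
    by_cases ht1 : t = 1
    · subst ht1; simp at he1 he2 he3; exact ⟨he1, he2, he3⟩
    have ht1 : t < 1 := lt_of_le_of_ne t1 ht1
    set ε := min t (1 - t) with hε
    have hε0 : 0 < ε := lt_min ht0 (by linarith)
    have hε1 : ε ≤ t := min_le_left _ _
    have hε2 : ε ≤ 1 - t := min_le_right _ _
    have := hext (ε * (k1 - a'), ε * (k2 - b'), ε * (k3 - c')) ?_ ?_
    · simp only [Prod.mk_eq_zero, mul_eq_zero, hε0.ne', false_or] at this
      obtain ⟨r1, r2, r3⟩ := this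
      rw [sub_eq_zero] at r1 r2 r3
      subst r1 r2 r3
      refine ⟨?_, ?_, ?_⟩ <;> linarith
    · have := h.body.conv hk hx' (a := 1 - t + ε) (b := t - ε) (by linarith) (by linarith) (by ring)
      convert this using 1; ext <;> simp [he1, he2, he3] <;> ring
    · have := h.body.conv hk hx' (a := 1 - t - ε) (b := t + ε) (by linarith) (by linarith) (by ring)
      convert this using 1; ext <;> simp [he1, he2, he3] <;> ring
  subst ht
  simp at he1 he2 he3
  subst he1 he2 he3
  have hc0 : c = 0 := by
    rcases mul_eq_zero.1 hk4 with h0 | h0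
    · rcases mul_eq_zero.1 h0 with h0 | h0
      · simp only at h0; subst h0; exact (h.plane1 hx hc (by linarith) (by linarith)).elim
      · simp only at h0; subst h0; exact (h.plane2 hx hc (by linarith) (by linarith)).elim
    · exact h0
  subst hc0
  have ea : a = (1 - m3) / (1 + m3 ^ 2) := by rw [eq_div_iff hs.ne']; linear_combination x1 - m3 * x2
  have eb : b = (1 + m3) / (1 + m3 ^ 2) := by rw [eq_div_iff hs.ne']; linear_combination x2 + m3 * x1
  rw [← ea, ← eb]; linarith

theorem Case0.false (h : Case0 K m1 m2 m3) : False := by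
  have s1 : 0 < 1 + m1 ^ 2 := by positivity
  have s2 : 0 < 1 + m2 ^ 2 := by positivity
  have s3 : 0 < 1 + m3 ^ 2 := by positivity
  have k1 := abs_lt.1 h.k1
  have k2 := abs_lt.1 h.k2
  have k3 := abs_lt.1 h.k3
  have hv := h.vZ
  have hm := h.body.conv h.toDat.v1 h.toDat.v2 (a := 1 / 2) (b := 1 / 2) (by norm_num) (by norm_num) (by norm_num)
  simp only [Prod.smul_mk, Prod.mk_add_mk, smul_eq_mul] at hm
  have p1 : 0 < (1 - m1) / (1 + m1 ^ 2) := div_pos (by linarith) s1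
  have p2 : 0 < (1 + m1) / (1 + m1 ^ 2) := div_pos (by linarith) s1
  have p3 : 0 < (1 - m2) / (1 + m2 ^ 2) := div_pos (by linarith) s2
  have p4 : 0 < (1 + m2) / (1 + m2 ^ 2) := div_pos (by linarith) s2
  have p5 : 0 < (1 - m3) / (1 + m3 ^ 2) := div_pos (by linarith) s3
  have p6 : 0 < (1 + m3) / (1 + m3 ^ 2) := div_pos (by linarith) s3
  obtain ⟨t, t0, t1, ⟨k1, k2, k3⟩, hk, hk1, hk2, hk3, hk4, he⟩ := h.fill h.toDat.v3 p5.le p6.le le_rfl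
    (by simpa using hv) hm (by simp; positivity) (by simp; positivity) (by simp; positivity)
  simp only [Prod.smul_mk, Prod.mk_add_mk, smul_eq_mul, Prod.mk.injEq] at he
  obtain ⟨e1, e2, e3⟩ := he
  have hb := h.b3 _ _ _ hk
  have hz : m2 * ((1 - m3) / (1 + m3 ^ 2)) - m1 * ((1 + m3) / (1 + m3 ^ 2)) < 1 := by
    have := h.z3
    rw [show m2 * ((1 - m3) / (1 + m3 ^ 2)) - m1 * ((1 + m3) / (1 + m3 ^ 2)) = (m2 * (1 - m3) - m1 * (1 + m3)) / (1 + m3 ^ 2) by ring,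
      div_lt_one s3]
    exact this
  have f1 : (1 + m1) / (1 + m1 ^ 2) - m1 * ((1 - m1) / (1 + m1 ^ 2)) = 1 := by field_simp; ring
  have f2 : (1 - m2) / (1 + m2 ^ 2) + m2 * ((1 + m2) / (1 + m2 ^ 2)) = 1 := by field_simp; ring
  have ht : t = 0 := by
    by_contra ht
    have ht0 : 0 < t := lt_of_le_of_ne t0 (Ne.symm ht)
    have key : (1 - t) * (k3 + m2 * k1 - m1 * k2) + t * (m2 * ((1 - m3) / (1 + m3 ^ 2)) - m1 * ((1 + m3) / (1 + m3 ^ 2))) = 1 := by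
      linear_combination 1 / 2 * f1 + 1 / 2 * f2 - e3 - m2 * e1 + m1 * e2
    nlinarith [mul_lt_mul_of_pos_left hz ht0, mul_le_mul_of_nonneg_left hb (show 0 ≤ 1 - t by linarith)]
  subst ht
  simp at e1 e2 e3
  have : 0 < k1 * k2 * k3 := by rw [← e1, ← e2, ← e3]; positivity
  simp only at hk4
  linarith

end

end Mahler

end

section
open MeasureTheory
open scoped RealInnerProductSpace
set_option linter.all false

namespace Mahler

def Para (K : Set V) : Prop := ∃ e : V ≃ₗ[ℝ] V, K = e ⁻¹' box3 1 1 1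

theorem Para.pre {K : Set V} (e : V ≃ₗ[ℝ] V) (h : Para (e ⁻¹' K)) : Para K := by
  obtain ⟨f, hf⟩ := h
  refine ⟨e.symm.trans f, ?_⟩
  ext x
  have : e.symm x ∈ e ⁻¹' K ↔ e.symm x ∈ f ⁻¹' box3 1 1 1 := by rw [hf]
  simpa using this

/-- linear equivalence from an explicit inverse -/
noncomputable def mkE (f g : V →ₗ[ℝ] V) (h1 : ∀ x, g (f x) = x) (h2 : ∀ x, f (g x) = x) : V ≃ₗ[ℝ] V :=
  LinearEquiv.ofLinear f g (LinearMap.ext h2) (LinearMap.ext h1)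

theorem mkE_inj (f : V →ₗ[ℝ] V) (h : ∀ x, f x = 0 → x = 0) : ∃ e : V ≃ₗ[ℝ] V, ∀ x, e x = f x := by
  have hi : Function.Injective f := (injective_iff_map_eq_zero f).2 h
  exact ⟨LinearEquiv.ofInjectiveEndo f hi, fun x => rfl⟩

def mat3 (a1 a2 a3 b1 b2 b3 c1 c2 c3 : ℝ) : V →ₗ[ℝ] V where
  toFun x := (a1 * x.1 + a2 * x.2.1 + a3 * x.2.2, b1 * x.1 + b2 * x.2.1 + b3 * x.2.2, c1 * x.1 + c2 * x.2.1 + c3 * x.2.2)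
  map_add' x y := by ext <;> simp <;> ring
  map_smul' x y := by ext <;> simp <;> ring

theorem para_of {K : Set V} (a1 a2 a3 b1 b2 b3 c1 c2 c3 : ℝ) 
    (hi : ∀ x y z : ℝ, a1 * x + a2 * y + a3 * z = 0 → b1 * x + b2 * y + b3 * z = 0 → c1 * x + c2 * y + c3 * z = 0 → 
      x = 0 ∧ y = 0 ∧ z = 0)
    (hK : ∀ x y z : ℝ, (x, y, z) ∈ K ↔ |a1 * x + a2 * y + a3 * z| ≤ 1 ∧ |b1 * x + b2 * y + b3 * z| ≤ 1 ∧ |c1 * x + c2 * y + c3 * z| ≤ 1) :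
    Para K := by
  obtain ⟨e, he⟩ := mkE_inj (mat3 a1 a2 a3 b1 b2 b3 c1 c2 c3) (by
    rintro ⟨x, y, z⟩ h
    simp [mat3] at h
    obtain ⟨r1, r2, r3⟩ := hi x y z h.1 h.2.1 h.2.2
    simp [r1, r2, r3])
  refine ⟨e, ?_⟩
  ext ⟨x, y, z⟩
  rw [hK, Set.mem_preimage, he]
  rfl

section
variable {K : Set V} {m1 m2 m3 : ℝ}

theorem Dat.body1 (h : Dat K m1 m2 m3) : Body (sqr m1) := h.h1 ▸ h.s1.body
theorem Dat.body2 (h : Dat K m1 m2 m3) : Body (sqr m2) := h.h2 ▸ h.s2.body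
theorem Dat.body3 (h : Dat K m1 m2 m3) : Body (sqr m3) := h.h3 ▸ h.s3.body

theorem Dat.pr1 (h : Dat K m1 m2 m3) {a b c : ℝ} (hy : (a, b, c) ∈ pol K) : (b, c) ∈ pol (sqr m1) := by
  rw [← h.h1, pol_sec1 h.body]; exact ⟨_, hy, rfl⟩
theorem Dat.pr2 (h : Dat K m1 m2 m3) {a b c : ℝ} (hy : (a, b, c) ∈ pol K) : (c, a) ∈ pol (sqr m2) := by
  rw [← h.h2, pol_sec2 h.body]; exact ⟨_, hy, rfl⟩
theorem Dat.pr3 (h : Dat K m1 m2 m3) {a b c : ℝ} (hy : (a, b, c) ∈ pol K) : (a, b) ∈ pol (sqr m3) := by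
  rw [← h.h3, pol_sec3 h.body]; exact ⟨_, hy, rfl⟩
theorem Dat.lift1 (h : Dat K m1 m2 m3) {b c : ℝ} (hy : (b, c) ∈ pol (sqr m1)) : ∃ a, (a, b, c) ∈ pol K := by
  rw [← h.h1, pol_sec1 h.body] at hy
  obtain ⟨⟨a, b, c⟩, h', e⟩ := hy
  simp at e; obtain ⟨rfl, rfl⟩ := e; exact ⟨a, h'⟩
theorem Dat.lift2 (h : Dat K m1 m2 m3) {c a : ℝ} (hy : (c, a) ∈ pol (sqr m2)) : ∃ b, (a, b, c) ∈ pol K := by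
  rw [← h.h2, pol_sec2 h.body] at hy
  obtain ⟨⟨a, b, c⟩, h', e⟩ := hy
  simp at e; obtain ⟨rfl, rfl⟩ := e; exact ⟨b, h'⟩
theorem Dat.lift3 (h : Dat K m1 m2 m3) {a b : ℝ} (hy : (a, b) ∈ pol (sqr m3)) : ∃ c, (a, b, c) ∈ pol K := by
  rw [← h.h3, pol_sec3 h.body] at hy
  obtain ⟨⟨a, b, c⟩, h', e⟩ := hy
  simp at e; obtain ⟨rfl, rfl⟩ := e; exact ⟨c, h'⟩

theorem Dat.Y1 (h : Dat K m1 m2 m3) (k2 : |m2| < 1) (k3 : |m3| < 1) : (1, m3, -m2) ∈ pol K := by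
  obtain ⟨⟨a, b⟩, hy, e⟩ := h.s3.y1
  simp at e; subst e
  rw [h.h3] at hy
  have := sqr_y1 h.body3 k3 hy
  subst this
  obtain ⟨c, hc⟩ := h.lift3 hy
  have := sqr_y2 h.body2 k2 (h.pr2 hc)
  rwa [this] at hc

theorem Dat.abs1 (h : Dat K m1 m2 m3) {a b c x y z : ℝ} (hy : (a, b, c) ∈ pol K) (hx : (x, y, z) ∈ K) :
    |a * x + b * y + c * z| ≤ 1 := by
  have := pol_abs h.body hx hy
  rw [dot3] at this
  convert this using 2; simp; ring

theorem Dat.q_mem (h : Dat K m1 m2 m3) (k1 : |m1| < 1) (k2 : |m2| < 1) (k3 : |m3| < 1) :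
    ∃ a b c, (a, b, c) ∈ K ∧ a + m3 * b - m2 * c = 1 ∧ b + m1 * c - m3 * a = 1 ∧ c + m2 * a - m1 * b = 1 := by
  by_contra hc
  push Not at hc
  have y1 := h.Y1 k2 k3
  have y2 := h.cyc.cyc.Y1 k3 k1
  have y3 := h.cyc.Y1 k1 k2
  refine Case0.false (K := K) (m1 := m1) (m2 := m2) (m3 := m3) ⟨h, k1, k2, k3, ?_, ?_, ?_, fun a b c hx h1 h2 h3 => hc a b c hx h1 h2 h3⟩
  · intro a b c hx
    have := le_of_abs_le (h.abs1 y1 hx); linarith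
  · intro a b c hx
    have := le_of_abs_le (h.cyc.cyc.abs1 (x := b) (y := c) (z := a) y2 hx); linarith
  · intro a b c hx
    have := le_of_abs_le (h.cyc.abs1 (x := c) (y := a) (z := b) y3 hx); linarith

theorem interp {K : Set V} (hc : Convex ℝ K) {a b c u v w t r s : ℝ} (h1 : (a, b, c) ∈ K) (h2 : (u, v, w) ∈ K)
    (ht : |t| ≤ 1) : ((1 + t) / 2 * a + (1 - t) / 2 * u, (1 + t) / 2 * b + (1 - t) / 2 * v, (1 + t) / 2 * c + (1 - t) / 2 * w) ∈ K := by
  have := abs_le.1 ht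
  have := hc h1 h2 (a := (1 + t) / 2) (b := (1 - t) / 2) (by linarith) (by linarith) (by ring)
  convert this using 1; ext <;> simp

theorem Dat.case0 (h : Dat K m1 m2 m3) (k1 : |m1| < 1) (k2 : |m2| < 1) (k3 : |m3| < 1) : Para K := by
  have y1 := h.Y1 k2 k3
  have y2 := h.cyc.cyc.Y1 k3 k1
  have y3 := h.cyc.Y1 k1 k2
  -- vertices
  have hv : ∀ σ τ ρ : Bool, ∃ a b c, (a, b, c) ∈ K ∧ a + m3 * b - m2 * c = sg σ ∧ b + m1 * c - m3 * a = sg τ ∧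
      c + m2 * a - m1 * b = sg ρ := by
    intro σ τ ρ
    obtain ⟨a, b, c, hx, e1, e2, e3⟩ := (h.flip σ τ ρ).q_mem (by simpa [abs_mul, abs_sg] using k1)
      (by simpa [abs_mul, abs_sg] using k2) (by simpa [abs_mul, abs_sg] using k3)
    have s1 := sg_sq σ
    have s2 := sg_sq τ
    have s3 := sg_sq ρ
    refine ⟨sg σ * a, sg τ * b, sg ρ * c, by simpa using hx, ?_, ?_, ?_⟩
    · linear_combination sg σ * e1 - m3 * sg τ * b * s1 + m2 * sg ρ * c * s1
    · linear_combination sg τ * e2 - m1 * sg ρ * c * s2 + m3 * sg σ * a * s2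
    · linear_combination sg ρ * e3 - m2 * sg σ * a * s3 + m1 * sg τ * b * s3
  refine para_of 1 m3 (-m2) (-m3) 1 m1 m2 (-m1) 1 ?_ ?_
  · intro x y z e1 e2 e3
    exact xi_zero (m1 := m1) (m2 := m2) (m3 := m3) (by linarith) (by linarith) (by linarith)
  · intro x y z
    constructor
    · intro hx
      refine ⟨h.abs1 y1 hx, ?_, ?_⟩
      · have := h.cyc.cyc.abs1 (x := y) (y := z) (z := x) y2 hx
        convert this using 2; ring
      · have := h.cyc.abs1 (x := z) (y := x) (z := y) y3 hx
        convert this using 2; ring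
    · rintro ⟨h1, h2, h3⟩
      -- interpolate
      have st1 : ∀ τ ρ : Bool, ∀ s : ℝ, |s| ≤ 1 → ∃ a b c, (a, b, c) ∈ K ∧ a + m3 * b - m2 * c = s ∧ b + m1 * c - m3 * a = sg τ ∧
          c + m2 * a - m1 * b = sg ρ := by
        intro τ ρ s hs
        obtain ⟨a, b, c, hx, e1, e2, e3⟩ := hv true τ ρ
        obtain ⟨u, v, w, hx', e1', e2', e3'⟩ := hv false τ ρ
        rw [sg_true] at e1; rw [sg_false] at e1'
        refine ⟨_, _, _, interp h.body.conv (r := 0) (s := 0) hx hx' hs, ?_, ?_, ?_⟩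
        · linear_combination (1 + s) / 2 * e1 + (1 - s) / 2 * e1'
        · linear_combination (1 + s) / 2 * e2 + (1 - s) / 2 * e2'
        · linear_combination (1 + s) / 2 * e3 + (1 - s) / 2 * e3'
      have st2 : ∀ ρ : Bool, ∀ s t : ℝ, |s| ≤ 1 → |t| ≤ 1 → ∃ a b c, (a, b, c) ∈ K ∧ a + m3 * b - m2 * c = s ∧ b + m1 * c - m3 * a = t ∧
          c + m2 * a - m1 * b = sg ρ := by
        intro ρ s t hs ht
        obtain ⟨a, b, c, hx, e1, e2, e3⟩ := st1 true ρ s hs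
        obtain ⟨u, v, w, hx', e1', e2', e3'⟩ := st1 false ρ s hs
        rw [sg_true] at e2; rw [sg_false] at e2'
        refine ⟨_, _, _, interp h.body.conv (r := 0) (s := 0) hx hx' ht, ?_, ?_, ?_⟩
        · linear_combination (1 + t) / 2 * e1 + (1 - t) / 2 * e1'
        · linear_combination (1 + t) / 2 * e2 + (1 - t) / 2 * e2'
        · linear_combination (1 + t) / 2 * e3 + (1 - t) / 2 * e3'
      have st3 : ∀ s t r : ℝ, |s| ≤ 1 → |t| ≤ 1 → |r| ≤ 1 → ∃ a b c, (a, b, c) ∈ K ∧ a + m3 * b - m2 * c = s ∧ b + m1 * c - m3 * a = t ∧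
          c + m2 * a - m1 * b = r := by
        intro s t r hs ht hr
        obtain ⟨a, b, c, hx, e1, e2, e3⟩ := st2 true s t hs ht
        obtain ⟨u, v, w, hx', e1', e2', e3'⟩ := st2 false s t hs ht
        rw [sg_true] at e3; rw [sg_false] at e3'
        refine ⟨_, _, _, interp h.body.conv (r := 0) (s := 0) hx hx' hr, ?_, ?_, ?_⟩
        · linear_combination (1 + r) / 2 * e1 + (1 - r) / 2 * e1'
        · linear_combination (1 + r) / 2 * e2 + (1 - r) / 2 * e2'
        · linear_combination (1 + r) / 2 * e3 + (1 - r) / 2 * e3'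
      obtain ⟨a, b, c, hx, e1, e2, e3⟩ := st3 _ _ _ h1 h2 h3
      obtain ⟨r1, r2, r3⟩ := xi_zero (m1 := m1) (m2 := m2) (m3 := m3) (a := a - x) (b := b - y) (c := c - z) (by linarith)
        (by linarith) (by linarith)
      rw [sub_eq_zero] at r1 r2 r3
      rwa [r1, r2, r3] at hx

theorem sqr_one {m : ℝ} (hb : Body (sqr m)) (hm : |m| = 1) {a b : ℝ} (ha : |a| ≤ 1) (hb' : |b| ≤ 1) : ((a, b) : V2) ∈ pol (sqr m) := by
  rw [sqr_pol hb]
  rw [abs_le] at ha hb'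
  rcases (abs_eq (by norm_num : (0:ℝ) ≤ 1)).1 hm with rfl | rfl <;> constructor <;> rw [abs_le] <;> constructor <;>
    simp only <;> linarith

theorem Dat.case1 (h : Dat K m1 m2 m3) (k1 : |m1| < 1) (k2 : |m2| < 1) (k3 : |m3| = 1) : Para K := by
  have hy1 : ∀ b c, (1, b, c) ∈ pol K → c = -m2 := fun b c hy => sqr_y2 h.body2 k2 (h.pr2 hy)
  have hy2 : ∀ a c, (a, 1, c) ∈ pol K → c = m1 := fun b c hy => sqr_y1 h.body1 k1 (h.pr1 hy)
  obtain ⟨c, hc⟩ := h.lift3 (sqr_one h.body3 k3 (a := 1) (b := 1) (by simp) (by simp))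
  obtain ⟨d, hd⟩ := h.lift3 (sqr_one h.body3 k3 (a := 1) (b := -1) (by simp) (by simp))
  have i1 := hy1 _ _ hc
  have i2 := hy2 _ _ hc
  have i3 := hy1 _ _ hd
  have hd' := h.body.pol.symm _ hd
  have i4 := hy2 (-1) (-d) (by simpa using hd')
  have hm1 : m1 = 0 := by linarith
  have hm2 : m2 = 0 := by linarith
  subst hm1 hm2
  have hc0 : c = 0 := by linarith
  have hd0 : d = 0 := by linarith
  subst hc0 hd0
  have y3 := h.cyc.Y1 k1 k2
  simp only [neg_zero] at y3
  refine para_of 1 1 0 1 (-1) 0 0 0 1 ?_ ?_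
  · intro x y z e1 e2 e3
    refine ⟨?_, ?_, ?_⟩ <;> linarith
  · intro x y z
    constructor
    · intro hx
      refine ⟨h.abs1 hc hx, h.abs1 hd hx, ?_⟩
      have := h.cyc.abs1 (x := z) (y := x) (z := y) y3 hx
      convert this using 2; ring
    · rintro ⟨h1, h2, h3⟩
      by_contra hx
      obtain ⟨⟨a, b, c⟩, hy, hlt⟩ := sep h.body.conv h.body.closed h.body.zero_mem hx
      rw [dot3] at hlt
      have p1 : (1, 0, 1) ∈ K := by rw [h.mem2]; simp
      have p2 : (1, 0, -1) ∈ K := by rw [h.mem2]; simp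
      have p3 : (0, 1, 1) ∈ K := by rw [h.mem1]; simp
      have p4 : (0, 1, -1) ∈ K := by rw [h.mem1]; simp
      have q1 := abs_le.1 (h.abs1 hy p1)
      have q2 := abs_le.1 (h.abs1 hy p2)
      have q3 := abs_le.1 (h.abs1 hy p3)
      have q4 := abs_le.1 (h.abs1 hy p4)
      have r1 : |a| + |c| ≤ 1 := by
        rcases abs_cases a with ⟨u, -⟩ | ⟨u, -⟩ <;> rcases abs_cases c with ⟨v, -⟩ | ⟨v, -⟩ <;> rw [u, v] <;> linarith
      have r2 : |b| + |c| ≤ 1 := by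
        rcases abs_cases b with ⟨u, -⟩ | ⟨u, -⟩ <;> rcases abs_cases c with ⟨v, -⟩ | ⟨v, -⟩ <;> rw [u, v] <;> linarith
      have r3 : |x| + |y| ≤ 1 := by
        rw [abs_le] at h1 h2
        rcases abs_cases x with ⟨u, -⟩ | ⟨u, -⟩ <;> rcases abs_cases y with ⟨v, -⟩ | ⟨v, -⟩ <;> rw [u, v] <;> linarith
      have r4 : |z| ≤ 1 := by simpa using h3
      have t1 : x * a ≤ |x| * (1 - |c|) := by
        refine (le_abs_self _).trans ?_
        rw [abs_mul]; gcongr; linarith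
      have t2 : y * b ≤ |y| * (1 - |c|) := by
        refine (le_abs_self _).trans ?_
        rw [abs_mul]; gcongr; linarith
      have t3 : z * c ≤ 1 * |c| := by
        refine (le_abs_self _).trans ?_
        rw [abs_mul]; gcongr
      have t4 : 0 ≤ 1 - |c| := by linarith [abs_nonneg a]
      simp only at hlt
      nlinarith

/-- the vectors of the polar with first coordinate one, when `e1` is not extreme -/
theorem Dat.kap (h : Dat K m1 m2 m3) (k2 : |m2| = 1) (k3 : |m3| = 1) (hN : NN (sec1 K) K ≠ 1) :
    ∃ κ : ℝ, |κ| = 1 ∧ ∀ b c, (1, b, c) ∈ pol K → c = κ * b := by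
  have he1 : ((1, 0, 0) : V) ∈ K := h.s3.e1
  obtain ⟨⟨g1, g2, g3⟩, hg1, hg2, hg0⟩ : ∃ g, ((1, 0, 0) : V) + g ∈ K ∧ ((1, 0, 0) : V) - g ∈ K ∧ g ≠ 0 := by
    by_contra hc
    push Not at hc
    have := h.ext he1 hc
    simp at this; exact hN this
  simp only [Prod.mk_add_mk, Prod.mk_sub_mk] at hg1 hg2
  have hl : ∀ b c, (1, b, c) ∈ pol K → g1 + g2 * b + g3 * c = 0 := by
    intro b c hy
    have a1 := le_of_abs_le (h.abs1 hy hg1)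
    have a2 := le_of_abs_le (h.abs1 hy hg2)
    linarith
  have hb : ∀ a b c, (a, b, c) ∈ pol K → |b| ≤ 1 ∧ |c| ≤ 1 := by
    intro a b c hy
    have e2 : ((0, 1, 0) : V) ∈ K := h.s3.e2
    have e3 : ((0, 0, 1) : V) ∈ K := h.s1.e2
    have a1 := h.abs1 hy e2
    have a2 := h.abs1 hy e3
    simp at a1 a2
    exact ⟨a1, a2⟩
  obtain ⟨a, ha⟩ := h.lift3 (sqr_one h.body3 k3 (a := 1) (b := 1) (by simp) (by simp))
  obtain ⟨b, hb'⟩ := h.lift3 (sqr_one h.body3 k3 (a := 1) (b := -1) (by simp) (by simp))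
  obtain ⟨c, hc⟩ := h.lift2 (sqr_one h.body2 k2 (a := 1) (b := 1) (by simp) (by simp))
  obtain ⟨d, hd⟩ := h.lift2 (sqr_one h.body2 k2 (a := -1) (b := 1) (by simp) (by simp))
  have l1 := hl _ _ ha
  have l2 := hl _ _ hb'
  have l3 := hl _ _ hc
  have l4 := hl _ _ hd
  have u1 := abs_le.1 (hb _ _ _ ha).2
  have u2 := abs_le.1 (hb _ _ _ hb').2
  have u3 := abs_le.1 (hb _ _ _ hc).1
  have u4 := abs_le.1 (hb _ _ _ hd).1
  have i1 : 2 * g2 = g3 * (b - a) := by linarith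
  have i2 : 2 * g3 = g2 * (d - c) := by linarith
  have hg3 : g3 ≠ 0 := by
    intro h0
    subst h0
    have : g2 = 0 := by linarith
    subst this
    have : g1 = 0 := by linarith
    subst this
    simp at hg0
  have hab : (b - a) * (d - c) = 4 := by
    have : g3 * ((b - a) * (d - c) - 4) = 0 := by linear_combination -(d - c) * i1 - 2 * i2
    have := (mul_eq_zero.1 this).resolve_left hg3
    linarith
  have hba : b - a = 2 ∨ b - a = -2 := by
    rcases le_or_gt 0 (b - a) with h0 | h0
    · left
      apply le_antisymm (by linarith)
      by_contra hcc; push Not at hcc; nlinarith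
    · right
      apply le_antisymm _ (by linarith)
      by_contra hcc; push Not at hcc; nlinarith
  rcases hba with h0 | h0
  · have eb : b = 1 := by linarith
    have ea : a = -1 := by linarith
    refine ⟨-1, by simp, fun y z hy => ?_⟩
    have := hl _ _ hy
    have : g3 * (z - -1 * y) = 0 := by linear_combination this + (- y) / 2 * i1 - l1 / 2 - l2 / 2 + (- g3*y/2 + g3/2)*eb + (g3*y/2 + g3/2)*ea
    have := (mul_eq_zero.1 this).resolve_left hg3
    linarith
  · have eb : b = -1 := by linarith
    have ea : a = 1 := by linarith
    refine ⟨1, by simp, fun y z hy => ?_⟩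
    have := hl _ _ hy
    have : g3 * (z - 1 * y) = 0 := by linear_combination this + (- y) / 2 * i1 - l1 / 2 - l2 / 2 + (- g3*y/2 + g3/2)*eb + (g3*y/2 + g3/2)*ea
    have := (mul_eq_zero.1 this).resolve_left hg3
    linarith

theorem Dat.case2b (h : Dat K m1 m2 m3) (k2 : |m2| = 1) (k3 : |m3| = 1) (hN : NN (sec1 K) K ≠ 1) : False := by
  obtain ⟨κ, hκ, hk⟩ := h.kap k2 k3 hN
  obtain ⟨a, ha⟩ := h.lift3 (sqr_one h.body3 k3 (a := 1) (b := 1) (by simp) (by simp))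
  obtain ⟨b, hb⟩ := h.lift3 (sqr_one h.body3 k3 (a := 1) (b := -1) (by simp) (by simp))
  have ea := hk _ _ ha
  have eb := hk _ _ hb
  have hb' := h.body.pol.symm _ hb
  simp only [Prod.neg_mk, neg_neg] at hb'
  have hκ2 : κ ^ 2 = 1 := by rw [← sq_abs, hκ]; norm_num
  have e1 : |m1| = 1 := by
    have hl := h.l1
    have q := (sqr_pol h.body1 _).1 (h.pr1 ha)
    refine le_antisymm hl ?_
    rcases (abs_eq (by norm_num : (0:ℝ) ≤ 1)).1 hκ with hh | hh
    · subst hh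
      have := le_of_abs_le q.1
      simp only [ea] at this
      have : 1 ≤ m1 ^ 2 := by linarith
      rw [← sq_abs] at this
      nlinarith [abs_nonneg m1]
    · subst hh
      have := le_of_abs_le q.2
      simp only [ea] at this
      have : 1 ≤ m1 ^ 2 := by linarith
      rw [← sq_abs] at this
      nlinarith [abs_nonneg m1]
  have hN2 : NN (sec2 K) K ≠ 1 := by
    obtain ⟨c, hc, c1, c2, c3⟩ := h.hN
    rw [c1, ← sq_abs, e1] at hN
    rw [c2, ← sq_abs, k2]
    exact hN
  obtain ⟨κ', hκ', hk'⟩ := h.cyc.cyc.kap k3 e1 (by rw [NN_cyc, NN_cyc]; exact hN2)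
  have w1 := hk' a 1 (by rw [pol_cyc, pol_cyc]; exact ha)
  have w2 := hk' (-b) (-1) (by rw [pol_cyc, pol_cyc]; exact hb')
  have : a = -b := by linarith
  rw [this] at w1
  linarith

theorem Dat.case2a0 (h : Dat K m1 m2 m3) (k2 : |m2| = 1) (k3 : |m3| = 1) (hN : NN (sec1 K) K = 1)
    {a b c x y z : ℝ} (hx : (x, y, z) ∈ K) (x0 : 0 ≤ x) (y0 : 0 ≤ y) (z0 : 0 ≤ z) (ha : |a| ≤ 1)
    (hbc : (b, c) ∈ pol (sqr m1)) : a * x + b * y + c * z ≤ 1 := by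
  have he1 : ((1, 0, 0) : V) ∈ K := h.s3.e1
  have hb := abs_le.1 (pol_abs h.body1 (show ((1, 0) : V2) ∈ sqr m1 from h.h1 ▸ h.s1.e1) hbc)
  have hc := abs_le.1 (pol_abs h.body1 (show ((0, 1) : V2) ∈ sqr m1 from h.h1 ▸ h.s1.e2) hbc)
  simp [dot2] at hb hc
  have ha := abs_le.1 ha
  obtain ⟨t, t0, t1, ⟨u, v, w⟩, hk, u0, v0, w0, hk4, he⟩ := h.fill he1 zero_le_one le_rfl le_rfl (by simpa using hN) hx x0 y0 z0
  simp only [Prod.smul_mk, Prod.mk_add_mk, smul_eq_mul, Prod.mk.injEq] at he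
  obtain ⟨e1, e2, e3⟩ := he
  simp only at u0 v0 w0 hk4
  have key : a * u + b * v + c * w ≤ 1 := by
    rcases mul_eq_zero.1 hk4 with h0 | h0
    · rcases mul_eq_zero.1 h0 with h0 | h0
      · subst h0
        have := hbc _ (show ((v, w) : V2) ∈ sqr m1 from h.h1 ▸ hk)
        rw [dot2] at this
        simp only at this
        linarith
      · subst h0
        have := h.mem2.1 hk
        have i1 := abs_le.1 this.1
        have i2 := abs_le.1 this.2
        have : u + w ≤ 1 := by
          rcases (abs_eq (by norm_num : (0:ℝ) ≤ 1)).1 k2 with rfl | rfl <;> linarith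
        nlinarith
    · subst h0
      have := h.mem3.1 hk
      have i1 := abs_le.1 this.1
      have i2 := abs_le.1 this.2
      have : u + v ≤ 1 := by
        rcases (abs_eq (by norm_num : (0:ℝ) ≤ 1)).1 k3 with rfl | rfl <;> linarith
      nlinarith
  rw [e1, e2, e3]
  nlinarith

theorem Dat.case2a (h : Dat K m1 m2 m3) (k2 : |m2| = 1) (k3 : |m3| = 1) (hN : NN (sec1 K) K = 1) : Para (pol K) := by
  have hs : 0 < 1 + m1 ^ 2 := by positivity
  have he1 : ((1, 0, 0) : V) ∈ K := h.s3.e1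
  refine para_of 1 0 0 0 ((1 - m1) / (1 + m1 ^ 2)) ((1 + m1) / (1 + m1 ^ 2)) 0 ((1 + m1) / (1 + m1 ^ 2)) ((m1 - 1) / (1 + m1 ^ 2)) ?_ ?_
  · intro x y z e1 e2 e3
    field_simp at e2 e3
    have f2 : (1 - m1) * y + (1 + m1) * z = 0 := by linarith
    have f3 : (1 + m1) * y + (m1 - 1) * z = 0 := by linarith
    have f4 : (1 + m1 ^ 2) * y = 0 := by linear_combination (1 - m1) / 2 * f2 + (1 + m1) / 2 * f3
    have f5 : (1 + m1 ^ 2) * z = 0 := by linear_combination (1 + m1) / 2 * f2 - (1 - m1) / 2 * f3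
    refine ⟨by linarith, (mul_eq_zero.1 f4).resolve_left hs.ne', (mul_eq_zero.1 f5).resolve_left hs.ne'⟩
  · intro a b c
    have E1 : 0 * a + (1 - m1) / (1 + m1 ^ 2) * b + (1 + m1) / (1 + m1 ^ 2) * c = ((1 - m1) * b + (1 + m1) * c) / (1 + m1 ^ 2) := by ring
    have E2 : 0 * a + (1 + m1) / (1 + m1 ^ 2) * b + (m1 - 1) / (1 + m1 ^ 2) * c = ((1 + m1) * b + (m1 - 1) * c) / (1 + m1 ^ 2) := by ring
    rw [E1, E2, abs_div, abs_div, abs_of_pos hs, div_le_one hs, div_le_one hs, ← sqr_pol h.body1 (b, c)]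
    constructor
    · intro hy
      refine ⟨?_, h.pr1 hy⟩
      have := h.abs1 hy he1
      simpa using this
    · rintro ⟨ha, hbc⟩ ⟨x, y, z⟩ hx
      have ha : |a| ≤ 1 := by simpa using ha
      obtain ⟨α, hα⟩ := exists_sg x
      obtain ⟨β, hβ⟩ := exists_sg y
      obtain ⟨γ, hγ⟩ := exists_sg z
      have s1 := sg_sq α
      have s2 := sg_sq β
      have s3 := sg_sq γ
      have h' := h.flip α β γ
      have e1 : sec1 (flip3 α β γ ⁻¹' K) = flip2 β γ ⁻¹' (sec1 K) := by ext; simp [sec1]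
      have hN' : NN (sec1 (flip3 α β γ ⁻¹' K)) (flip3 α β γ ⁻¹' K) = 1 := by
        rw [← hN, e1]; unfold NN; rw [real_pre (mp_flip3 _ _ _), real_pre (mp_flip2 _ _)]
      have := h'.case2a0 (by simpa [abs_mul, abs_sg] using k2) (by simpa [abs_mul, abs_sg] using k3) hN'
        (a := sg α * a) (b := sg β * b) (c := sg γ * c) (x := sg α * x) (y := sg β * y) (z := sg γ * z) ?_
        (by rw [hα]; positivity) (by rw [hβ]; positivity) (by rw [hγ]; positivity)
        (by simpa [abs_mul, abs_sg] using ha) ?_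
      · rw [dot3]
        simp only
        have e : sg α * a * (sg α * x) + sg β * b * (sg β * y) + sg γ * c * (sg γ * z) = x * a + (y * b + z * c) := by
          linear_combination a * x * s1 + b * y * s2 + c * z * s3
        linarith
      · simp only [Set.mem_preimage, flip3_apply]
        convert hx using 1
        ext
        · simp only; linear_combination x * s1
        · simp only; linear_combination y * s2
        · simp only; linear_combination z * s3
      · rw [← flip_sqr, pol_flip2]
        simp only [Set.mem_preimage, flip2_apply]
        convert hbc using 1
        ext
        · simp only; linear_combination b * s2
        · simp only; linear_combination c * s3

theorem Dat.case2 (h : Dat K m1 m2 m3) (k2 : |m2| = 1) (k3 : |m3| = 1) : Para K ∨ Para (pol K) := by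
  by_cases hN : NN (sec1 K) K = 1
  · exact Or.inr (h.case2a k2 k3 hN)
  · exact (h.case2b k2 k3 hN).elim

theorem Eq3.para (h : Eq3 K) : Para K ∨ Para (pol K) := by
  obtain ⟨m1, m2, m3, h⟩ := h.dat
  have cy : ∀ K : Set V, Para (Mahler.cyc ⁻¹' K) ∨ Para (pol (Mahler.cyc ⁻¹' K)) → Para K ∨ Para (pol K) := by
    intro K hK
    rw [pol_cyc] at hK
    exact hK.imp (Para.pre _) (Para.pre _)
  rcases lt_or_eq_of_le h.l1 with k1 | k1 <;> rcases lt_or_eq_of_le h.l2 with k2 | k2 <;>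
    rcases lt_or_eq_of_le h.l3 with k3 | k3
  · exact Or.inl (h.case0 k1 k2 k3)
  · exact Or.inl (h.case1 k1 k2 k3)
  · exact cy _ (Or.inl (h.cyc.case1 k3 k1 k2))
  · exact h.case2 k2 k3
  · exact cy _ (cy _ (Or.inl (h.cyc.cyc.case1 k2 k3 k1)))
  · exact cy _ (cy _ (h.cyc.cyc.case2 k3 k1))
  · exact cy _ (h.cyc.case2 k1 k2)
  · exact h.case2 k2 k3

end

end Mahler

end

section
open MeasureTheory
open scoped RealInnerProductSpace
set_option linter.all false

namespace Mahler

theorem constExp {X : Type} [TopologicalSpace X] {S : Set X} (hS : IsPreconnected S) {h : X → ℂ}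
    (hc : ContinuousOn h S) (he : ∀ x ∈ S, ∀ y ∈ S, Complex.exp (h x) = Complex.exp (h y)) :
    ∀ x ∈ S, ∀ y ∈ S, h x = h y := by
  intro x hx y hy
  exact Complex.isCoveringMap_exp.constOn_of_comp hS hc (fun a ha b hb => Subtype.ext (he a ha b hb)) hx hy

section
variable {F : Type} [NormedAddCommGroup F] [NormedSpace ℝ F]

theorem slit_log {s : ℝ} (hs : s = 1 ∨ s = -1) {g : ℝ × F → ℂ} (hg : ContinuousOn g {0}ᶜ) (h0 : ∀ x, x ≠ 0 → g x ≠ 0) :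
    ∃ L : ℝ × F → ℂ, ContinuousOn L {x | x.2 ≠ 0 ∨ 0 < s * x.1} ∧
      ∀ x, (x.2 ≠ 0 ∨ 0 < s * x.1) → Complex.exp (L x) = g x := by
  have hss : s * s = 1 := by rcases hs with h | h <;> simp [h]
  have hsub : ∀ x : ℝ × F, (x.2 ≠ 0 ∨ 0 < s * x.1) → x ≠ 0 := by
    rintro x hx rfl; simp at hx
  have ho : IsOpen {x : ℝ × F | x.2 ≠ 0 ∨ 0 < s * x.1} := by
    simp only [Set.setOf_or]
    refine IsOpen.union ?_ ?_
    · exact isOpen_ne_fun (by fun_prop) (by fun_prop)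
    · exact isOpen_lt (by fun_prop) (by fun_prop)
  have hst : StarConvex ℝ (s, (0:F)) {x : ℝ × F | x.2 ≠ 0 ∨ 0 < s * x.1} := by
    rintro ⟨t, x⟩ hx a b ha hb hab
    simp only [Set.mem_setOf_eq, Prod.smul_mk, Prod.mk_add_mk, smul_zero, zero_add, smul_eq_mul] at *
    by_cases hx0 : x = 0
    · right
      have := hx.resolve_left (by simpa using hx0)
      have h1 : s * (a * s + b * t) = a + b * (s * t) := by linear_combination a * hss
      rw [h1]
      rcases eq_or_lt_of_le ha with h | h
      · have : b = 1 := by linarith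
        subst this; linarith
      · have := mul_nonneg hb this.le; linarith
    · rcases eq_or_lt_of_le hb with h | h
      · right
        have h1 : s * (a * s + b * t) = 1 := by
          rw [← h] at hab ⊢; linear_combination a * hss + hab
        rw [h1]; norm_num
      · left
        simp [h.ne', hx0]
  have hcon := hst.contractibleSpace ⟨(s, 0), Or.inr (by rw [hss]; norm_num)⟩
  have hsc : IsSimplyConnected {x : ℝ × F | x.2 ≠ 0 ∨ 0 < s * x.1} := by
    show SimplyConnectedSpace _
    infer_instance
  obtain ⟨L, hL, hE⟩ := Complex.exists_continuousOn_eqOn_exp_comp hsc ho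
    (hg.mono fun x hx => hsub x hx) (by rintro ⟨x, hx, h⟩; exact h0 x (hsub x hx) h)
  exact ⟨L, hL, fun x hx => hE hx⟩

theorem full_log (hF : 1 < Module.rank ℝ F) {g : ℝ × F → ℂ} (hg : ContinuousOn g {0}ᶜ) (h0 : ∀ x, x ≠ 0 → g x ≠ 0) :
    ∃ L : ℝ × F → ℂ, ContinuousOn L {0}ᶜ ∧ ∀ x, x ≠ 0 → Complex.exp (L x) = g x := by
  classical
  obtain ⟨L1, h1, e1⟩ := slit_log (s := 1) (by simp) hg h0
  obtain ⟨L2, h2, e2⟩ := slit_log (s := -1) (by simp) hg h0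
  simp only [one_mul, neg_mul] at h1 e1 h2 e2
  have hpre : IsPreconnected {x : ℝ × F | x.2 ≠ 0} := by
    have := isPreconnected_univ (α := ℝ) |>.prod (isConnected_compl_singleton_of_one_lt_rank hF (0:F)).isPreconnected
    convert this using 1
    ext x; simp
  have hd : ∀ x ∈ {x : ℝ × F | x.2 ≠ 0}, ∀ y ∈ {x : ℝ × F | x.2 ≠ 0}, L1 x - L2 x = L1 y - L2 y := by
    apply constExp (h := fun x => L1 x - L2 x) hpre
    · exact (h1.mono fun x hx => Or.inl hx).sub (h2.mono fun x hx => Or.inl hx)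
    · intro x hx y hy
      simp only [Complex.exp_sub]
      rw [e1 x (Or.inl hx), e2 x (Or.inl hx), e1 y (Or.inl hy), e2 y (Or.inl hy)]
      rw [div_self (h0 _ _), div_self (h0 _ _)]
      · rintro rfl; simp at hy
      · rintro rfl; simp at hx
  obtain ⟨z, hz⟩ : ∃ z : F, z ≠ 0 := by
    by_contra hcon
    push Not at hcon
    have : Subsingleton F := ⟨fun a b => by rw [hcon a, hcon b]⟩
    rw [rank_subsingleton'] at hF
    simp at hF
  obtain ⟨c, hc⟩ : ∃ c, c = L1 (0, z) - L2 (0, z) := ⟨_, rfl⟩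
  have hcc : ∀ x : ℝ × F, x.2 ≠ 0 → L1 x = L2 x + c := by
    intro x hx
    have := hd x hx (0, z) hz
    rw [hc, ← this]; ring
  have hexpc : Complex.exp c = 1 := by
    rw [hc, Complex.exp_sub, e1 _ (Or.inl hz), e2 _ (Or.inl hz), div_self]
    apply h0
    intro h; simp [Prod.ext_iff] at h; exact hz h
  have o1 : IsOpen {x : ℝ × F | x.2 ≠ 0 ∨ 0 < x.1} := by
    simp only [Set.setOf_or]
    exact (isOpen_ne_fun (by fun_prop) (by fun_prop)).union (isOpen_lt (by fun_prop) (by fun_prop))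
  have o2 : IsOpen {x : ℝ × F | x.2 ≠ 0 ∨ 0 < -x.1} := by
    simp only [Set.setOf_or]
    exact (isOpen_ne_fun (by fun_prop) (by fun_prop)).union (isOpen_lt (by fun_prop) (by fun_prop))
  have key : ∀ x : ℝ × F, (x.2 ≠ 0 ∨ 0 < -x.1) → (if (x.2 ≠ 0 ∨ 0 < x.1) then L1 x else L2 x + c) = L2 x + c := by
    intro x hx
    split_ifs with h
    · apply hcc
      intro h2
      simp only [h2, ne_eq, not_true_eq_false, false_or] at h hx
      linarith
    · rfl
  have cov : ∀ x : ℝ × F, x ≠ 0 → (x.2 ≠ 0 ∨ 0 < x.1) ∨ (x.2 ≠ 0 ∨ 0 < -x.1) := by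
    intro x hx
    by_cases h2 : x.2 = 0
    · rcases lt_trichotomy x.1 0 with h | h | h
      · right; right; linarith
      · exact (hx (Prod.ext h h2)).elim
      · left; right; exact h
    · left; left; exact h2
  refine ⟨fun x => if (x.2 ≠ 0 ∨ 0 < x.1) then L1 x else L2 x + c, ?_, ?_⟩
  · intro x hx
    apply ContinuousAt.continuousWithinAt
    rcases cov x hx with h | h
    · refine (h1.continuousAt (o1.mem_nhds h)).congr ?_
      filter_upwards [o1.mem_nhds h] with y hy
      exact (if_pos hy).symm
    · refine ((h2.continuousAt (o2.mem_nhds h)).add (continuousAt_const (y := c))).congr ?_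
      filter_upwards [o2.mem_nhds h] with y hy
      exact (key y hy).symm
  · intro x hx
    rcases cov x hx with h | h
    · simp only [if_pos h]; exact e1 x h
    · simp only [key x h]; rw [Complex.exp_add, e2 x h, hexpc, mul_one]

end

end Mahler

end

section
open MeasureTheory
open scoped RealInnerProductSpace ComplexConjugate
set_option linter.all false

namespace Mahler

noncomputable def rr (f : ℂ × ℝ) : ℝ := Real.sqrt (Complex.normSq f.1 + f.2 ^ 2)

theorem rr_sq (f : ℂ × ℝ) : (rr f : ℂ) * rr f = f.1 * conj f.1 + (f.2 : ℂ) * f.2 := by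
  have : rr f * rr f = Complex.normSq f.1 + f.2 ^ 2 :=
    Real.mul_self_sqrt (add_nonneg (Complex.normSq_nonneg _) (sq_nonneg _))
  rw [Complex.mul_conj]
  rw [← Complex.ofReal_mul, this]
  push_cast; ring

theorem rr_sq' (f : ℂ × ℝ) : rr f * rr f = Complex.normSq f.1 + f.2 ^ 2 :=
    Real.mul_self_sqrt (add_nonneg (Complex.normSq_nonneg _) (sq_nonneg _))

theorem rr_nonneg (f : ℂ × ℝ) : 0 ≤ rr f := Real.sqrt_nonneg _

theorem rr_pos {f : ℂ × ℝ} (hf : f ≠ 0) : 0 < rr f := by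
  apply Real.sqrt_pos.2
  by_cases h : f.1 = 0
  · have : f.2 ≠ 0 := fun h2 => hf (Prod.ext h h2)
    have := Complex.normSq_nonneg f.1
    positivity
  · have := Complex.normSq_pos.2 h
    positivity

theorem rr_cont : Continuous rr := by
  unfold rr
  have := Complex.continuous_normSq
  fun_prop

structure Spin (f : ℂ × ℝ) (p : ℂ × ℂ) : Prop where
  e1 : (f.2 : ℂ) * p.1 + conj f.1 * p.2 = rr f * p.1
  e2 : f.1 * p.1 - (f.2 : ℂ) * p.2 = rr f * p.2
  ne : p ≠ 0

theorem Spin.exists (f : ℂ × ℝ) : ∃ p, Spin f p := by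
  have hr := rr_sq f
  by_cases h : (rr f : ℂ) + f.2 = 0
  · refine ⟨(0, 1), ?_, ?_, by simp⟩
    · have : f.1 * conj f.1 = 0 := by linear_combination -hr + (rr f - f.2) * h
      have : f.1 = 0 := by simpa using this
      simp [this]
    · simp; linear_combination -h
  · refine ⟨(rr f + f.2, f.1), ?_, ?_, ?_⟩
    · simp only; linear_combination -hr
    · simp only; ring
    · intro hh; exact h (congrArg Prod.fst hh)

noncomputable def RR (f : ℂ × ℝ) (p : ℂ × ℂ) : ℂ × ℂ :=
  ((rr f + f.2) * p.1 + conj f.1 * p.2, f.1 * p.1 + (rr f - f.2) * p.2)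

theorem Spin.step {f g : ℂ × ℝ} {p : ℂ × ℂ} (h : Spin f p)
    (hd : 0 < (g.1 * conj f.1).re + g.2 * f.2) : Spin g (RR g p) := by
  have hr := rr_sq g
  refine ⟨?_, ?_, ?_⟩
  · simp only [RR]; linear_combination (- p.1) * hr
  · simp only [RR]; linear_combination (- p.2) * hr
  · intro h0
    have h1 : (rr g + g.2) * p.1 + conj g.1 * p.2 = 0 := congrArg Prod.fst h0
    have h2 : g.1 * p.1 + (rr g - g.2) * p.2 = 0 := congrArg Prod.snd h0
    have e1 := h.e1
    have e2 := h.e2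
    have hre : ((g.1 * conj f.1).re : ℂ) * 2 = g.1 * conj f.1 + f.1 * conj g.1 := by
      have := Complex.add_conj (g.1 * conj f.1)
      simp only [map_mul, Complex.conj_conj] at this
      push_cast at this
      linear_combination -this
    have hs : 0 < (g.1 * conj f.1).re + g.2 * f.2 + rr g * rr f := by
      have := mul_nonneg (rr_nonneg g) (rr_nonneg f); linarith
    have hs' : (((g.1 * conj f.1).re + g.2 * f.2 + rr g * rr f : ℝ) : ℂ) ≠ 0 := by
      exact_mod_cast hs.ne'
    have k1 : (((g.1 * conj f.1).re + g.2 * f.2 + rr g * rr f : ℝ) : ℂ) * p.1 = 0 := by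
      push_cast
      linear_combination (p.1 / 2) * hre + (1/2) * ((f.2 : ℂ) * h1 + conj f.1 * h2 + (g.2 : ℂ) * e1 + conj g.1 * e2)
        + (1/2) * rr f * h1 - (1/2) * rr g * e1
    have k2 : (((g.1 * conj f.1).re + g.2 * f.2 + rr g * rr f : ℝ) : ℂ) * p.2 = 0 := by
      push_cast
      linear_combination (p.2 / 2) * hre + (1/2) * (f.1 * h1 - (f.2:ℂ) * h2 + g.1 * e1 - (g.2:ℂ) * e2)
        + (1/2) * rr f * h2 - (1/2) * rr g * e2
    exact h.ne (Prod.ext ((mul_eq_zero.1 k1).resolve_left hs') ((mul_eq_zero.1 k2).resolve_left hs'))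

theorem Spin.par {f : ℂ × ℝ} (hf : f ≠ 0) {p q : ℂ × ℂ} (hp : Spin f p) (hq : Spin f q) : p.1 * q.2 = q.1 * p.2 := by
  have hr := rr_sq f
  have h0 : (rr f : ℂ) ≠ 0 := by exact_mod_cast (rr_pos hf).ne'
  have h2 : (2 * (rr f : ℂ)) * (p.1 * q.2 - q.1 * p.2) = 0 := by
    linear_combination (- q.2) * hp.e1 + q.1 * hp.e2 + p.2 * hq.e1 - p.1 * hq.e2
  have := (mul_eq_zero.1 h2).resolve_left (mul_ne_zero two_ne_zero h0)
  linear_combination this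

noncomputable def lam (p q : ℂ × ℂ) : ℂ := (q.1 * conj p.1 + q.2 * conj p.2) / (p.1 * conj p.1 + p.2 * conj p.2)

theorem den_ne {p : ℂ × ℂ} (hp : p ≠ 0) : p.1 * conj p.1 + p.2 * conj p.2 ≠ 0 := by
  rw [Complex.mul_conj, Complex.mul_conj, ← Complex.ofReal_add]
  have h1 := Complex.normSq_nonneg p.1
  have h2 := Complex.normSq_nonneg p.2
  intro h
  have h : Complex.normSq p.1 + Complex.normSq p.2 = 0 := by exact_mod_cast h
  apply hp
  exact Prod.ext (Complex.normSq_eq_zero.1 (by linarith)) (Complex.normSq_eq_zero.1 (by linarith))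

theorem Spin.lam {f : ℂ × ℝ} (hf : f ≠ 0) {p q : ℂ × ℂ} (hp : Spin f p) (hq : Spin f q) :
    q = Mahler.lam p q • p := by
  have h := hp.par hf hq
  have hd := den_ne hp.ne
  ext
  · simp only [Mahler.lam, Prod.smul_fst, smul_eq_mul]
    rw [div_mul_eq_mul_div, eq_div_iff hd]
    linear_combination (- conj p.2) * h
  · simp only [Mahler.lam, Prod.smul_snd, smul_eq_mul]
    rw [div_mul_eq_mul_div, eq_div_iff hd]
    linear_combination (conj p.1) * h

theorem Spin.lam_ne {f : ℂ × ℝ} (hf : f ≠ 0) {p q : ℂ × ℂ} (hp : Spin f p) (hq : Spin f q) :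
    Mahler.lam p q ≠ 0 := by
  intro h
  have := hp.lam hf hq
  rw [h, zero_smul] at this
  exact hq.ne this

theorem Spin.smul {f : ℂ × ℝ} {p : ℂ × ℂ} (hp : Spin f p) {c : ℂ} (hc : c ≠ 0) : Spin f (c • p) := by
  refine ⟨?_, ?_, ?_⟩
  · simp only [Prod.smul_fst, Prod.smul_snd, smul_eq_mul]; linear_combination c * hp.e1
  · simp only [Prod.smul_fst, Prod.smul_snd, smul_eq_mul]; linear_combination c * hp.e2
  · exact smul_ne_zero hc hp.ne

def Tk (p : ℂ × ℂ) : ℂ × ℂ := (Complex.I * conj p.2, conj p.1)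
def Ti (p : ℂ × ℂ) : ℂ × ℂ := (Complex.I * conj p.1, conj p.2)
def fk (f : ℂ × ℝ) : ℂ × ℝ := (-Complex.I * f.1, -f.2)
def fi (f : ℂ × ℝ) : ℂ × ℝ := (-Complex.I * conj f.1, f.2)

theorem rr_fk (f : ℂ × ℝ) : rr (fk f) = rr f := by simp [rr, fk]
theorem rr_fi (f : ℂ × ℝ) : rr (fi f) = rr f := by simp [rr, fi]

theorem Spin.conj {f : ℂ × ℝ} {p : ℂ × ℂ} (hp : Spin f p) :
    (f.2 : ℂ) * starRingEnd ℂ p.1 + f.1 * starRingEnd ℂ p.2 = rr f * starRingEnd ℂ p.1 ∧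
    starRingEnd ℂ f.1 * starRingEnd ℂ p.1 - (f.2 : ℂ) * starRingEnd ℂ p.2 = rr f * starRingEnd ℂ p.2 := by
  have h1 := congrArg (starRingEnd ℂ) hp.e1
  have h2 := congrArg (starRingEnd ℂ) hp.e2
  simp only [map_mul, map_add, map_sub, Complex.conj_conj, Complex.conj_ofReal] at h1 h2
  exact ⟨h1, h2⟩

theorem Spin.k {f : ℂ × ℝ} {p : ℂ × ℂ} (hp : Spin f p) : Spin (fk f) (Tk p) := by
  obtain ⟨h1, h2⟩ := hp.conj
  refine ⟨?_, ?_, ?_⟩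
  · rw [rr_fk]; simp only [fk, Tk, map_mul, map_neg, Complex.conj_I, Complex.ofReal_neg]
    linear_combination Complex.I * h2
  · rw [rr_fk]; simp only [fk, Tk, map_mul, map_neg, Complex.conj_I, Complex.ofReal_neg]
    linear_combination h1 - (f.1 * starRingEnd ℂ p.2) * Complex.I_mul_I
  · intro h
    apply hp.ne
    simpa [Tk, Prod.ext_iff, and_comm] using h

theorem Spin.i {f : ℂ × ℝ} {p : ℂ × ℂ} (hp : Spin f p) : Spin (fi f) (Ti p) := by
  obtain ⟨h1, h2⟩ := hp.conj
  refine ⟨?_, ?_, ?_⟩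
  · rw [rr_fi]; simp only [fi, Ti, map_mul, map_neg, Complex.conj_I, Complex.conj_conj]
    linear_combination Complex.I * h1
  · rw [rr_fi]; simp only [fi, Ti, map_mul, map_neg, Complex.conj_I, Complex.conj_conj]
    linear_combination h2 - (starRingEnd ℂ f.1 * starRingEnd ℂ p.1) * Complex.I_mul_I
  · intro h
    apply hp.ne
    simpa [Ti, Prod.ext_iff] using h

theorem Tk_smul (c : ℂ) (p : ℂ × ℂ) : Tk (c • p) = conj c • Tk p := by
  ext <;> simp [Tk] <;> ring
theorem Ti_smul (c : ℂ) (p : ℂ × ℂ) : Ti (c • p) = conj c • Ti p := by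
  ext <;> simp [Ti] <;> ring
theorem Tk4 (p : ℂ × ℂ) : Tk (Tk (Tk (Tk p))) = - p := by
  ext
  · simp [Tk]; linear_combination (p.1) * Complex.I_mul_I
  · simp [Tk]; linear_combination (p.2) * Complex.I_mul_I
theorem Ti2 (p : ℂ × ℂ) : Ti (Ti p) = p := by
  ext
  · simp [Ti]; linear_combination (- p.1) * Complex.I_mul_I
  · simp [Ti]

/-- lift over a ball -/
theorem spin_ball {G : Type} [NormedAddCommGroup G] [NormedSpace ℝ G] [FiniteDimensional ℝ G] {F : G → ℂ × ℝ}
    (hF : Continuous F) (h0 : ∀ x, F x ≠ 0) :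
    ∃ p : G → ℂ × ℂ, Continuous p ∧ ∀ x, ‖x‖ ≤ 1 → Spin (F x) (p x) := by
  obtain ⟨N, hN, hstep⟩ : ∃ N : ℕ, 0 < N ∧ ∀ u v : G, ‖u‖ ≤ 1 → ‖v‖ ≤ 1 → ‖u - v‖ ≤ 1 / N →
      0 < ((F u).1 * conj (F v).1).re + (F u).2 * (F v).2 := by
    have hcpt := isCompact_closedBall (0:G) 1
    obtain ⟨x0, -, hx0⟩ := hcpt.exists_isMinOn ⟨0, by simp⟩ (rr_cont.comp hF).continuousOn
    obtain ⟨m, hm⟩ : ∃ m, m = rr (F x0) := ⟨_, rfl⟩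
    have hmpos : 0 < m := hm ▸ rr_pos (h0 x0)
    have hmin : ∀ x, ‖x‖ ≤ 1 → m ≤ rr (F x) := fun x hx => hm ▸ hx0 (by simpa using hx)
    have huc := hcpt.uniformContinuousOn_of_continuous hF.continuousOn
    obtain ⟨δ, hδ, hu⟩ := Metric.uniformContinuousOn_iff.1 huc (m / 2) (by positivity)
    obtain ⟨N, hN⟩ := exists_nat_gt (1 / δ)
    have hNpos : (0:ℝ) < N := lt_trans (by positivity) hN
    refine ⟨N, by exact_mod_cast hNpos, fun u v hu1 hv1 huv => ?_⟩
    have hlt : dist (F u) (F v) < m / 2 := by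
      apply hu _ (by simpa using hu1) _ (by simpa using hv1)
      rw [dist_eq_norm]
      refine lt_of_le_of_lt huv ?_
      rw [div_lt_iff₀ hNpos]
      rw [div_lt_iff₀ hδ] at hN; linarith
    rw [dist_eq_norm] at hlt
    have n1 : ‖(F u).1 - (F v).1‖ < m / 2 := lt_of_le_of_lt (norm_fst_le (F u - F v)) hlt
    have n2 : |(F u).2 - (F v).2| < m / 2 := lt_of_le_of_lt (norm_snd_le (F u - F v)) hlt
    have a1 := rr_sq' (F u)
    have a2 := rr_sq' (F v)
    have b1 := hmin u hu1
    have b2 := hmin v hv1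
    have c1 : Complex.normSq ((F u).1 - (F v).1) ≤ (m/2) ^ 2 := by
      rw [Complex.normSq_eq_norm_sq]; exact pow_le_pow_left₀ (norm_nonneg _) n1.le 2
    have c2 : ((F u).2 - (F v).2) ^ 2 ≤ (m/2) ^ 2 := sq_le_sq' (by linarith [abs_lt.1 n2]) (by linarith [abs_lt.1 n2])
    rw [Complex.normSq_sub] at c1
    nlinarith
  obtain ⟨p0, hp0⟩ := Spin.exists (F 0)
  have : ∀ k : ℕ, k ≤ N → ∃ p : G → ℂ × ℂ, Continuous p ∧ ∀ x, ‖x‖ ≤ 1 → Spin (F (((k:ℝ) / N) • x)) (p x) := by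
    have hNp : (0:ℝ) < N := by exact_mod_cast hN
    intro k
    induction k with
    | zero => intro _; exact ⟨fun _ => p0, continuous_const, fun x _ => by simpa using hp0⟩
    | succ k ih =>
      intro hk
      obtain ⟨p, hp, hs⟩ := ih (by omega)
      refine ⟨fun x => RR (F ((((k+1:ℕ):ℝ) / N) • x)) (p x), ?_, fun x hx => (hs x hx).step (hstep _ _ ?_ ?_ ?_)⟩
      · unfold RR
        have := rr_cont
        have h2 : Continuous (fun x => F ((((k+1:ℕ):ℝ) / N) • x)) := by fun_prop
        have h3 := rr_cont.comp h2
        have h4 : Continuous (fun x => (rr (F ((((k+1:ℕ):ℝ) / N) • x)) : ℂ)) := Complex.continuous_ofReal.comp h3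
        have h5 : Continuous (fun x => ((F ((((k+1:ℕ):ℝ) / N) • x)).2 : ℂ)) := Complex.continuous_ofReal.comp (continuous_snd.comp h2)
        have h6 : Continuous (fun x => ((F ((((k+1:ℕ):ℝ) / N) • x)).1 : ℂ)) := (continuous_fst.comp h2)
        have h7 : Continuous (fun x => conj ((F ((((k+1:ℕ):ℝ) / N) • x)).1 : ℂ)) := Complex.continuous_conj.comp h6
        have h8 := continuous_fst.comp hp
        have h9 := continuous_snd.comp hp
        exact (((h4.add h5).mul h8).add (h7.mul h9)).prodMk ((h6.mul h8).add ((h4.sub h5).mul h9))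
      · rw [norm_smul, Real.norm_of_nonneg (by positivity)]
        have : (((k+1:ℕ):ℝ) / N) ≤ 1 := by rw [div_le_one hNp]; exact_mod_cast hk
        nlinarith [norm_nonneg x, (by positivity : 0 ≤ (((k+1:ℕ):ℝ) / N))]
      · rw [norm_smul, Real.norm_of_nonneg (by positivity)]
        have : (((k:ℕ):ℝ) / N) ≤ 1 := by rw [div_le_one hNp]; exact_mod_cast (by omega)
        nlinarith [norm_nonneg x, (by positivity : 0 ≤ (((k:ℕ):ℝ) / N))]
      · rw [← sub_smul, norm_smul]
        have : (((k+1:ℕ):ℝ) / N) - (k:ℝ) / N = 1 / N := by push_cast; ring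
        rw [this, Real.norm_of_nonneg (by positivity)]
        nlinarith [norm_nonneg x, (by positivity : 0 ≤ (1:ℝ) / N)]
  obtain ⟨p, hp, hs⟩ := this N le_rfl
  refine ⟨p, hp, fun x hx => ?_⟩
  have := hs x hx
  rwa [div_self (by exact_mod_cast hN.ne'), one_smul] at this

end Mahler

end

section
open MeasureTheory
open scoped RealInnerProductSpace ComplexConjugate
set_option linter.all false

namespace Mahler

abbrev Q4 := ℝ × V

theorem rank2 : 1 < Module.rank ℝ V2 := by
  rw [← Module.finrank_eq_rank]; simp
theorem rank3 : 1 < Module.rank ℝ V := by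
  rw [← Module.finrank_eq_rank]; simp
theorem rank4 : 1 < Module.rank ℝ Q4 := by
  rw [← Module.finrank_eq_rank]; simp

theorem lam_cont {X : Type} [TopologicalSpace X] {S : Set X} {p q : X → ℂ × ℂ} (hp : ContinuousOn p S) (hq : ContinuousOn q S)
    (h0 : ∀ x ∈ S, p x ≠ 0) : ContinuousOn (fun x => lam (p x) (q x)) S := by
  have a1 := continuous_fst.comp_continuousOn hp
  have a2 := continuous_snd.comp_continuousOn hp
  have b1 := continuous_fst.comp_continuousOn hq
  have b2 := continuous_snd.comp_continuousOn hq
  have c1 := Complex.continuous_conj.comp_continuousOn a1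
  have c2 := Complex.continuous_conj.comp_continuousOn a2
  exact ((b1.mul c1).add (b2.mul c2)).div ((a1.mul c1).add (a2.mul c2)) (fun x hx => den_ne (h0 x hx))

theorem spin_global {f : Q4 → ℂ × ℝ} (hf : ContinuousOn f {0}ᶜ) (h0 : ∀ q, q ≠ 0 → f q ≠ 0)
    (hs : ∀ c : ℝ, 0 < c → ∀ q, q ≠ 0 → f (c • q) = f q) :
    ∃ p : Q4 → ℂ × ℂ, ContinuousOn p {0}ᶜ ∧ (∀ q, q ≠ 0 → Spin (f q) (p q)) ∧
      ∀ c : ℝ, 0 < c → ∀ q, p (c • q) = p q := by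
  have hne : ∀ (s : ℝ) (x : V), (s * (1 - ‖x‖), x) ≠ (0 : Q4) ∨ s = 0 := by
    intro s x
    by_cases h : s = 0
    · right; exact h
    · left
      intro h2
      have e2 : x = 0 := congrArg Prod.snd h2
      have e1 : s * (1 - ‖x‖) = 0 := congrArg Prod.fst h2
      rw [e2] at e1; simp at e1; exact h e1
  have hn1 : ∀ x : V, ((1 - ‖x‖, x) : Q4) ≠ 0 := fun x => by simpa using hne 1 x
  have hn2 : ∀ x : V, ((‖x‖ - 1, x) : Q4) ≠ 0 := fun x => by simpa using hne (-1) x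
  obtain ⟨p1, hp1, s1⟩ := spin_ball (F := fun x : V => f (1 - ‖x‖, x)) (hf.comp_continuous (by fun_prop) (fun x => hn1 x)) (fun x => h0 _ (hn1 x))
  obtain ⟨p2, hp2, s2⟩ := spin_ball (F := fun x : V => f (‖x‖ - 1, x)) (hf.comp_continuous (by fun_prop) (fun x => hn2 x)) (fun x => h0 _ (hn2 x))
  have t1 : ∀ x : V, ‖x‖ = 1 → Spin (f (0, x)) (p1 x) := fun x hx => by simpa [hx] using s1 x hx.le
  have t2 : ∀ x : V, ‖x‖ = 1 → Spin (f (0, x)) (p2 x) := fun x hx => by simpa [hx] using s2 x hx.le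
  have hx0 : ∀ x : V, ‖x‖ = 1 → ((0, x) : Q4) ≠ 0 := by
    intro x hx h
    have : x = 0 := congrArg Prod.snd h
    simp [this] at hx
  have hnorm : ∀ x : V, x ≠ 0 → ‖‖x‖⁻¹ • x‖ = 1 := fun x hx => norm_smul_inv_norm hx
  have hnc : ContinuousOn (fun x : V => ‖x‖⁻¹ • x) {0}ᶜ :=
    (continuousOn_id.norm.inv₀ (fun x hx => norm_ne_zero_iff.2 hx)).smul continuousOn_id
  obtain ⟨L, hL, eL⟩ := full_log (F := V2) rank2 (g := fun x : V => lam (p1 (‖x‖⁻¹ • x)) (p2 (‖x‖⁻¹ • x)))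
    (lam_cont (hp1.comp_continuousOn hnc) (hp2.comp_continuousOn hnc) (fun x hx => (t1 _ (hnorm x hx)).ne))
    (fun x hx => (t1 _ (hnorm x hx)).lam_ne (h0 _ (hx0 _ (hnorm x hx))) (t2 _ (hnorm x hx)))
  have hsub : Metric.sphere (0:V) 1 ⊆ {0}ᶜ := by
    intro x hx h
    simp only [Set.mem_singleton_iff] at h
    simp [h] at hx
  obtain ⟨M, hM⟩ := ContinuousMap.exists_restrict_eq (Metric.isClosed_sphere (x := (0:V)) (ε := 1))
    (⟨fun x => L x, continuousOn_iff_continuous_domRestrict.1 (hL.mono hsub)⟩ : C(Metric.sphere (0:V) 1, ℂ))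
  have hM' : ∀ x : V, ‖x‖ = 1 → M x = L x := by
    intro x hx
    have := DFunLike.congr_fun hM ⟨x, by simpa using hx⟩
    exact this
  have glue : ∀ x : V, ‖x‖ = 1 → Complex.exp (M x) • p1 x = p2 x := by
    intro x hx
    have hxx : x ≠ 0 := by rintro rfl; simp at hx
    rw [hM' x hx, eL x hxx, hx]
    simp only [inv_one, one_smul]
    exact ((t1 x hx).lam (h0 _ (hx0 x hx)) (t2 x hx)).symm
  have hspos : ∀ q : Q4, q ≠ 0 → 0 < |q.1| + ‖q.2‖ := by
    intro q hq
    have h1 := abs_nonneg q.1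
    have h2 := norm_nonneg q.2
    by_contra hcon
    push Not at hcon
    exact hq (Prod.ext (abs_eq_zero.1 (by linarith)) (norm_eq_zero.1 (by linarith)))
  refine ⟨fun q => if 0 ≤ q.1 then Complex.exp (M ((|q.1| + ‖q.2‖)⁻¹ • q.2)) • p1 ((|q.1| + ‖q.2‖)⁻¹ • q.2)
    else p2 ((|q.1| + ‖q.2‖)⁻¹ • q.2), ?_, ?_, ?_⟩
  · have hy : ContinuousOn (fun q : Q4 => (|q.1| + ‖q.2‖)⁻¹ • q.2) {0}ᶜ := by
      have h1 : ContinuousOn (fun q : Q4 => |q.1| + ‖q.2‖) {0}ᶜ :=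
        (by fun_prop : Continuous (fun q : Q4 => |q.1| + ‖q.2‖)).continuousOn
      exact (h1.inv₀ (fun q hq => (hspos q hq).ne')).smul continuous_snd.continuousOn
    have hy' := continuousOn_iff_continuous_domRestrict.1 hy
    rw [continuousOn_iff_continuous_domRestrict]
    refine Continuous.if_le (f := fun _ => 0) (g := fun q : ({0}ᶜ : Set Q4) => q.1.1) ?_ ?_ continuous_const (by fun_prop) ?_
    · exact ((Complex.continuous_exp.comp (M.continuous.comp hy')).smul (hp1.comp hy'))
    · exact hp2.comp hy'
    · rintro ⟨q, hq⟩ hq0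
      simp only at hq0 ⊢
      apply glue
      have := hspos q hq
      rw [norm_smul, norm_inv, Real.norm_of_nonneg this.le, ← hq0, abs_zero, zero_add]
      rw [← hq0, abs_zero, zero_add] at this
      exact inv_mul_cancel₀ this.ne'
  · intro q hq
    have hp := hspos q hq
    have hN : ‖(|q.1| + ‖q.2‖)⁻¹ • q.2‖ = (|q.1| + ‖q.2‖)⁻¹ * ‖q.2‖ := by
      rw [norm_smul, norm_inv, Real.norm_of_nonneg hp.le]
    have hle : ‖(|q.1| + ‖q.2‖)⁻¹ • q.2‖ ≤ 1 := by
      rw [hN, inv_mul_le_iff₀ hp]; linarith [abs_nonneg q.1]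
    have h1N : 1 - ‖(|q.1| + ‖q.2‖)⁻¹ • q.2‖ = (|q.1| + ‖q.2‖)⁻¹ * |q.1| := by
      rw [hN]; field_simp; ring
    have hfq := hs (|q.1| + ‖q.2‖)⁻¹ (by positivity) q hq
    beta_reduce
    split_ifs with h
    · apply Spin.smul _ (Complex.exp_ne_zero _)
      have := s1 _ hle
      rw [h1N] at this
      rw [← hfq]
      have h5 : (|q.1| + ‖q.2‖)⁻¹ • q = ((|q.1| + ‖q.2‖)⁻¹ * |q.1|, (|q.1| + ‖q.2‖)⁻¹ • q.2) := by
        apply Prod.ext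
        · simp [abs_of_nonneg h]
        · simp
      rw [h5]; exact this
    · have := s2 _ hle
      push Not at h
      have h2 : ‖(|q.1| + ‖q.2‖)⁻¹ • q.2‖ - 1 = (|q.1| + ‖q.2‖)⁻¹ * q.1 := by
        rw [← neg_sub, h1N, abs_of_neg h]; ring
      simp only [h2] at this
      rw [← hfq]; exact this
  · intro c hc q
    have e1 : (c • q).1 = c * q.1 := rfl
    have e2 : (c • q).2 = c • q.2 := rfl
    have e3 : (|c * q.1| + ‖c • q.2‖)⁻¹ • c • q.2 = (|q.1| + ‖q.2‖)⁻¹ • q.2 := by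
      rw [abs_mul, norm_smul, Real.norm_eq_abs, abs_of_pos hc, ← mul_add, smul_smul, mul_inv, mul_comm c⁻¹, mul_assoc, inv_mul_cancel₀ hc.ne', mul_one]
    simp only [e1, e2, e3, mul_nonneg_iff_of_pos_left hc]

theorem log_global {g : Q4 → ℂ} (hg : ContinuousOn g {0}ᶜ) (h0 : ∀ q, q ≠ 0 → g q ≠ 0)
    (hs : ∀ c : ℝ, 0 < c → ∀ q, q ≠ 0 → g (c • q) = g q) :
    ∃ L : Q4 → ℂ, ContinuousOn L {0}ᶜ ∧ (∀ q, q ≠ 0 → Complex.exp (L q) = g q) ∧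
      ∀ c : ℝ, 0 < c → ∀ q, L (c • q) = L q := by
  obtain ⟨L, hL, e⟩ := full_log (F := V) rank3 hg h0
  have hnc : ContinuousOn (fun x : Q4 => ‖x‖⁻¹ • x) {0}ᶜ :=
    (continuousOn_id.norm.inv₀ (fun x hx => norm_ne_zero_iff.2 hx)).smul continuousOn_id
  refine ⟨fun q => L (‖q‖⁻¹ • q), hL.comp hnc ?_, ?_, ?_⟩
  · intro q hq; exact smul_ne_zero (inv_ne_zero (norm_ne_zero_iff.2 hq)) hq
  · intro q hq
    rw [e, hs _ (inv_pos.2 (norm_pos_iff.2 hq)) q hq]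
    exact smul_ne_zero (inv_ne_zero (norm_ne_zero_iff.2 hq)) hq
  · intro c hc q
    simp only
    rw [norm_smul, Real.norm_eq_abs, abs_of_pos hc, smul_smul, mul_inv, mul_comm c⁻¹, mul_assoc, inv_mul_cancel₀ hc.ne', mul_one]

def kap (q : Q4) : Q4 := (q.1 - q.2.2.2, q.2.1 + q.2.2.1, q.2.2.1 - q.2.1, q.1 + q.2.2.2)
def iot (q : Q4) : Q4 := (-q.2.1 - q.2.2.1, q.1 - q.2.2.2, q.1 + q.2.2.2, q.2.1 - q.2.2.1)

theorem kap4 (q : Q4) : kap (kap (kap (kap q))) = (4:ℝ) • (-q) := by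
  ext <;> simp [kap] <;> ring
theorem iot2 (q : Q4) : iot (iot q) = (2:ℝ) • (-q) := by
  ext <;> simp [iot] <;> ring
theorem kap_ne {q : Q4} (hq : q ≠ 0) : kap q ≠ 0 := by
  intro h
  apply hq
  have := kap4 q
  rw [h] at this
  have h2 : kap (kap (kap 0)) = 0 := by ext <;> simp [kap]
  rw [h2] at this
  simpa using this.symm
theorem iot_ne {q : Q4} (hq : q ≠ 0) : iot q ≠ 0 := by
  intro h
  apply hq
  have := iot2 q
  rw [h] at this
  have h2 : iot 0 = 0 := by ext <;> simp [iot]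
  rw [h2] at this
  simpa using this.symm
theorem kap_cont : Continuous kap := by unfold kap; fun_prop
theorem iot_cont : Continuous iot := by unfold iot; fun_prop
theorem kap_smul (c : ℝ) (q : Q4) : kap (c • q) = c • kap q := by ext <;> simp [kap] <;> ring
theorem iot_smul (c : ℝ) (q : Q4) : iot (c • q) = c • iot q := by ext <;> simp [iot] <;> ring

theorem topo {f : Q4 → ℂ × ℝ} (hf : ContinuousOn f {0}ᶜ)
    (hs : ∀ c : ℝ, 0 < c → ∀ q, q ≠ 0 → f (c • q) = f q)
    (hk : ∀ q, q ≠ 0 → f (kap q) = fk (f q)) (hi : ∀ q, q ≠ 0 → f (iot q) = fi (f q)) :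
    ∃ q, q ≠ 0 ∧ f q = 0 := by
  by_contra hcon
  push Not at hcon
  obtain ⟨p, hp, sp, sc⟩ := spin_global hf hcon hs
  have mk : Set.MapsTo kap {0}ᶜ {0}ᶜ := fun q hq => kap_ne hq
  have mi : Set.MapsTo iot {0}ᶜ {0}ᶜ := fun q hq => iot_ne hq
  have mn : Set.MapsTo (fun q : Q4 => -q) {0}ᶜ {0}ᶜ := fun q hq => neg_ne_zero.2 hq
  have cTk : Continuous Tk := by
    unfold Tk; have := Complex.continuous_conj; fun_prop
  have cTi : Continuous Ti := by
    unfold Ti; have := Complex.continuous_conj; fun_prop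
  obtain ⟨A, cA, eA, sA⟩ := log_global (g := fun q => lam (Tk (p q)) (p (kap q)))
    (lam_cont (cTk.comp_continuousOn hp) (hp.comp kap_cont.continuousOn mk) (fun q hq => (sp q hq).k.ne))
    (fun q hq => (sp q hq).k.lam_ne (hk q hq ▸ hcon _ (kap_ne hq)) (hk q hq ▸ sp _ (kap_ne hq)))
    (fun c hc q hq => by simp only [kap_smul, sc c hc])
  obtain ⟨B, cB, eB, sB⟩ := log_global (g := fun q => lam (Ti (p q)) (p (iot q)))
    (lam_cont (cTi.comp_continuousOn hp) (hp.comp iot_cont.continuousOn mi) (fun q hq => (sp q hq).i.ne))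
    (fun q hq => (sp q hq).i.lam_ne (hi q hq ▸ hcon _ (iot_ne hq)) (hi q hq ▸ sp _ (iot_ne hq)))
    (fun c hc q hq => by simp only [iot_smul, sc c hc])
  have pk : ∀ q, q ≠ 0 → p (kap q) = Complex.exp (A q) • Tk (p q) := fun q hq => by
    rw [eA q hq]; exact (sp q hq).k.lam (hk q hq ▸ hcon _ (kap_ne hq)) (hk q hq ▸ sp _ (kap_ne hq))
  have pi : ∀ q, q ≠ 0 → p (iot q) = Complex.exp (B q) • Ti (p q) := fun q hq => by
    rw [eB q hq]; exact (sp q hq).i.lam (hi q hq ▸ hcon _ (iot_ne hq)) (hi q hq ▸ sp _ (iot_ne hq))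
  -- transition exponents
  let b : Q4 → ℂ := fun q => A (kap (kap (kap q))) + conj (A (kap (kap q))) + A (kap q) + conj (A q)
  let c : Q4 → ℂ := fun q => B (iot q) + conj (B q)
  have pb : ∀ q, q ≠ 0 → p (-q) = -(Complex.exp (b q) • p q) := by
    intro q hq
    have h1 := kap_ne hq
    have h2 := kap_ne h1
    have h3 := kap_ne h2
    rw [← sc 4 (by norm_num) (-q), ← kap4, pk _ h3, pk _ h2, pk _ h1, pk _ hq]
    simp only [Tk_smul, Tk4, b, Complex.exp_add, Complex.exp_conj, Complex.conj_conj, smul_neg, smul_smul]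
    congr 2
    simp only [map_mul, Complex.conj_conj]
    try ring
  have pc : ∀ q, q ≠ 0 → p (-q) = Complex.exp (c q) • p q := by
    intro q hq
    rw [← sc 2 (by norm_num) (-q), ← iot2, pi _ (iot_ne hq), pi _ hq]
    simp only [Ti_smul, Ti2, c, Complex.exp_add, Complex.exp_conj, smul_smul]
  have cconj := Complex.continuous_conj
  have cb : ContinuousOn b {0}ᶜ := by
    have k1 := kap_cont.continuousOn (s := {0}ᶜ)
    have k2 := k1.comp k1 mk
    have k3 := k1.comp k2 (mk.comp mk)
    exact (((cA.comp k3 (mk.comp (mk.comp mk))).add (cconj.comp_continuousOn (cA.comp k2 (mk.comp mk)))).add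
      (cA.comp k1 mk)).add (cconj.comp_continuousOn cA)
  have cc : ContinuousOn c {0}ᶜ :=
    (cB.comp iot_cont.continuousOn mi).add (cconj.comp_continuousOn cB)
  have hpre : IsPreconnected ({0}ᶜ : Set Q4) := (isConnected_compl_singleton_of_one_lt_rank rank4 (0:Q4)).isPreconnected
  have hexp : ∀ q, q ≠ 0 → ∀ s t : ℂ, s • p q = t • p q → s = t := fun q hq s t h => by
    exact smul_left_injective ℂ (sp q hq).ne h
  have neg0 : ∀ q : Q4, q ≠ 0 → -q ≠ 0 := fun q hq => neg_ne_zero.2 hq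
  have bb : ∀ q, q ≠ 0 → Complex.exp (b q + b (-q)) = 1 := by
    intro q hq
    apply hexp q hq
    have h1 := pb (-q) (neg0 q hq)
    rw [pb q hq, neg_neg, smul_neg, neg_neg, smul_smul] at h1
    rw [Complex.exp_add, mul_comm, one_smul]; exact h1.symm
  have cc1 : ∀ q, q ≠ 0 → Complex.exp (c q + c (-q)) = 1 := by
    intro q hq
    apply hexp q hq
    have h1 := pc (-q) (neg0 q hq)
    rw [pc q hq, neg_neg, smul_smul] at h1
    rw [Complex.exp_add, mul_comm, one_smul]; exact h1.symm
  have bc : ∀ q, q ≠ 0 → Complex.exp (c q - b q) = -1 := by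
    intro q hq
    have : Complex.exp (c q) = - Complex.exp (b q) := by
      apply hexp q hq
      rw [← pc q hq, pb q hq, neg_smul]
    rw [Complex.exp_sub, this, neg_div, div_self (Complex.exp_ne_zero _)]
  have cn : ContinuousOn (fun q : Q4 => -q) {0}ᶜ := continuous_neg.continuousOn
  have Kb := constExp hpre (cb.add (cb.comp cn mn)) (fun x hx y hy => (bb x hx).trans (bb y hy).symm)
  have Kc := constExp hpre (cc.add (cc.comp cn mn)) (fun x hx y hy => (cc1 x hx).trans (cc1 y hy).symm)
  have Kbc := constExp hpre (cc.sub cb) (fun x hx y hy => (bc x hx).trans (bc y hy).symm)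
  simp only [Pi.add_apply, Pi.sub_apply, Function.comp_apply] at Kb Kc Kbc
  let q : Q4 := (1, 0)
  have hq : q ≠ 0 := by simp [q]
  have kn : ∀ q : Q4, kap (-q) = - kap q := fun q => by simpa using kap_smul (-1) q
  have inn : ∀ q : Q4, iot (-q) = - iot q := fun q => by simpa using iot_smul (-1) q
  have hA4 : ∀ q : Q4, A (kap (kap (kap (kap q)))) = A (-q) := fun q => by rw [kap4, sA 4 (by norm_num)]
  have hB2 : ∀ q : Q4, B (iot (iot q)) = B (-q) := fun q => by rw [iot2, sB 2 (by norm_num)]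
  have hA4' : ∀ q : Q4, A (-kap (kap (kap (kap q)))) = A q := fun q => by rw [← kn, ← kn, ← kn, ← kn, hA4, neg_neg]
  have hB2' : ∀ q : Q4, B (-iot (iot q)) = B q := fun q => by rw [← inn, ← inn, hB2, neg_neg]
  have F1 := congrArg Complex.im (Kb q hq (kap q) (kap_ne hq))
  have F2 := congrArg Complex.im (Kc q hq (iot q) (iot_ne hq))
  have F3 := congrArg Complex.im (Kbc q hq (-q) (neg0 q hq))
  simp only [b, c, Complex.add_im, Complex.sub_im, Complex.conj_im, kn, inn, hA4, hB2, hA4', hB2', neg_neg] at F1 F2 F3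
  have F4 : (c q - b q).im = 0 := by
    simp only [b, c, Complex.add_im, Complex.sub_im, Complex.conj_im]
    linarith
  have := bc q hq
  have h2 : Complex.exp (c q - b q) = ((Real.exp (c q - b q).re : ℝ) : ℂ) := by
    rw [Complex.ofReal_exp]
    congr 1
    apply Complex.ext <;> simp [F4]
  rw [h2] at this
  have h3 : Real.exp (c q - b q).re = -1 := by exact_mod_cast this
  have := Real.exp_pos (c q - b q).re
  linarith

end Mahler

end

section
open MeasureTheory
open scoped RealInnerProductSpace
set_option linter.all false

namespace Mahler

section JJ
variable {W : Type} [NormedAddCommGroup W] [NormedSpace ℝ W] [FiniteDimensional ℝ W]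
  [MeasureSpace W] [BorelSpace W] [(volume : Measure W).IsAddHaarMeasure]

noncomputable def J (C : Set W) (A : W → ℝ) : ℝ := (∫ y in C, Real.sign (A y)) / volume.real C

theorem sign_meas : Measurable Real.sign := by
  unfold Real.sign
  refine Measurable.ite measurableSet_Iio measurable_const ?_
  exact Measurable.ite measurableSet_Ioi measurable_const measurable_const

theorem sign_bd (r : ℝ) : |Real.sign r| ≤ 1 := by
  rcases Real.sign_apply_eq r with h | h | h <;> simp [h]

theorem sign_mul' (a b : ℝ) : Real.sign (a * b) = Real.sign a * Real.sign b := by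
  rcases lt_trichotomy a 0 with ha | ha | ha <;> rcases lt_trichotomy b 0 with hb | hb | hb <;>
    simp [ha, hb, Real.sign_of_pos, Real.sign_of_neg, mul_pos, mul_pos_of_neg_of_neg, mul_neg_of_neg_of_pos,
      mul_neg_of_pos_of_neg]

theorem sign_int {C : Set W} (h : Body C) {A : W → ℝ} (hA : Measurable A) :
    IntegrableOn (fun y => Real.sign (A y)) C := by
  refine Measure.integrableOn_of_bounded (M := 1) h.ne_top (sign_meas.comp hA).aestronglyMeasurable ?_
  exact Filter.Eventually.of_forall fun y => sign_bd _

theorem int_comp (M : W ≃ₗ[ℝ] W) (C : Set W) (φ : W → ℝ) :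
    ∫ y in M ⁻¹' C, φ (M y) = |(LinearMap.det (M : W →ₗ[ℝ] W))⁻¹| * ∫ y in C, φ y := by
  have hd : LinearMap.det (M : W →ₗ[ℝ] W) ≠ 0 := (LinearEquiv.isUnit_det' M).ne_zero
  have := (M.toContinuousLinearEquiv.toHomeomorph.measurableEmbedding).setIntegral_map (μ := volume) φ C
  have e1 := Measure.map_linearMap_addHaar_eq_smul_addHaar (volume : Measure W) hd
  have e2 : Measure.map (⇑M.toContinuousLinearEquiv.toHomeomorph) (volume : Measure W)
    = ENNReal.ofReal |(LinearMap.det (M : W →ₗ[ℝ] W))⁻¹| • volume := e1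
  rw [e2, Measure.restrict_smul, integral_smul_measure, ENNReal.toReal_ofReal (abs_nonneg _), smul_eq_mul] at this
  exact this.symm

theorem J_comp (M : W ≃ₗ[ℝ] W) (C : Set W) (A : W → ℝ) : J (M ⁻¹' C) (fun y => A (M y)) = J C A := by
  have hd : LinearMap.det (M : W →ₗ[ℝ] W) ≠ 0 := (LinearEquiv.isUnit_det' M).ne_zero
  have h1 := int_comp M C (fun y => Real.sign (A y))
  have h2 := int_comp M C (fun y => 1)
  simp only [integral_const, smul_eq_mul, mul_one, measureReal_restrict_apply_univ] at h2
  unfold J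
  rw [h1, h2]
  have : |(LinearMap.det (M : W →ₗ[ℝ] W))⁻¹| ≠ 0 := abs_ne_zero.2 (inv_ne_zero hd)
  rw [mul_div_mul_left _ _ this]

theorem J_congr (C : Set W) {A B : W → ℝ} (h : ∀ y, Real.sign (A y) = Real.sign (B y)) : J C A = J C B := by
  unfold J; simp only [h]

theorem J_neg (C : Set W) (A : W → ℝ) : J C (fun y => - A y) = - J C A := by
  unfold J; simp only [Real.sign_neg, integral_neg, neg_div]

theorem J_eqv {F : Type} {K : Set F} (M : W ≃ₗ[ℝ] W) {L L' : W → F} {A A' : W → ℝ} (hL : ∀ y, L' y = L (M y))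
    (hA : ∀ y, Real.sign (A' y) = Real.sign (A (M y))) : J (L' ⁻¹' K) A' = J (L ⁻¹' K) A := by
  rw [J_congr _ hA, ← J_comp M (L ⁻¹' K) A]
  congr 1
  ext y; simp [hL]

theorem J_eqv_neg {F : Type} {K : Set F} (M : W ≃ₗ[ℝ] W) {L L' : W → F} {A A' : W → ℝ} (hL : ∀ y, L' y = L (M y))
    (hA : ∀ y, Real.sign (A' y) = - Real.sign (A (M y))) : J (L' ⁻¹' K) A' = - J (L ⁻¹' K) A := by
  rw [← J_neg]
  exact J_eqv M hL (fun y => by rw [hA, Real.sign_neg])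

theorem J_pos {C : Set W} (h : Body C) {A : W → ℝ} (hA : ∀ᵐ y, 0 < A y) : 0 < J C A := by
  unfold J
  refine div_pos ?_ h.pos
  have : ∫ y in C, Real.sign (A y) = ∫ y in C, (1:ℝ) := by
    refine integral_congr_ae (ae_restrict_of_ae ?_)
    filter_upwards [hA] with y hy
    exact Real.sign_of_pos hy
  rw [this]
  simpa using h.pos

theorem J_lt {C : Set W} (h : Body C) {A B : W → ℝ} (hA : Continuous A) (hB : Continuous B)
    (hle : ∀ y, Real.sign (B y) ≤ Real.sign (A y)) {y0 : W}
    (h0 : ∀ c : ℝ, 0 < c → 0 < A (c • y0) ∧ B (c • y0) < 0) : J C B < J C A := by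
  unfold J
  refine div_lt_div_of_pos_right ?_ h.pos
  have iA := sign_int h hA.measurable
  have iB := sign_int h hB.measurable
  rw [← sub_pos, ← integral_sub iA iB]
  rw [integral_pos_iff_support_of_nonneg (fun y => sub_nonneg.2 (hle y)) (iA.sub iB)]
  have hopen : IsOpen (interior C ∩ {y | 0 < A y ∧ B y < 0}) := by
    refine isOpen_interior.inter ?_
    simp only [Set.setOf_and]
    exact (isOpen_lt continuous_const hA).inter (isOpen_lt hB continuous_const)
  have hne : (interior C ∩ {y | 0 < A y ∧ B y < 0}).Nonempty := by
    have ht : Filter.Tendsto (fun c : ℝ => c • y0) (nhdsWithin 0 (Set.Ioi 0)) (nhds 0) := by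
      have : Continuous fun c : ℝ => c • y0 := by fun_prop
      have := this.tendsto 0
      simp only [zero_smul] at this
      exact this.mono_left nhdsWithin_le_nhds
    have := (ht.eventually (isOpen_interior.mem_nhds h.zero)).and self_mem_nhdsWithin
    obtain ⟨c, hc1, hc2⟩ := this.exists
    exact ⟨c • y0, hc1, h0 c hc2⟩
  refine lt_of_lt_of_le (hopen.measure_pos volume hne) ?_
  rw [Measure.restrict_apply' h.measurable]
  refine measure_mono fun y hy => ⟨?_, interior_subset hy.1⟩
  simp [Real.sign_of_pos hy.2.1, Real.sign_of_neg hy.2.2]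

theorem null_lin (l : W →ₗ[ℝ] ℝ) {y : W} (hy : l y ≠ 0) : volume {y | l y = 0} = 0 := by
  have : {y | l y = 0} = (LinearMap.ker l : Set W) := by ext y; simp
  rw [this]
  refine Measure.addHaar_submodule _ _ ?_
  intro h
  have : y ∈ LinearMap.ker l := by rw [h]; trivial
  exact hy (by simpa using this)

theorem null_mul (l m : W →ₗ[ℝ] ℝ) {y z : W} (hy : l y ≠ 0) (hz : m z ≠ 0) :
    volume {y | l y * m y = 0} = 0 := by
  have : {y | l y * m y = 0} = {y | l y = 0} ∪ {y | m y = 0} := by ext y; simp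
  rw [this]
  exact measure_union_null (null_lin l hy) (null_lin m hz)

end JJ

section cont
variable {W : Type} [NormedAddCommGroup W] [NormedSpace ℝ W] [FiniteDimensional ℝ W]
  [MeasureSpace W] [BorelSpace W] [(volume : Measure W).IsAddHaarMeasure]
  {F : Type} [NormedAddCommGroup F] [NormedSpace ℝ F] [FiniteDimensional ℝ F]
  {X : Type} [TopologicalSpace X] [FirstCountableTopology X]

theorem I_cont {K : Set F} (h : Body K) {L : X → W →L[ℝ] F} (hL : ∀ y, Continuous fun x => L x y)
    (inj : ∀ x, Function.Injective (L x)) {A : X → W → ℝ} (hA : ∀ y, Continuous fun x => A x y)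
    (hA' : ∀ x, Continuous (A x)) (null : ∀ x, volume {y | A x y = 0} = 0) :
    Continuous fun x => ∫ y in L x ⁻¹' K, Real.sign (A x y) := by
  have hLc : Continuous L := continuous_clm_apply.2 hL
  have mC : ∀ x, MeasurableSet (L x ⁻¹' K) := fun x => (h.closed.preimage (L x).continuous).measurableSet
  have bC : ∀ x, Body (L x ⁻¹' K) := fun x => h.comap (L x : W →ₗ[ℝ] F) (inj x)
  simp_rw [← fun x => integral_indicator (f := fun y => Real.sign (A x y)) (μ := volume) (mC x)]
  rw [continuous_iff_continuousAt]
  intro a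
  obtain ⟨c, c0, hc⟩ := LinearMap.exists_antilipschitzWith (L a : W →ₗ[ℝ] F) (LinearMap.ker_eq_bot.2 (inj a))
  obtain ⟨R, hR⟩ := h.compact.isBounded.exists_norm_le
  have hc' : ∀ y, ‖y‖ ≤ c * ‖L a y‖ := by
    intro y
    have := hc.le_mul_dist y 0
    simpa using this
  have c0' : (0:ℝ) < c := c0
  have hU : ∀ᶠ x in nhds a, ∀ y, L x y ∈ K → ‖y‖ ≤ 2 * c * R := by
    have h1 := Metric.continuousAt_iff'.1 (hLc.continuousAt (x := a)) (1 / (2 * c)) (by positivity)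
    filter_upwards [h1] with x hx y hy
    rw [dist_eq_norm] at hx
    have h2 := (L x - L a).le_opNorm y
    have h3 := hc' y
    have h4 : ‖L a y‖ ≤ ‖L x y‖ + ‖(L x - L a) y‖ := by
      have : L a y = L x y - (L x - L a) y := by simp
      rw [this]; exact norm_sub_le _ _
    have h5 := hR _ hy
    have h6 : ‖L x - L a‖ * ‖y‖ ≤ 1 / (2 * c) * ‖y‖ := by gcongr
    have h7 : (c:ℝ) * (1 / (2 * c) * ‖y‖) = ‖y‖ / 2 := by field_simp
    have h8 : (c:ℝ) * ‖L a y‖ ≤ c * (R + 1 / (2 * c) * ‖y‖) := by gcongr; linarith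
    rw [mul_add, h7] at h8
    linarith
  refine continuousAt_of_dominated (bound := Set.indicator (Metric.closedBall 0 (2 * c * R)) 1) ?_ ?_ ?_ ?_
  · exact Filter.Eventually.of_forall fun x =>
      ((sign_meas.comp (hA' x).measurable).indicator (mC x)).aestronglyMeasurable
  · filter_upwards [hU] with x hx
    refine Filter.Eventually.of_forall fun y => ?_
    by_cases hy : L x y ∈ K
    · have hb : y ∈ Metric.closedBall (0:W) (2 * c * R) := by simpa using hx y hy
      rw [Set.indicator_of_mem (show y ∈ L x ⁻¹' K from hy), Set.indicator_of_mem hb]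
      exact sign_bd _
    · rw [Set.indicator_of_notMem (show y ∉ L x ⁻¹' K from hy), norm_zero]
      exact Set.indicator_nonneg (fun _ _ => zero_le_one) _
  · rw [integrable_indicator_iff Metric.isClosed_closedBall.measurableSet]
    exact integrableOn_const (isCompact_closedBall _ _).measure_lt_top.ne
  · have hfr : volume (frontier (L a ⁻¹' K)) = 0 := Convex.addHaar_frontier _ (bC a).conv
    have n1 : ∀ᵐ y, y ∉ frontier (L a ⁻¹' K) := measure_eq_zero_iff_ae_notMem.1 hfr
    have n2 : ∀ᵐ y, y ∉ {y | A a y = 0} := measure_eq_zero_iff_ae_notMem.1 (null a)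
    filter_upwards [n1, n2] with y hy1 hy2
    by_cases hy : L a y ∈ K
    · have hyi : y ∈ interior (L a ⁻¹' K) := by
        by_contra hcon
        exact hy1 ⟨subset_closure hy, hcon⟩
      have hintr : L a y ∈ interior K := by
        have hcont : Continuous fun t : ℝ => t • y := by fun_prop
        have h1 := hcont.tendsto 1
        simp only [one_smul] at h1
        have h2 := (h1.mono_left (nhdsWithin_le_nhds (s := Set.Ioi 1))).eventually (isOpen_interior.mem_nhds hyi)
        obtain ⟨t, ht1, ht2⟩ := (h2.and self_mem_nhdsWithin).exists
        have ht4 : t • y ∈ interior (L a ⁻¹' K) := ht1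
        have ht5 : t • y ∈ L a ⁻¹' K := interior_subset ht4
        have ht3 : L a (t • y) ∈ K := ht5
        have ht2 : 1 < t := ht2
        have := h.conv.combo_interior_self_mem_interior h.zero ht3 (a := 1 - t⁻¹) (b := t⁻¹)
          (by have := inv_lt_one_of_one_lt₀ ht2; linarith) (by positivity) (by ring)
        rw [map_smul, smul_zero, zero_add, smul_smul, inv_mul_cancel₀ (by positivity), one_smul] at this
        exact this
      have e1 : ∀ᶠ x in nhds a, L x y ∈ K := by
        filter_upwards [(hL y).continuousAt.eventually (isOpen_interior.mem_nhds hintr)] with x hx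
        exact interior_subset hx
      have e2 : ∀ᶠ x in nhds a, Real.sign (A x y) = Real.sign (A a y) := by
        rcases lt_or_gt_of_ne hy2 with hn | hp
        · filter_upwards [(hA y).continuousAt.eventually (gt_mem_nhds hn)] with x hx
          rw [Real.sign_of_neg hx, Real.sign_of_neg hn]
        · filter_upwards [(hA y).continuousAt.eventually (lt_mem_nhds hp)] with x hx
          rw [Real.sign_of_pos hx, Real.sign_of_pos hp]
      refine ContinuousAt.congr (f := fun _ => Real.sign (A a y)) continuousAt_const ?_
      filter_upwards [e1, e2] with x hx1 hx2
      rw [Set.indicator_of_mem (show y ∈ L x ⁻¹' K from hx1), hx2]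
    · refine ContinuousAt.congr (f := fun _ => 0) continuousAt_const ?_
      filter_upwards [(hL y).continuousAt.eventually (h.closed.isOpen_compl.mem_nhds hy)] with x hx
      rw [Set.indicator_of_notMem (show y ∉ L x ⁻¹' K from hx)]

theorem J_cont {K : Set F} (h : Body K) {L : X → W →L[ℝ] F} (hL : ∀ y, Continuous fun x => L x y)
    (inj : ∀ x, Function.Injective (L x)) {A : X → W → ℝ} (hA : ∀ y, Continuous fun x => A x y)
    (hA' : ∀ x, Continuous (A x)) (null : ∀ x, volume {y | A x y = 0} = 0) :
    Continuous fun x => J (L x ⁻¹' K) (A x) := by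
  unfold J
  refine (I_cont h hL inj hA hA' null).div ?_ ?_
  · have := I_cont h hL inj (A := fun _ _ => 1) (fun _ => continuous_const) (fun _ => continuous_const) (by simp)
    simpa using this
  · intro x
    exact (h.comap (L x : W →ₗ[ℝ] F) (inj x)).pos.ne'

end cont
end Mahler

end

section
open MeasureTheory
open scoped RealInnerProductSpace
set_option linter.all false

namespace Mahler

section root
variable {W : Type} [NormedAddCommGroup W] [NormedSpace ℝ W] [FiniteDimensional ℝ W]
  [MeasureSpace W] [BorelSpace W] [(volume : Measure W).IsAddHaarMeasure]

structure Fam (A : ℝ → W → ℝ) (N : Set W) : Prop where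
  cont : Continuous fun p : ℝ × W => A p.1 p.2
  hom : ∀ c τ y, A τ (c • y) = c ^ 2 * A τ y
  null : ∀ τ, volume {y | A τ y = 0} = 0
  mono : ∀ τ τ', τ ∈ Set.Icc (-1:ℝ) 1 → τ' ∈ Set.Icc (-1:ℝ) 1 → τ < τ' → ∀ y ∉ N, 0 ≤ A τ' y → 0 < A τ y
  top : ∀ y, A 1 y ≤ 0
  bot : ∀ y, 0 ≤ A (-1) y
  mid : ∀ μ ∈ Set.Ioo (-1:ℝ) 1, ∃ y ∉ N, A μ y = 0
  Nzero : ∀ y ∈ N, ∀ τ, A τ y = 0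

theorem Fam.ct {A : ℝ → W → ℝ} {N : Set W} (hA : Fam A N) (τ : ℝ) : Continuous (A τ) :=
  hA.cont.comp (by fun_prop : Continuous fun y : W => (τ, y))

theorem Fam.anti {A : ℝ → W → ℝ} {N : Set W} (hA : Fam A N) {C : Set W} (h : Body C) :
    StrictAntiOn (fun τ => J C (A τ)) (Set.Icc (-1) 1) := by
  intro τ ht τ' ht' hlt
  have hm : (τ + τ') / 2 ∈ Set.Ioo (-1:ℝ) 1 := ⟨by linarith [ht.1, ht'.1], by linarith [ht.2, ht'.2]⟩
  obtain ⟨y, hyN, hy⟩ := hA.mid _ hm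
  refine J_lt h (hA.ct τ) (hA.ct τ') (y0 := y) ?_ ?_
  · intro z
    by_cases hz : z ∈ N
    · rw [hA.Nzero z hz, hA.Nzero z hz]
    · by_cases h0 : 0 ≤ A τ' z
      · rw [Real.sign_of_pos (hA.mono τ τ' ht ht' hlt z hz h0)]
        exact (abs_le.1 (sign_bd _)).2
      · rw [Real.sign_of_neg (not_le.1 h0)]
        exact (abs_le.1 (sign_bd _)).1
  · intro c hc
    rw [hA.hom, hA.hom]
    have h1 := hA.mono τ _ ht (Set.Ioo_subset_Icc_self hm) (by linarith) y hyN hy.ge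
    have h2 : A τ' y < 0 := by
      by_contra hcon
      have := hA.mono _ τ' (Set.Ioo_subset_Icc_self hm) ht' (by linarith) y hyN (not_lt.1 hcon)
      linarith
    exact ⟨by positivity, mul_neg_of_pos_of_neg (by positivity) h2⟩

theorem Fam.uniq {A : ℝ → W → ℝ} {N : Set W} (hA : Fam A N) {C : Set W} (h : Body C) {τ τ' : ℝ}
    (ht : τ ∈ Set.Ioo (-1:ℝ) 1) (ht' : τ' ∈ Set.Ioo (-1:ℝ) 1) (e : J C (A τ) = 0) (e' : J C (A τ') = 0) : τ = τ' :=
  (hA.anti h).injOn (Set.Ioo_subset_Icc_self ht) (Set.Ioo_subset_Icc_self ht') (e.trans e'.symm)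

variable {F : Type} [NormedAddCommGroup F] [NormedSpace ℝ F] [FiniteDimensional ℝ F]
  {X : Type} [TopologicalSpace X] [FirstCountableTopology X]

theorem Fam.root {A : ℝ → W → ℝ} {N : Set W} (hA : Fam A N) {K : Set F} (h : Body K) {L : X → W →L[ℝ] F}
    (hL : ∀ y, Continuous fun x => L x y) (inj : ∀ x, Function.Injective (L x)) :
    ∃ τ : X → ℝ, Continuous τ ∧ ∀ x, τ x ∈ Set.Ioo (-1:ℝ) 1 ∧ J (L x ⁻¹' K) (A (τ x)) = 0 := by
  have bC : ∀ x, Body (L x ⁻¹' K) := fun x => h.comap (L x : W →ₗ[ℝ] F) (inj x)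
  have hΦ : Continuous fun p : X × ℝ => J (L p.1 ⁻¹' K) (A p.2) := by
    refine J_cont (X := X × ℝ) (L := fun p => L p.1) (A := fun p => A p.2) h (fun y => (hL y).comp continuous_fst)
      (fun p => inj p.1) ?_ (fun p => hA.ct p.2) (fun p => hA.null p.2)
    intro y
    exact hA.cont.comp (by fun_prop : Continuous fun p : X × ℝ => (p.2, y))
  have aeN : ∀ τ, ∀ᵐ y, y ∉ {y | A τ y = 0} := fun τ => measure_eq_zero_iff_ae_notMem.1 (hA.null τ)
  have hp : ∀ x, 0 < J (L x ⁻¹' K) (A (-1)) := fun x =>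
    J_pos (bC x) (by filter_upwards [aeN (-1)] with y hy using lt_of_le_of_ne (hA.bot y) (Ne.symm hy))
  have hn : ∀ x, J (L x ⁻¹' K) (A 1) < 0 := fun x => by
    have := J_pos (bC x) (A := fun y => - A 1 y) (by
      filter_upwards [aeN 1] with y hy
      have := lt_of_le_of_ne (hA.top y) hy
      linarith)
    rw [J_neg] at this
    linarith
  have ex : ∀ x, ∃ t, t ∈ Set.Ioo (-1:ℝ) 1 ∧ J (L x ⁻¹' K) (A t) = 0 := by
    intro x
    have hc : ContinuousOn (fun t => J (L x ⁻¹' K) (A t)) (Set.Icc (-1) 1) :=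
      (hΦ.comp (by fun_prop : Continuous fun t : ℝ => (x, t))).continuousOn
    obtain ⟨t, ht, e⟩ := intermediate_value_Ioo' (by norm_num : (-1:ℝ) ≤ 1) hc ⟨hn x, hp x⟩
    exact ⟨t, ht, e⟩
  choose τ h1 h2 using ex
  refine ⟨τ, ?_, fun x => ⟨h1 x, h2 x⟩⟩
  rw [continuous_iff_continuousAt]
  intro a
  have cx : ∀ t, Continuous fun x => J (L x ⁻¹' K) (A t) := fun t =>
    hΦ.comp (by fun_prop : Continuous fun x : X => (x, t))
  refine tendsto_order.2 ⟨fun u hu => ?_, fun u hu => ?_⟩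
  · by_cases hu1 : u < -1
    · exact Filter.Eventually.of_forall fun x => hu1.trans (h1 x).1
    have hui : u ∈ Set.Icc (-1:ℝ) 1 := ⟨not_lt.1 hu1, hu.le.trans (h1 a).2.le⟩
    have : 0 < J (L a ⁻¹' K) (A u) := by
      have := hA.anti (bC a) hui (Set.Ioo_subset_Icc_self (h1 a)) hu
      simp only [h2] at this
      exact this
    filter_upwards [(cx u).continuousAt.eventually (lt_mem_nhds this)] with x hx
    by_contra hcon
    have := (hA.anti (bC x)).antitoneOn (Set.Ioo_subset_Icc_self (h1 x)) hui (not_lt.1 hcon)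
    simp only [h2] at this
    linarith
  · by_cases hu1 : 1 < u
    · exact Filter.Eventually.of_forall fun x => (h1 x).2.trans hu1
    have hui : u ∈ Set.Icc (-1:ℝ) 1 := ⟨(h1 a).1.le.trans hu.le, not_lt.1 hu1⟩
    have : J (L a ⁻¹' K) (A u) < 0 := by
      have := hA.anti (bC a) (Set.Ioo_subset_Icc_self (h1 a)) hui hu
      simp only [h2] at this
      exact this
    filter_upwards [(cx u).continuousAt.eventually (gt_mem_nhds this)] with x hx
    by_contra hcon
    have := (hA.anti (bC x)).antitoneOn hui (Set.Ioo_subset_Icc_self (h1 x)) (not_lt.1 hcon)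
    simp only [h2] at this
    linarith
end root

/-! the two families -/
def At (τ : ℝ) (y : V) : ℝ := (y.1 - τ * y.2.1) * (y.2.1 - τ * y.1)
def As (σ : ℝ) (y : V2) : ℝ := y.1 * ((1 - |σ|) * y.2 - σ * y.1)

def f1 : V →ₗ[ℝ] ℝ := LinearMap.fst ℝ ℝ V2
def f2 : V →ₗ[ℝ] ℝ := LinearMap.fst ℝ ℝ ℝ ∘ₗ LinearMap.snd ℝ ℝ V2
def f3 : V →ₗ[ℝ] ℝ := LinearMap.snd ℝ ℝ ℝ ∘ₗ LinearMap.snd ℝ ℝ V2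

theorem Fam_t : Fam At {y : V | y.1 = 0 ∧ y.2.1 = 0} where
  cont := by unfold At; fun_prop
  hom c τ y := by simp [At]; ring
  null τ := null_mul (f1 - τ • f2) (f2 - τ • f1) (y := (1,0,0)) (z := (0,1,0)) (by simp [f1, f2]) (by simp [f1, f2])
  mono τ τ' ht ht' hlt y hy h0 := by
    have hpos : 0 < y.1 ^ 2 + y.2.1 ^ 2 := by
      by_contra hcon
      apply hy
      constructor <;> nlinarith [sq_nonneg y.1, sq_nonneg y.2.1]
    have h1 : 0 < (τ' - τ) * (1 - τ * τ') := by
      apply mul_pos (by linarith)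
      rcases ht with ⟨a, b⟩
      rcases ht' with ⟨c, d⟩
      nlinarith
    have h2 : (1 + τ' ^ 2) * At τ y = (1 + τ ^ 2) * At τ' y + (τ' - τ) * (1 - τ * τ') * (y.1 ^ 2 + y.2.1 ^ 2) := by
      unfold At; ring
    have h3 : 0 < (1 + τ' ^ 2) * At τ y := by rw [h2]; positivity
    exact pos_of_mul_pos_right h3 (by positivity)
  top y := by unfold At; nlinarith [sq_nonneg (y.1 - y.2.1)]
  bot y := by unfold At; nlinarith [sq_nonneg (y.1 + y.2.1)]
  mid μ hμ := ⟨(1, μ, 0), by simp, by simp [At]⟩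
  Nzero y hy τ := by simp [At, hy.1, hy.2]

theorem Fam_s : Fam As {y : V2 | y.1 = 0} where
  cont := by unfold As; fun_prop
  hom c τ y := by simp [As]; ring
  null σ := by
    refine null_mul (LinearMap.fst ℝ ℝ ℝ) ((1 - |σ|) • LinearMap.snd ℝ ℝ ℝ - σ • LinearMap.fst ℝ ℝ ℝ)
      (y := (1,0)) (z := if |σ| = 1 then (1,0) else (0,1)) (by simp) ?_
    split_ifs with h
    · simp; rintro rfl; simp at h
    · simp; intro h2; apply h; linarith
  mono σ σ' ht ht' hlt y hy h0 := by
    have hs : 0 < y.1 ^ 2 := by have : y.1 ≠ 0 := hy; positivity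
    have hlt1 : |σ'| < 1 := by
      rw [abs_lt]
      refine ⟨by linarith [ht.1], lt_of_le_of_ne ht'.2 ?_⟩
      rintro rfl
      simp [As] at h0
      nlinarith
    have h2 : (1 - |σ'|) * As σ y = (1 - |σ|) * As σ' y + ((1 - |σ|) * σ' - (1 - |σ'|) * σ) * y.1 ^ 2 := by
      unfold As; ring
    have h1 : 0 < (1 - |σ|) * σ' - (1 - |σ'|) * σ := by
      rcases le_or_gt 0 σ with a | a <;> rcases le_total 0 σ' with b | b
      · rw [abs_of_nonneg a, abs_of_nonneg b]; linarith
      · linarith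
      · rw [abs_of_neg a, abs_of_nonneg b] at *
        have h5 : 0 < (1 - σ') * (-σ) := mul_pos (by linarith) (by linarith)
        have h6 : 0 ≤ (1 - -σ) * σ' := mul_nonneg (by linarith [ht.1]) b
        linarith
      · rw [abs_of_neg a, abs_of_nonpos b]; linarith
    have h4 : 0 ≤ 1 - |σ| := by have := abs_le.2 ht; linarith
    have h3 : 0 < (1 - |σ'|) * As σ y := by rw [h2]; positivity
    exact pos_of_mul_pos_right h3 (by linarith)
  top y := by simp [As]; nlinarith [sq_nonneg y.1]
  bot y := by simp [As]; nlinarith [sq_nonneg y.1]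
  mid μ hμ := ⟨(1 - |μ|, μ), by have := abs_lt.2 hμ; simp; linarith, by simp [As]; right; ring⟩
  Nzero y hy τ := by
    have : y.1 = 0 := hy
    simp [As, this]
end Mahler

end

section
open MeasureTheory
open scoped RealInnerProductSpace
set_option linter.all false

namespace Mahler

theorem sgn_p {k : ℝ} (hk : 0 < k) (x : ℝ) : Real.sign (k * x) = Real.sign x := by
  rw [sign_mul', Real.sign_of_pos hk, one_mul]
theorem sgn_n {k : ℝ} (hk : k < 0) (x : ℝ) : Real.sign (k * x) = - Real.sign x := by
  rw [sign_mul', Real.sign_of_neg hk]; ring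
theorem sgn_k {k : ℝ} (hk : k ≠ 0) (x : ℝ) : Real.sign x = Real.sign k * Real.sign (k * x) := by
  rcases lt_or_gt_of_ne hk with h | h
  · rw [sgn_n h, Real.sign_of_neg h]; ring
  · rw [sgn_p h, Real.sign_of_pos h]; ring

noncomputable def T3 (p1 p2 p3 : V) : V →L[ℝ] V :=
  LinearMap.toContinuousLinearMap (f1.smulRight p1 + f2.smulRight p2 + f3.smulRight p3)
noncomputable def T2 (p1 p2 : V) : V2 →L[ℝ] V :=
  LinearMap.toContinuousLinearMap ((LinearMap.fst ℝ ℝ ℝ).smulRight p1 + (LinearMap.snd ℝ ℝ ℝ).smulRight p2)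

theorem T3_apply (p1 p2 p3 y : V) : T3 p1 p2 p3 y = y.1 • p1 + y.2.1 • p2 + y.2.2 • p3 := rfl
theorem T2_apply (p1 p2 : V) (y : V2) : T2 p1 p2 y = y.1 • p1 + y.2 • p2 := rfl

def LI (p1 p2 p3 : V) : Prop := ∀ a b c : ℝ, a • p1 + b • p2 + c • p3 = 0 → a = 0 ∧ b = 0 ∧ c = 0
def LI2 (p1 p2 : V) : Prop := ∀ a b : ℝ, a • p1 + b • p2 = 0 → a = 0 ∧ b = 0

theorem LI.inj {p1 p2 p3 : V} (h : LI p1 p2 p3) : Function.Injective (T3 p1 p2 p3) := by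
  rw [injective_iff_map_eq_zero]
  intro y hy
  rw [T3_apply] at hy
  obtain ⟨h1, h2, h3⟩ := h _ _ _ hy
  exact Prod.ext h1 (Prod.ext h2 h3)
theorem LI2.inj {p1 p2 : V} (h : LI2 p1 p2) : Function.Injective (T2 p1 p2) := by
  rw [injective_iff_map_eq_zero]
  intro y hy
  rw [T2_apply] at hy
  obtain ⟨h1, h2⟩ := h _ _ hy
  exact Prod.ext h1 h2
theorem LI.perm {p1 p2 p3 : V} (h : LI p1 p2 p3) : LI p2 p3 p1 := by
  intro a b c e
  obtain ⟨h1, h2, h3⟩ := h c a b (by rw [← e]; abel)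
  exact ⟨h2, h3, h1⟩
theorem LI.swap {p1 p2 p3 : V} (h : LI p1 p2 p3) : LI p2 p1 p3 := by
  intro a b c e
  obtain ⟨h1, h2, h3⟩ := h b a c (by rw [← e]; abel)
  exact ⟨h2, h1, h3⟩
theorem LI.two {p1 p2 p3 : V} (h : LI p1 p2 p3) : LI2 p1 p2 := by
  intro a b e
  obtain ⟨h1, h2, h3⟩ := h a b 0 (by rw [← e]; simp)
  exact ⟨h1, h2⟩

theorem J_eqv_s {W : Type} [NormedAddCommGroup W] [NormedSpace ℝ W] [FiniteDimensional ℝ W]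
    [MeasureSpace W] [BorelSpace W] [(volume : Measure W).IsAddHaarMeasure]
    {F : Type} {K : Set F} (M : W →ₗ[ℝ] W) (hM : ∀ y, M y = 0 → y = 0) (s : ℝ)
    {L L' : W → F} {A A' : W → ℝ} (hL : ∀ y, L' y = L (M y))
    (hA : ∀ y, Real.sign (A' y) = s * Real.sign (A (M y))) : J (L' ⁻¹' K) A' = s * J (L ⁻¹' K) A := by
  have hi : Function.Injective M := by rwa [injective_iff_map_eq_zero]
  have := J_comp (LinearEquiv.ofInjectiveEndo M hi) (L ⁻¹' K) A
  rw [← this]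
  have e : L' ⁻¹' K = (LinearEquiv.ofInjectiveEndo M hi) ⁻¹' (L ⁻¹' K) := by
    ext y; simp [hL]
  rw [e]
  unfold J
  simp only [hA, LinearEquiv.coe_ofInjectiveEndo, integral_const_mul, mul_div_assoc]

noncomputable def G (K : Set V) (p1 p2 p3 : V) : ℝ := J (T3 p1 p2 p3 ⁻¹' K) (fun y => y.1 * y.2.1)
noncomputable def G2 (K : Set V) (p1 p2 : V) : ℝ := J (T2 p1 p2 ⁻¹' K) (fun y => y.1 * y.2)
noncomputable def Ps (K : Set V) (p1 p2 p3 : V) (τ : ℝ) : ℝ := J (T3 p1 p2 p3 ⁻¹' K) (At τ)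
noncomputable def S2 (K : Set V) (h e : V) (σ : ℝ) : ℝ := J (T2 h e ⁻¹' K) (As σ)

def m3 (a11 a12 a13 a21 a22 a23 a31 a32 a33 : ℝ) : V →ₗ[ℝ] V where
  toFun y := (a11 * y.1 + a12 * y.2.1 + a13 * y.2.2, a21 * y.1 + a22 * y.2.1 + a23 * y.2.2,
    a31 * y.1 + a32 * y.2.1 + a33 * y.2.2)
  map_add' x y := by ext <;> simp <;> ring
  map_smul' c y := by ext <;> simp <;> ring
def m2 (a11 a12 a21 a22 : ℝ) : V2 →ₗ[ℝ] V2 where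
  toFun y := (a11 * y.1 + a12 * y.2, a21 * y.1 + a22 * y.2)
  map_add' x y := by ext <;> simp <;> ring
  map_smul' c y := by ext <;> simp <;> ring
theorem m3_apply (a11 a12 a13 a21 a22 a23 a31 a32 a33 : ℝ) (y : V) : m3 a11 a12 a13 a21 a22 a23 a31 a32 a33 y =
  (a11 * y.1 + a12 * y.2.1 + a13 * y.2.2, a21 * y.1 + a22 * y.2.1 + a23 * y.2.2,
    a31 * y.1 + a32 * y.2.1 + a33 * y.2.2) := rfl
theorem m2_apply (a11 a12 a21 a22 : ℝ) (y : V2) : m2 a11 a12 a21 a22 y =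
  (a11 * y.1 + a12 * y.2, a21 * y.1 + a22 * y.2) := rfl

theorem G_law (K : Set V) {a b c : ℝ} (u v : ℝ) (ha : a ≠ 0) (hb : b ≠ 0) (hc : c ≠ 0) (p1 p2 p3 : V) :
    G K (a • p1 + u • p3) (b • p2 + v • p3) (c • p3) = Real.sign (a * b) * G K p1 p2 p3 := by
  refine J_eqv_s (m3 a 0 0 0 b 0 u v c) ?_ _ ?_ ?_
  · intro y hy
    simp only [m3_apply, Prod.mk_eq_zero] at hy
    obtain ⟨h1, h2, h3⟩ := hy
    have e1 : y.1 = 0 := by simpa [ha] using h1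
    have e2 : y.2.1 = 0 := by simpa [hb] using h2
    have e3 : y.2.2 = 0 := by simpa [hc, e1, e2] using h3
    exact Prod.ext e1 (Prod.ext e2 e3)
  · intro y
    simp only [T3_apply, m3_apply]; module
  · intro y
    rw [sgn_k (mul_ne_zero ha hb)]; simp only [m3_apply]; congr 2; ring

theorem G_scale (K : Set V) {a b c : ℝ} (ha : a ≠ 0) (hb : b ≠ 0) (hc : c ≠ 0) (p1 p2 p3 : V) :
    G K (a • p1) (b • p2) (c • p3) = Real.sign (a * b) * G K p1 p2 p3 := by
  simpa using G_law K 0 0 ha hb hc p1 p2 p3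

theorem G_symm (K : Set V) (p1 p2 p3 : V) : G K p2 p1 p3 = G K p1 p2 p3 := by
  rw [← one_mul (G K p1 p2 p3)]
  refine J_eqv_s (m3 0 1 0 1 0 0 0 0 1) ?_ _ ?_ ?_
  · intro y hy
    simp only [m3_apply, Prod.mk_eq_zero] at hy
    obtain ⟨h1, h2, h3⟩ := hy
    exact Prod.ext (by simpa using h2) (Prod.ext (by simpa using h1) (by simpa using h3))
  · intro y
    simp only [T3_apply, m3_apply]; module
  · intro y
    rw [one_mul]; simp only [m3_apply]; congr 1; ring

theorem G2_scale (K : Set V) {a b : ℝ} (ha : a ≠ 0) (hb : b ≠ 0) (p1 p2 : V) :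
    G2 K (a • p1) (b • p2) = Real.sign (a * b) * G2 K p1 p2 := by
  refine J_eqv_s (m2 a 0 0 b) ?_ _ ?_ ?_
  · intro y hy
    simp only [m2_apply, Prod.mk_eq_zero] at hy
    obtain ⟨h1, h2⟩ := hy
    exact Prod.ext (by simpa [ha] using h1) (by simpa [hb] using h2)
  · intro y
    simp only [T2_apply, m2_apply]; module
  · intro y
    rw [sgn_k (mul_ne_zero ha hb)]; simp only [m2_apply]; congr 2; ring

theorem G2_symm (K : Set V) (p1 p2 : V) : G2 K p2 p1 = G2 K p1 p2 := by
  rw [← one_mul (G2 K p1 p2)]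
  refine J_eqv_s (m2 0 1 1 0) ?_ _ ?_ ?_
  · intro y hy
    simp only [m2_apply, Prod.mk_eq_zero] at hy
    obtain ⟨h1, h2⟩ := hy
    exact Prod.ext (by simpa using h2) (by simpa using h1)
  · intro y
    simp only [T2_apply, m2_apply]; module
  · intro y
    rw [one_mul]; simp only [m2_apply]; congr 1; ring

theorem G_Ps (K : Set V) {τ : ℝ} (ht : τ ∈ Set.Ioo (-1:ℝ) 1) (e1 e2 e3 : V) :
    G K (e1 + τ • e2) (τ • e1 + e2) e3 = Ps K e1 e2 e3 τ := by
  have h1 : 0 < 1 - τ ^ 2 := by nlinarith [ht.1, ht.2]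
  rw [← one_mul (Ps K e1 e2 e3 τ)]
  refine J_eqv_s (m3 1 τ 0 τ 1 0 0 0 1) ?_ _ ?_ ?_
  · intro y hy
    simp only [m3_apply, Prod.mk_eq_zero] at hy
    obtain ⟨h1', h2, h3⟩ := hy
    have e1 : y.1 = 0 := by
      have : (1 - τ ^ 2) * y.1 = 0 := by linear_combination h1' - τ * h2
      exact (mul_eq_zero.1 this).resolve_left h1.ne'
    have e2 : y.2.1 = 0 := by simpa [e1] using h2
    exact Prod.ext e1 (Prod.ext e2 (by simpa using h3))
  · intro y
    simp only [T3_apply, m3_apply]; module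
  · intro y
    have : At τ (m3 1 τ 0 τ 1 0 0 0 1 y) = (1 - τ ^ 2) ^ 2 * (y.1 * y.2.1) := by
      simp only [At, m3_apply]; ring
    rw [this, sgn_p (pow_pos h1 2)]; ring

theorem G2_S2 (K : Set V) {σ : ℝ} (hs : σ ∈ Set.Ioo (-1:ℝ) 1) (h e : V) :
    G2 K ((1 - |σ|) • h + σ • e) e = S2 K h e σ := by
  have h1 : 0 < 1 - |σ| := by have := abs_lt.2 hs; linarith
  rw [← one_mul (S2 K h e σ)]
  refine J_eqv_s (m2 (1 - |σ|) 0 σ 1) ?_ _ ?_ ?_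
  · intro y hy
    simp only [m2_apply, Prod.mk_eq_zero] at hy
    obtain ⟨h1', h2⟩ := hy
    have e1 : y.1 = 0 := by simpa [h1.ne'] using h1'
    exact Prod.ext e1 (by simpa [e1] using h2)
  · intro y
    simp only [T2_apply, m2_apply]; module
  · intro y
    have : As σ (m2 (1 - |σ|) 0 σ 1 y) = (1 - |σ|) ^ 2 * (y.1 * y.2) := by
      simp only [As, m2_apply]; ring
    rw [this, sgn_p (pow_pos h1 2)]; ring

theorem Ps_scale (K : Set V) {c : ℝ} (hc : c ≠ 0) (e1 e2 e3 : V) (τ : ℝ) :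
    Ps K (c • e1) (c • e2) (c • e3) τ = Ps K e1 e2 e3 τ := by
  rw [← one_mul (Ps K e1 e2 e3 τ)]
  refine J_eqv_s (m3 c 0 0 0 c 0 0 0 c) ?_ _ ?_ ?_
  · intro y hy
    simp only [m3_apply, Prod.mk_eq_zero] at hy
    obtain ⟨h1, h2, h3⟩ := hy
    exact Prod.ext (by simpa [hc] using h1) (Prod.ext (by simpa [hc] using h2) (by simpa [hc] using h3))
  · intro y
    simp only [T3_apply, m3_apply]; module
  · intro y
    have : At τ (m3 c 0 0 0 c 0 0 0 c y) = c ^ 2 * At τ y := by simp only [At, m3_apply]; ring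
    rw [this, sgn_p (by positivity)]; ring

theorem Ps_k (K : Set V) (e1 e2 e3 : V) (τ : ℝ) :
    Ps K ((2:ℝ) • e2) ((-2:ℝ) • e1) ((2:ℝ) • e3) τ = -1 * Ps K e1 e2 e3 (-τ) := by
  refine J_eqv_s (m3 0 (-2) 0 2 0 0 0 0 2) ?_ _ ?_ ?_
  · intro y hy
    simp only [m3_apply, Prod.mk_eq_zero] at hy
    obtain ⟨h1, h2, h3⟩ := hy
    exact Prod.ext (by simpa using h2) (Prod.ext (by simpa using h1) (by simpa using h3))
  · intro y
    simp only [T3_apply, m3_apply]; module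
  · intro y
    have : At (-τ) (m3 0 (-2) 0 2 0 0 0 0 2 y) = (-4) * At τ y := by simp only [At, m3_apply]; ring
    rw [this, sgn_n (by norm_num)]; ring

theorem Ps_i (K : Set V) (e1 e2 e3 : V) (τ : ℝ) :
    Ps K ((2:ℝ) • e2) ((2:ℝ) • e1) ((-2:ℝ) • e3) τ = Ps K e1 e2 e3 τ := by
  rw [← one_mul (Ps K e1 e2 e3 τ)]
  refine J_eqv_s (m3 0 2 0 2 0 0 0 0 (-2)) ?_ _ ?_ ?_
  · intro y hy
    simp only [m3_apply, Prod.mk_eq_zero] at hy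
    obtain ⟨h1, h2, h3⟩ := hy
    exact Prod.ext (by simpa using h2) (Prod.ext (by simpa using h1) (by simpa using h3))
  · intro y
    simp only [T3_apply, m3_apply]; module
  · intro y
    have : At τ (m3 0 2 0 2 0 0 0 0 (-2) y) = 4 * At τ y := by simp only [At, m3_apply]; ring
    rw [this, sgn_p (by norm_num)]; ring

theorem S2_scale (K : Set V) {c : ℝ} (hc : c ≠ 0) (h e : V) (σ : ℝ) :
    S2 K (c • h) (c • e) σ = S2 K h e σ := by
  rw [← one_mul (S2 K h e σ)]
  refine J_eqv_s (m2 c 0 0 c) ?_ _ ?_ ?_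
  · intro y hy
    simp only [m2_apply, Prod.mk_eq_zero] at hy
    obtain ⟨h1, h2⟩ := hy
    exact Prod.ext (by simpa [hc] using h1) (by simpa [hc] using h2)
  · intro y
    simp only [T2_apply, m2_apply]; module
  · intro y
    have : As σ (m2 c 0 0 c y) = c ^ 2 * As σ y := by simp only [As, m2_apply]; ring
    rw [this, sgn_p (by positivity)]; ring

theorem S2_neg (K : Set V) {c d : ℝ} (hc : c ≠ 0) (hd : d = -c) (h e : V) (σ : ℝ) :
    S2 K (c • h) (d • e) σ = -1 * S2 K h e (-σ) := by
  subst hd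
  refine J_eqv_s (m2 c 0 0 (-c)) ?_ _ ?_ ?_
  · intro y hy
    simp only [m2_apply, Prod.mk_eq_zero] at hy
    obtain ⟨h1, h2⟩ := hy
    exact Prod.ext (by simpa [hc] using h1) (by simpa [hc] using h2)
  · intro y
    simp only [T2_apply, m2_apply]; module
  · intro y
    have : As (-σ) (m2 c 0 0 (-c) y) = (-c ^ 2) * As σ y := by simp only [As, m2_apply, abs_neg]; ring
    have hc2 : 0 < c ^ 2 := by positivity
    rw [this, sgn_n (by linarith)]; ring

end Mahler

end

section
open MeasureTheory
open scoped RealInnerProductSpace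
set_option linter.all false

namespace Mahler

structure Frm (K : Set V) (e1 e2 e3 : V) (τ σ1 σ2 : ℝ) : Prop where
  li : LI e1 e2 e3
  ht : τ ∈ Set.Ioo (-1:ℝ) 1
  hs1 : σ1 ∈ Set.Ioo (-1:ℝ) 1
  hs2 : σ2 ∈ Set.Ioo (-1:ℝ) 1
  z : Ps K e1 e2 e3 τ = 0
  z1 : S2 K (e1 + τ • e2) e3 σ1 = 0
  z2 : S2 K (τ • e1 + e2) e3 σ2 = 0

theorem LI.tau {e1 e2 e3 : V} (h : LI e1 e2 e3) {τ : ℝ} (ht : τ ∈ Set.Ioo (-1:ℝ) 1) :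
    LI (e1 + τ • e2) (τ • e1 + e2) e3 := by
  intro a b c e
  have h1 : 0 < 1 - τ ^ 2 := by nlinarith [ht.1, ht.2]
  obtain ⟨x, y, z⟩ := h (a + b * τ) (a * τ + b) c (by rw [← e]; module)
  refine ⟨?_, ?_, z⟩
  · have : (1 - τ ^ 2) * a = 0 := by linear_combination x - τ * y
    exact (mul_eq_zero.1 this).resolve_left h1.ne'
  · have : (1 - τ ^ 2) * b = 0 := by linear_combination y - τ * x
    exact (mul_eq_zero.1 this).resolve_left h1.ne'

theorem LI.sig {e1 e2 e3 : V} (h : LI e1 e2 e3) {s1 s2 : ℝ} (h1 : s1 ∈ Set.Ioo (-1:ℝ) 1) (h2 : s2 ∈ Set.Ioo (-1:ℝ) 1) :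
    LI ((1 - |s1|) • e1 + s1 • e3) ((1 - |s2|) • e2 + s2 • e3) e3 := by
  intro a b c e
  have h1' : 1 - |s1| ≠ 0 := by have := abs_lt.2 h1; intro h; linarith
  have h2' : 1 - |s2| ≠ 0 := by have := abs_lt.2 h2; intro h; linarith
  obtain ⟨x, y, z⟩ := h (a * (1 - |s1|)) (b * (1 - |s2|)) (a * s1 + b * s2 + c) (by rw [← e]; module)
  have ea := (mul_eq_zero.1 x).resolve_right h1'
  have eb := (mul_eq_zero.1 y).resolve_right h2'
  exact ⟨ea, eb, by simpa [ea, eb] using z⟩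

noncomputable def ff (K : Set V) (p1 p2 p3 : V) : ℂ × ℝ :=
  (⟨G K p1 p3 p2, G K p2 p3 p1⟩, G2 K p1 p2)

noncomputable def P1v (e1 e2 e3 : V) (τ σ : ℝ) : V := (1 - |σ|) • (e1 + τ • e2) + σ • e3
noncomputable def P2v (e1 e2 e3 : V) (τ σ : ℝ) : V := (1 - |σ|) • (τ • e1 + e2) + σ • e3

noncomputable def F (K : Set V) (e1 e2 e3 : V) (τ σ1 σ2 : ℝ) : ℂ × ℝ :=
  ff K (P1v e1 e2 e3 τ σ1) (P2v e1 e2 e3 τ σ2) e3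

theorem Ps_uniq {K : Set V} (hK : Body K) {e1 e2 e3 : V} (h : LI e1 e2 e3) {τ τ' : ℝ}
    (ht : τ ∈ Set.Ioo (-1:ℝ) 1) (ht' : τ' ∈ Set.Ioo (-1:ℝ) 1) (e : Ps K e1 e2 e3 τ = 0)
    (e' : Ps K e1 e2 e3 τ' = 0) : τ = τ' :=
  Fam_t.uniq (hK.comap (T3 e1 e2 e3 : V →ₗ[ℝ] V) h.inj) ht ht' e e'

theorem S2_uniq {K : Set V} (hK : Body K) {e1 e2 : V} (h : LI2 e1 e2) {τ τ' : ℝ}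
    (ht : τ ∈ Set.Ioo (-1:ℝ) 1) (ht' : τ' ∈ Set.Ioo (-1:ℝ) 1) (e : S2 K e1 e2 τ = 0)
    (e' : S2 K e1 e2 τ' = 0) : τ = τ' :=
  Fam_s.uniq (hK.comap (T2 e1 e2 : V2 →ₗ[ℝ] V) h.inj) ht ht' e e'

theorem Frm.scale {K : Set V} (hK : Body K) {e1 e2 e3 : V} {τ σ1 σ2 τ' σ1' σ2' c : ℝ} (hc : 0 < c) (d : Frm K e1 e2 e3 τ σ1 σ2)
    (d' : Frm K (c • e1) (c • e2) (c • e3) τ' σ1' σ2') :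
    F K (c • e1) (c • e2) (c • e3) τ' σ1' σ2' = F K e1 e2 e3 τ σ1 σ2 := by
  have hli := d.li.tau d.ht
  have et : τ' = τ := Ps_uniq hK d.li d'.ht d.ht (by rw [← Ps_scale K hc.ne']; exact d'.z) d.z
  subst et
  have v1 : c • e1 + τ' • c • e2 = c • (e1 + τ' • e2) := by module
  have v2 : τ' • c • e1 + c • e2 = c • (τ' • e1 + e2) := by module
  have z1 := d'.z1
  have z2 := d'.z2
  rw [v1, S2_scale K hc.ne'] at z1
  rw [v2, S2_scale K hc.ne'] at z2
  have es1 : σ1' = σ1 := S2_uniq hK hli.perm.perm.swap.two d'.hs1 d.hs1 z1 d.z1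
  have es2 : σ2' = σ2 := S2_uniq hK hli.perm.two d'.hs2 d.hs2 z2 d.z2
  subst es1 es2
  have w1 : P1v (c • e1) (c • e2) (c • e3) τ' σ1' = c • P1v e1 e2 e3 τ' σ1' := by unfold P1v; module
  have w2 : P2v (c • e1) (c • e2) (c • e3) τ' σ2' = c • P2v e1 e2 e3 τ' σ2' := by unfold P2v; module
  have hs : Real.sign (c * c) = 1 := Real.sign_of_pos (by positivity)
  unfold F ff
  rw [w1, w2, G_scale K hc.ne' hc.ne' hc.ne', G_scale K hc.ne' hc.ne' hc.ne', G2_scale K hc.ne' hc.ne', hs]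
  simp only [one_mul]

theorem Frm.k {K : Set V} (hK : Body K) {e1 e2 e3 : V} {τ σ1 σ2 τ' σ1' σ2' : ℝ} (d : Frm K e1 e2 e3 τ σ1 σ2)
    (d' : Frm K ((2:ℝ) • e2) ((-2:ℝ) • e1) ((2:ℝ) • e3) τ' σ1' σ2') :
    F K ((2:ℝ) • e2) ((-2:ℝ) • e1) ((2:ℝ) • e3) τ' σ1' σ2' = fk (F K e1 e2 e3 τ σ1 σ2) := by
  have hli := d.li.tau d.ht
  have et : -τ' = τ := Ps_uniq hK d.li ⟨by linarith [d'.ht.2], by linarith [d'.ht.1]⟩ d.ht (by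
    have := d'.z; rw [Ps_k] at this; linarith) d.z
  subst et
  have v1 : (2:ℝ) • e2 + τ' • (-2:ℝ) • e1 = (2:ℝ) • (-τ' • e1 + e2) := by module
  have v2 : τ' • (2:ℝ) • e2 + (-2:ℝ) • e1 = (-2:ℝ) • (e1 + -τ' • e2) := by module
  have z1 := d'.z1
  have z2 := d'.z2
  rw [v1, S2_scale K (by norm_num)] at z1
  rw [v2, S2_neg K (by norm_num) (by norm_num)] at z2
  have es1 : σ1' = σ2 := S2_uniq hK hli.perm.two d'.hs1 d.hs2 z1 d.z2
  have es2 : -σ2' = σ1 := S2_uniq hK hli.perm.perm.swap.two ⟨by linarith [d'.hs2.2], by linarith [d'.hs2.1]⟩ d.hs1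
    (by linarith) d.z1
  subst es1 es2
  have w1 : P1v ((2:ℝ) • e2) ((-2:ℝ) • e1) ((2:ℝ) • e3) τ' σ1' = (2:ℝ) • P2v e1 e2 e3 (-τ') σ1' := by
    unfold P1v P2v; module
  have w2 : P2v ((2:ℝ) • e2) ((-2:ℝ) • e1) ((2:ℝ) • e3) τ' σ2' = (-2:ℝ) • P1v e1 e2 e3 (-τ') (-σ2') := by
    unfold P1v P2v; rw [abs_neg]; module
  have hs : Real.sign (2 * 2) = 1 := Real.sign_of_pos (by positivity)
  have hs2 : Real.sign (-2 * 2) = -1 := Real.sign_of_neg (by norm_num)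
  have hs3 : Real.sign (2 * -2) = -1 := Real.sign_of_neg (by norm_num)
  unfold F ff
  rw [w1, w2, G_scale K (by norm_num) (by norm_num) (by norm_num), G_scale K (by norm_num) (by norm_num) (by norm_num),
    G2_scale K (by norm_num) (by norm_num), hs, hs2, hs3, G2_symm]
  unfold fk
  refine Prod.ext (Complex.ext ?_ ?_) ?_ <;> simp

theorem Frm.i {K : Set V} (hK : Body K) {e1 e2 e3 : V} {τ σ1 σ2 τ' σ1' σ2' : ℝ} (d : Frm K e1 e2 e3 τ σ1 σ2)
    (d' : Frm K ((2:ℝ) • e2) ((2:ℝ) • e1) ((-2:ℝ) • e3) τ' σ1' σ2') :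
    F K ((2:ℝ) • e2) ((2:ℝ) • e1) ((-2:ℝ) • e3) τ' σ1' σ2' = fi (F K e1 e2 e3 τ σ1 σ2) := by
  have hli := d.li.tau d.ht
  have et : τ' = τ := Ps_uniq hK d.li d'.ht d.ht (by rw [← Ps_i]; exact d'.z) d.z
  subst et
  have v1 : (2:ℝ) • e2 + τ' • (2:ℝ) • e1 = (2:ℝ) • (τ' • e1 + e2) := by module
  have v2 : τ' • (2:ℝ) • e2 + (2:ℝ) • e1 = (2:ℝ) • (e1 + τ' • e2) := by module
  have z1 := d'.z1
  have z2 := d'.z2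
  rw [v1, S2_neg K (by norm_num) (by norm_num)] at z1
  rw [v2, S2_neg K (by norm_num) (by norm_num)] at z2
  have es1 : -σ1' = σ2 := S2_uniq hK hli.perm.two ⟨by linarith [d'.hs1.2], by linarith [d'.hs1.1]⟩ d.hs2
    (by linarith) d.z2
  have es2 : -σ2' = σ1 := S2_uniq hK hli.perm.perm.swap.two ⟨by linarith [d'.hs2.2], by linarith [d'.hs2.1]⟩ d.hs1
    (by linarith) d.z1
  subst es1 es2
  have w1 : P1v ((2:ℝ) • e2) ((2:ℝ) • e1) ((-2:ℝ) • e3) τ' σ1' = (2:ℝ) • P2v e1 e2 e3 τ' (-σ1') := by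
    unfold P1v P2v; rw [abs_neg]; module
  have w2 : P2v ((2:ℝ) • e2) ((2:ℝ) • e1) ((-2:ℝ) • e3) τ' σ2' = (2:ℝ) • P1v e1 e2 e3 τ' (-σ2') := by
    unfold P1v P2v; rw [abs_neg]; module
  have hs : Real.sign (2 * 2) = 1 := Real.sign_of_pos (by positivity)
  have hs3 : Real.sign (2 * -2) = -1 := Real.sign_of_neg (by norm_num)
  unfold F ff
  rw [w1, w2, G_scale K (by norm_num) (by norm_num) (by norm_num), G_scale K (by norm_num) (by norm_num) (by norm_num),
    G2_scale K (by norm_num) (by norm_num), hs, hs3, G2_symm]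
  unfold fi
  refine Prod.ext (Complex.ext ?_ ?_) ?_ <;> simp

/-! the frame -/
def E1 (q : Q4) : V := (q.1^2+q.2.1^2-q.2.2.1^2-q.2.2.2^2, 2*(q.2.1*q.2.2.1+q.1*q.2.2.2), 2*(q.2.1*q.2.2.2-q.1*q.2.2.1))
def E2 (q : Q4) : V := (2*(q.2.1*q.2.2.1-q.1*q.2.2.2), q.1^2-q.2.1^2+q.2.2.1^2-q.2.2.2^2, 2*(q.2.2.1*q.2.2.2+q.1*q.2.1))
def E3 (q : Q4) : V := (2*(q.2.1*q.2.2.2+q.1*q.2.2.1), 2*(q.2.2.1*q.2.2.2-q.1*q.2.1), q.1^2-q.2.1^2-q.2.2.1^2+q.2.2.2^2)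

theorem E1_k (q : Q4) : E1 (kap q) = (2:ℝ) • E2 q := by ext <;> simp [E1, E2, kap] <;> ring
theorem E2_k (q : Q4) : E2 (kap q) = (-2:ℝ) • E1 q := by ext <;> simp [E1, E2, kap] <;> ring
theorem E3_k (q : Q4) : E3 (kap q) = (2:ℝ) • E3 q := by ext <;> simp [E3, kap] <;> ring
theorem E1_i (q : Q4) : E1 (iot q) = (2:ℝ) • E2 q := by ext <;> simp [E1, E2, iot] <;> ring
theorem E2_i (q : Q4) : E2 (iot q) = (2:ℝ) • E1 q := by ext <;> simp [E1, E2, iot] <;> ring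
theorem E3_i (q : Q4) : E3 (iot q) = (-2:ℝ) • E3 q := by ext <;> simp [E3, iot] <;> ring
theorem E1_c (c : ℝ) (q : Q4) : E1 (c • q) = (c^2) • E1 q := by ext <;> simp [E1] <;> ring
theorem E2_c (c : ℝ) (q : Q4) : E2 (c • q) = (c^2) • E2 q := by ext <;> simp [E2] <;> ring
theorem E3_c (c : ℝ) (q : Q4) : E3 (c • q) = (c^2) • E3 q := by ext <;> simp [E3] <;> ring

theorem E_li {q : Q4} (hq : q ≠ 0) : LI (E1 q) (E2 q) (E3 q) := by
  obtain ⟨a, b, c, d⟩ := q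
  have hN : 0 < a^2+b^2+c^2+d^2 := by
    by_contra hcon
    push Not at hcon
    apply hq
    have ha : a = 0 := by nlinarith [sq_nonneg a, sq_nonneg b, sq_nonneg c, sq_nonneg d]
    have hb : b = 0 := by nlinarith [sq_nonneg a, sq_nonneg b, sq_nonneg c, sq_nonneg d]
    have hc : c = 0 := by nlinarith [sq_nonneg a, sq_nonneg b, sq_nonneg c, sq_nonneg d]
    have hd : d = 0 := by nlinarith [sq_nonneg a, sq_nonneg b, sq_nonneg c, sq_nonneg d]
    simp [ha, hb, hc, hd]
  intro x y z e
  have h1 := congrArg (fun v : V => v.1) e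
  have h2 := congrArg (fun v : V => v.2.1) e
  have h3 := congrArg (fun v : V => v.2.2) e
  simp [E1, E2, E3] at h1 h2 h3
  have hN2 : (a^2+b^2+c^2+d^2)^2 ≠ 0 := by positivity
  refine ⟨?_, ?_, ?_⟩
  · have : (a^2+b^2+c^2+d^2)^2 * x = 0 := by
      linear_combination (a^2+b^2-c^2-d^2) * h1 + (2*(b*c+a*d)) * h2 + 2*(b*d-a*c) * h3
    exact (mul_eq_zero.1 this).resolve_left hN2
  · have : (a^2+b^2+c^2+d^2)^2 * y = 0 := by
      linear_combination (2*(b*c-a*d)) * h1 + (a^2-b^2+c^2-d^2) * h2 + 2*(c*d+a*b) * h3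
    exact (mul_eq_zero.1 this).resolve_left hN2
  · have : (a^2+b^2+c^2+d^2)^2 * z = 0 := by
      linear_combination (2*(b*d+a*c)) * h1 + (2*(c*d-a*b)) * h2 + (a^2-b^2-c^2+d^2) * h3
    exact (mul_eq_zero.1 this).resolve_left hN2

theorem G_cont {X : Type} [TopologicalSpace X] [FirstCountableTopology X] {K : Set V} (hK : Body K)
    {p1 p2 p3 : X → V} (h1 : Continuous p1) (h2 : Continuous p2) (h3 : Continuous p3)
    (li : ∀ x, LI (p1 x) (p2 x) (p3 x)) : Continuous fun x => G K (p1 x) (p2 x) (p3 x) := by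
  refine J_cont hK (L := fun x => T3 (p1 x) (p2 x) (p3 x)) (A := fun _ y => y.1 * y.2.1) ?_ (fun x => (li x).inj)
    (fun y => continuous_const) (fun x => by fun_prop) (fun x => ?_)
  · intro y; simp only [T3_apply]; fun_prop
  · exact null_mul f1 f2 (y := (1,0,0)) (z := (0,1,0)) (by simp [f1]) (by simp [f2])

theorem G2_cont {X : Type} [TopologicalSpace X] [FirstCountableTopology X] {K : Set V} (hK : Body K)
    {p1 p2 : X → V} (h1 : Continuous p1) (h2 : Continuous p2)
    (li : ∀ x, LI2 (p1 x) (p2 x)) : Continuous fun x => G2 K (p1 x) (p2 x) := by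
  refine J_cont hK (L := fun x => T2 (p1 x) (p2 x)) (A := fun _ y => y.1 * y.2) ?_ (fun x => (li x).inj)
    (fun y => continuous_const) (fun x => by fun_prop) (fun x => ?_)
  · intro y; simp only [T2_apply]; fun_prop
  · exact null_mul (LinearMap.fst ℝ ℝ ℝ) (LinearMap.snd ℝ ℝ ℝ) (y := (1,0)) (z := (0,1)) (by simp) (by simp)

theorem exists_frame {K : Set V} (hK : Body K) : ∃ p1 p2 p3 : V, LI p1 p2 p3 ∧ G K p1 p2 p3 = 0 ∧
    G K p2 p3 p1 = 0 ∧ G K p3 p1 p2 = 0 ∧ G2 K p1 p2 = 0 ∧ G2 K p2 p3 = 0 ∧ G2 K p3 p1 = 0 := by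
  let X := {q : Q4 // q ≠ 0}
  have c1 : Continuous fun x : X => E1 x.1 := by unfold E1; fun_prop
  have c2 : Continuous fun x : X => E2 x.1 := by unfold E2; fun_prop
  have c3 : Continuous fun x : X => E3 x.1 := by unfold E3; fun_prop
  obtain ⟨τ, ct, ht⟩ := Fam_t.root hK (L := fun x : X => T3 (E1 x.1) (E2 x.1) (E3 x.1))
    (by intro y; simp only [T3_apply]; fun_prop) (fun x => (E_li x.2).inj)
  have hli : ∀ x : X, LI (E1 x.1 + τ x • E2 x.1) (τ x • E1 x.1 + E2 x.1) (E3 x.1) := fun x =>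
    (E_li x.2).tau (ht x).1
  obtain ⟨σ1, cs1, hs1⟩ := Fam_s.root hK (L := fun x : X => T2 (E1 x.1 + τ x • E2 x.1) (E3 x.1))
    (by intro y; simp only [T2_apply]; fun_prop) (fun x => (hli x).perm.perm.swap.two.inj)
  obtain ⟨σ2, cs2, hs2⟩ := Fam_s.root hK (L := fun x : X => T2 (τ x • E1 x.1 + E2 x.1) (E3 x.1))
    (by intro y; simp only [T2_apply]; fun_prop) (fun x => (hli x).perm.two.inj)
  have dat : ∀ x : X, Frm K (E1 x.1) (E2 x.1) (E3 x.1) (τ x) (σ1 x) (σ2 x) := fun x =>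
    ⟨E_li x.2, (ht x).1, (hs1 x).1, (hs2 x).1, (ht x).2, (hs1 x).2, (hs2 x).2⟩
  have hli2 : ∀ x : X, LI (P1v (E1 x.1) (E2 x.1) (E3 x.1) (τ x) (σ1 x)) (P2v (E1 x.1) (E2 x.1) (E3 x.1) (τ x) (σ2 x))
    (E3 x.1) := fun x => (hli x).sig (hs1 x).1 (hs2 x).1
  have cp1 : Continuous fun x : X => P1v (E1 x.1) (E2 x.1) (E3 x.1) (τ x) (σ1 x) := by unfold P1v; fun_prop
  have cp2 : Continuous fun x : X => P2v (E1 x.1) (E2 x.1) (E3 x.1) (τ x) (σ2 x) := by unfold P2v; fun_prop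
  let φ : X → ℂ × ℝ := fun x => F K (E1 x.1) (E2 x.1) (E3 x.1) (τ x) (σ1 x) (σ2 x)
  have cφ : Continuous φ := by
    have g1 := G_cont hK cp1 c3 cp2 (fun x => (hli2 x).perm.perm.swap)
    have g2 := G_cont hK cp2 c3 cp1 (fun x => (hli2 x).perm)
    have g3 := G2_cont hK cp1 cp2 (fun x => (hli2 x).two)
    have g4 := Complex.continuous_ofReal.comp g1
    have g5 := (Complex.continuous_ofReal.comp g2).mul (continuous_const (y := Complex.I))
    have := (g4.add g5).prodMk g3
    convert this using 2 with x
    refine Prod.ext ?_ rfl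
    exact Complex.mk_eq_add_mul_I _ _
  let f : Q4 → ℂ × ℝ := fun q => if hq : q ≠ 0 then φ ⟨q, hq⟩ else 0
  have fe : ∀ q (hq : q ≠ 0), f q = φ ⟨q, hq⟩ := fun q hq => dif_pos hq
  have key : ∃ q, q ≠ 0 ∧ f q = 0 := by
    refine topo ?_ ?_ ?_ ?_
    · rw [continuousOn_iff_continuous_domRestrict]
      have : Set.domRestrict ({0}ᶜ : Set Q4) f = φ := by
        funext x
        exact fe x.1 x.2
      rw [this]; exact cφ
    · intro c hc q hq
      have hcq : c • q ≠ 0 := smul_ne_zero hc.ne' hq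
      rw [fe _ hcq, fe _ hq]
      have d' := dat ⟨c • q, hcq⟩
      simp only [φ]
      simp only [E1_c, E2_c, E3_c] at d' ⊢
      exact Frm.scale hK (by positivity) (dat ⟨q, hq⟩) d'
    · intro q hq
      rw [fe _ (kap_ne hq), fe _ hq]
      have d' := dat ⟨kap q, kap_ne hq⟩
      simp only [φ]
      simp only [E1_k, E2_k, E3_k] at d' ⊢
      exact Frm.k hK (dat ⟨q, hq⟩) d'
    · intro q hq
      rw [fe _ (iot_ne hq), fe _ hq]
      have d' := dat ⟨iot q, iot_ne hq⟩
      simp only [φ]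
      simp only [E1_i, E2_i, E3_i] at d' ⊢
      exact Frm.i hK (dat ⟨q, hq⟩) d'
  obtain ⟨q, hq, hz⟩ := key
  rw [fe q hq] at hz
  have d := dat ⟨q, hq⟩
  have l2 := hli2 ⟨q, hq⟩
  simp only [φ, F, ff, Prod.mk_eq_zero, Complex.ext_iff, Complex.zero_re, Complex.zero_im] at hz
  obtain ⟨⟨h1, h2⟩, h3⟩ := hz
  refine ⟨_, _, _, l2, ?_, h2, ?_, h3, ?_, ?_⟩
  · have a1 : 1 - |σ1 ⟨q, hq⟩| ≠ 0 := by have := abs_lt.2 d.hs1; intro h; linarith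
    have a2 : 1 - |σ2 ⟨q, hq⟩| ≠ 0 := by have := abs_lt.2 d.hs2; intro h; linarith
    have := G_law K (σ1 ⟨q, hq⟩) (σ2 ⟨q, hq⟩) a1 a2 one_ne_zero (E1 q + τ ⟨q, hq⟩ • E2 q) (τ ⟨q, hq⟩ • E1 q + E2 q) (E3 q)
    rw [G_Ps K d.ht, d.z, mul_zero, one_smul] at this
    exact this
  · rw [G_symm]; exact h1
  · have := G2_S2 K d.hs2 (τ ⟨q, hq⟩ • E1 q + E2 q) (E3 q)
    rw [d.z2] at this; exact this
  · rw [G2_symm]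
    have := G2_S2 K d.hs1 (E1 q + τ ⟨q, hq⟩ • E2 q) (E3 q)
    rw [d.z1] at this; exact this

end Mahler

end

section
open MeasureTheory
open scoped RealInnerProductSpace
set_option linter.all false
namespace Mahler

theorem exists_scale {K : Set V} (h : Body K) {p : V} (hp : p ≠ 0) :
    ∃ r : ℝ, 0 < r ∧ r • p ∈ K ∧ ∀ t, r < t → t • p ∉ K := by
  have hb := h.comap (LinearMap.toSpanSingleton ℝ V p) (by
    rw [injective_iff_map_eq_zero]; intro a ha
    simpa [hp] using ha)
  obtain ⟨r, hr⟩ := hb.compact.exists_isGreatest ⟨0, hb.zero_mem⟩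
  have hmem : ∀ t : ℝ, t ∈ (LinearMap.toSpanSingleton ℝ V p) ⁻¹' K ↔ t • p ∈ K := fun t => by simp
  refine ⟨r, ?_, (hmem r).1 hr.1, fun t ht hk => absurd (hr.2 ((hmem t).2 hk)) (not_le.2 ht)⟩
  have h0 := mem_interior_iff_mem_nhds.1 hb.zero
  rw [Metric.mem_nhds_iff] at h0
  obtain ⟨ε, he, hs⟩ := h0
  have : ε / 2 ≤ r := hr.2 (hs (by simp [abs_of_pos he]; linarith))
  linarith

theorem J_odd {W : Type} [NormedAddCommGroup W] [NormedSpace ℝ W] [FiniteDimensional ℝ W]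
    [MeasureSpace W] [BorelSpace W] [(volume : Measure W).IsAddHaarMeasure] {C : Set W} (h : Body C)
    {A : W → ℝ} (hA : ∀ y, A (-y) = - A y) : J C A = 0 := by
  have h1 := J_comp (LinearEquiv.neg ℝ) C A
  have e : (LinearEquiv.neg ℝ : W ≃ₗ[ℝ] W) ⁻¹' C = C := by
    ext y
    simp only [Set.mem_preimage, LinearEquiv.neg_apply]
    exact ⟨fun k => by simpa using h.symm _ k, fun k => h.symm _ k⟩
  rw [e] at h1
  simp only [LinearEquiv.neg_apply, hA, J_neg] at h1
  linarith

theorem I_zero {W : Type} [NormedAddCommGroup W] [NormedSpace ℝ W] [FiniteDimensional ℝ W]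
    [MeasureSpace W] [BorelSpace W] [(volume : Measure W).IsAddHaarMeasure] {C : Set W} (h : Body C)
    {A : W → ℝ} (hA : J C A = 0) : ∫ y in C, Real.sign (A y) = 0 := by
  unfold J at hA
  rcases div_eq_zero_iff.1 hA with k | k
  · exact k
  · exact absurd k h.pos.ne'

theorem ind_eq {W : Type} [MeasureSpace W] {C S : Set W} (hS : MeasurableSet S) :
    volume.real (C ∩ S) = ∫ y in C, S.indicator (fun _ => (1:ℝ)) y := by
  have := integral_indicator_one (μ := volume.restrict C) hS
  rw [measureReal_restrict_apply hS, Set.inter_comm] at this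
  exact this.symm

theorem sg_ind (a : Bool) {x : ℝ} (hx : x ≠ 0) :
    (1 + sg a * Real.sign x) / 2 = if 0 < sg a * x then 1 else 0 := by
  rcases lt_or_gt_of_ne hx with h | h
  · rw [Real.sign_of_neg h]; cases a
    · simp [h]
    · simp [h.le]
  · rw [Real.sign_of_pos h]; cases a
    · simp [h.le]
    · simp [h]

def HI {W : Type} [MeasureSpace W] (C : Set W) (f : W → ℝ) (v : ℝ) : Prop := IntegrableOn f C ∧ ∫ y in C, f y = v

theorem HI.add {W : Type} [MeasureSpace W] {C : Set W} {f g : W → ℝ} {v w : ℝ} (h : HI C f v) (k : HI C g w) :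
    HI C (fun y => f y + g y) (v + w) := ⟨h.1.add k.1, by rw [integral_add h.1 k.1, h.2, k.2]⟩
theorem HI.mul {W : Type} [MeasureSpace W] {C : Set W} {f : W → ℝ} {v : ℝ} (h : HI C f v) (c : ℝ) :
    HI C (fun y => c * f y) (c * v) := ⟨h.1.const_mul c, by rw [integral_const_mul, h.2]⟩

theorem quad_of {C : Set V2} (h : Body C) (hJ : J C (fun y => y.1 * y.2) = 0) (a b : Bool) :
    volume.real (C ∩ {x | 0 < sg a * x.1 ∧ 0 < sg b * x.2}) = volume.real C / 4 := by
  rw [ind_eq (quad_meas _ _)]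
  have n1 : ∀ᵐ y : V2, y.1 ≠ 0 := by
    have := null_lin (W := V2) (LinearMap.fst ℝ ℝ ℝ) (y := (1, 0)) (by simp)
    rw [ae_iff]; simpa using this
  have n2 : ∀ᵐ y : V2, y.2 ≠ 0 := by
    have := null_lin (W := V2) (LinearMap.snd ℝ ℝ ℝ) (y := (0, 1)) (by simp)
    rw [ae_iff]; simpa using this
  have i1 := sign_int h (A := fun y : V2 => y.1) (by fun_prop)
  have i2 := sign_int h (A := fun y : V2 => y.2) (by fun_prop)
  have i12 := sign_int h (A := fun y : V2 => y.1 * y.2) (by fun_prop)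
  have z1 := I_zero h (J_odd h (A := fun y : V2 => y.1) (fun y => rfl))
  have z2 := I_zero h (J_odd h (A := fun y : V2 => y.2) (fun y => rfl))
  have z12 := I_zero h hJ
  have i0 : IntegrableOn (fun _ : V2 => (1:ℝ)) C := integrableOn_const h.ne_top
  have key : ∫ y in C, {x : V2 | 0 < sg a * x.1 ∧ 0 < sg b * x.2}.indicator (fun _ => (1:ℝ)) y
     = ∫ y in C, (1/4) * (((1:ℝ) + sg a * Real.sign y.1) + (sg b * Real.sign y.2 + sg a * sg b * Real.sign (y.1 * y.2))) := by
    refine integral_congr_ae (ae_restrict_of_ae ?_)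
    filter_upwards [n1, n2] with y h1 h2
    have e : (1/4:ℝ) * (((1:ℝ) + sg a * Real.sign y.1) + (sg b * Real.sign y.2 + sg a * sg b * Real.sign (y.1 * y.2)))
      = (1 + sg a * Real.sign y.1) / 2 * ((1 + sg b * Real.sign y.2) / 2) := by rw [sign_mul']; ring
    rw [e, sg_ind a h1, sg_ind b h2, Set.indicator_apply]
    simp only [Set.mem_setOf_eq]; split_ifs <;> simp_all
  have i0' : HI C (fun _ : V2 => (1:ℝ)) (volume.real C) := ⟨i0, by simp⟩
  have := (((i0'.add (HI.mul ⟨i1, z1⟩ (sg a))).add ((HI.mul ⟨i2, z2⟩ (sg b)).add (HI.mul ⟨i12, z12⟩ (sg a * sg b)))).mul (1/4)).2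
  rw [key, this]
  ring

theorem oct_of {C : Set V} (h : Body C) (h12 : J C (fun y => y.1 * y.2.1) = 0)
    (h23 : J C (fun y => y.2.1 * y.2.2) = 0) (h13 : J C (fun y => y.1 * y.2.2) = 0) (a b c : Bool) :
    volume.real (C ∩ {x | 0 < sg a * x.1 ∧ 0 < sg b * x.2.1 ∧ 0 < sg c * x.2.2}) = volume.real C / 8 := by
  rw [ind_eq (oct_meas _ _ _)]
  have n1 : ∀ᵐ y : V, y.1 ≠ 0 := by
    have := null_lin (W := V) f1 (y := (1, 0, 0)) (by simp [f1])
    rw [ae_iff]; simpa [f1] using this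
  have n2 : ∀ᵐ y : V, y.2.1 ≠ 0 := by
    have := null_lin (W := V) f2 (y := (0, 1, 0)) (by simp [f2])
    rw [ae_iff]; simpa [f2] using this
  have n3 : ∀ᵐ y : V, y.2.2 ≠ 0 := by
    have := null_lin (W := V) f3 (y := (0, 0, 1)) (by simp [f3])
    rw [ae_iff]; simpa [f3] using this
  have i1 := sign_int h (A := fun y : V => y.1) (by fun_prop)
  have i2 := sign_int h (A := fun y : V => y.2.1) (by fun_prop)
  have i3 := sign_int h (A := fun y : V => y.2.2) (by fun_prop)
  have i12 := sign_int h (A := fun y : V => y.1 * y.2.1) (by fun_prop)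
  have i23 := sign_int h (A := fun y : V => y.2.1 * y.2.2) (by fun_prop)
  have i13 := sign_int h (A := fun y : V => y.1 * y.2.2) (by fun_prop)
  have i123 := sign_int h (A := fun y : V => y.1 * y.2.1 * y.2.2) (by fun_prop)
  have z1 := I_zero h (J_odd h (A := fun y : V => y.1) (fun y => rfl))
  have z2 := I_zero h (J_odd h (A := fun y : V => y.2.1) (fun y => rfl))
  have z3 := I_zero h (J_odd h (A := fun y : V => y.2.2) (fun y => rfl))
  have z123 := I_zero h (J_odd h (A := fun y : V => y.1 * y.2.1 * y.2.2) (fun y => by simp))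
  have z12 := I_zero h h12
  have z23 := I_zero h h23
  have z13 := I_zero h h13
  have i0 : IntegrableOn (fun _ : V => (1:ℝ)) C := integrableOn_const h.ne_top
  have key : ∫ y in C, {x : V | 0 < sg a * x.1 ∧ 0 < sg b * x.2.1 ∧ 0 < sg c * x.2.2}.indicator (fun _ => (1:ℝ)) y
     = ∫ y in C, (1/8) * ((((1:ℝ) + sg a * Real.sign y.1) + (sg b * Real.sign y.2.1 + sg c * Real.sign y.2.2)) +
        ((sg a * sg b * Real.sign (y.1 * y.2.1) + sg b * sg c * Real.sign (y.2.1 * y.2.2)) +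
          (sg a * sg c * Real.sign (y.1 * y.2.2) + sg a * sg b * sg c * Real.sign (y.1 * y.2.1 * y.2.2)))) := by
    refine integral_congr_ae (ae_restrict_of_ae ?_)
    filter_upwards [n1, n2, n3] with y h1 h2 h3
    have e : (1/8:ℝ) * ((((1:ℝ) + sg a * Real.sign y.1) + (sg b * Real.sign y.2.1 + sg c * Real.sign y.2.2)) +
        ((sg a * sg b * Real.sign (y.1 * y.2.1) + sg b * sg c * Real.sign (y.2.1 * y.2.2)) +
          (sg a * sg c * Real.sign (y.1 * y.2.2) + sg a * sg b * sg c * Real.sign (y.1 * y.2.1 * y.2.2))))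
      = (1 + sg a * Real.sign y.1) / 2 * ((1 + sg b * Real.sign y.2.1) / 2 * ((1 + sg c * Real.sign y.2.2) / 2)) := by
      rw [sign_mul' (y.1 * y.2.1), sign_mul', sign_mul', sign_mul']; ring
    rw [e, sg_ind a h1, sg_ind b h2, sg_ind c h3, Set.indicator_apply]
    simp only [Set.mem_setOf_eq]; split_ifs <;> simp_all
  have i0' : HI C (fun _ : V => (1:ℝ)) (volume.real C) := ⟨i0, by simp⟩
  have := ((((i0'.add (HI.mul ⟨i1, z1⟩ (sg a))).add ((HI.mul ⟨i2, z2⟩ (sg b)).add (HI.mul ⟨i3, z3⟩ (sg c)))).add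
    (((HI.mul ⟨i12, z12⟩ (sg a * sg b)).add (HI.mul ⟨i23, z23⟩ (sg b * sg c))).add
      ((HI.mul ⟨i13, z13⟩ (sg a * sg c)).add (HI.mul ⟨i123, z123⟩ (sg a * sg b * sg c))))).mul (1/8)).2
  rw [key, this]
  ring

theorem not_int {C : Set V2} {p : V2} (hn : ∀ t : ℝ, 1 < t → t • p ∉ C) : p ∉ interior C := by
  intro hi
  have ho : IsOpen ((fun t : ℝ => t • p) ⁻¹' interior C) := isOpen_interior.preimage (by fun_prop)
  have h1 : (1:ℝ) ∈ ((fun t : ℝ => t • p) ⁻¹' interior C) := by simpa using hi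
  obtain ⟨ε, he, hs⟩ := Metric.isOpen_iff.1 ho 1 h1
  have : (1 + ε / 2 : ℝ) ∈ Metric.ball (1:ℝ) ε := by
    rw [Metric.mem_ball, Real.dist_eq, abs_lt]; constructor <;> linarith
  exact hn (1 + ε / 2) (by linarith) (interior_subset (hs this))

theorem equi2_of {C : Set V2} (h : Body C) (hJ : J C (fun y => y.1 * y.2) = 0) (e1 : ((1:ℝ), (0:ℝ)) ∈ C)
    (e2 : ((0:ℝ), (1:ℝ)) ∈ C) (n1 : ∀ t : ℝ, 1 < t → (t, (0:ℝ)) ∉ C) (n2 : ∀ t : ℝ, 1 < t → ((0:ℝ), t) ∉ C) :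
    Equi2 C where
  body := h
  quad := quad_of h hJ
  e1 := e1
  e2 := e2
  y1 := by
    obtain ⟨y, hy, hd⟩ := exists_support h (not_int (p := (1, 0)) (fun t ht => by simpa using n1 t ht)) e1
    exact ⟨y, hy, by simpa [dot2] using hd⟩
  y2 := by
    obtain ⟨y, hy, hd⟩ := exists_support h (not_int (p := (0, 1)) (fun t ht => by simpa using n2 t ht)) e2
    exact ⟨y, hy, by simpa [dot2] using hd⟩

theorem G_cyc (K : Set V) (p1 p2 p3 : V) :
    J (T3 p1 p2 p3 ⁻¹' K) (fun y => y.2.1 * y.2.2) = G K p2 p3 p1 := by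
  rw [← one_mul (G K p2 p3 p1)]
  refine J_eqv_s (m3 0 1 0 0 0 1 1 0 0) ?_ _ ?_ ?_
  · intro y hy
    simp only [m3_apply, Prod.mk_eq_zero] at hy
    obtain ⟨h1, h2, h3⟩ := hy
    refine Prod.ext (by simpa using h3) (Prod.ext (by simpa using h1) (by simpa using h2))
  · intro y; simp only [T3_apply, m3_apply]; simp; abel
  · intro y; simp only [m3_apply]; simp

theorem G_cyc' (K : Set V) (p1 p2 p3 : V) :
    J (T3 p1 p2 p3 ⁻¹' K) (fun y => y.1 * y.2.2) = G K p3 p1 p2 := by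
  rw [← one_mul (G K p3 p1 p2)]
  refine J_eqv_s (m3 0 0 1 1 0 0 0 1 0) ?_ _ ?_ ?_
  · intro y hy
    simp only [m3_apply, Prod.mk_eq_zero] at hy
    obtain ⟨h1, h2, h3⟩ := hy
    refine Prod.ext (by simpa using h2) (Prod.ext (by simpa using h3) (by simpa using h1))
  · intro y; simp only [T3_apply, m3_apply]; simp; abel
  · intro y; simp only [m3_apply]; simp [mul_comm]

theorem equip {K : Set V} (h : Body K) : ∃ e : V ≃ₗ[ℝ] V, Equi (e ⁻¹' K) := by
  obtain ⟨p1, p2, p3, li, g1, g2, g3, k1, k2, k3⟩ := exists_frame h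
  have z1 : p1 ≠ 0 := fun k => by simpa using (li 1 0 0 (by simp [k])).1
  have z2 : p2 ≠ 0 := fun k => by simpa using (li 0 1 0 (by simp [k])).2.1
  have z3 : p3 ≠ 0 := fun k => by simpa using (li 0 0 1 (by simp [k])).2.2
  obtain ⟨r1, s1, t1, u1⟩ := exists_scale h z1
  obtain ⟨r2, s2, t2, u2⟩ := exists_scale h z2
  obtain ⟨r3, s3, t3, u3⟩ := exists_scale h z3
  have li' : LI (r1 • p1) (r2 • p2) (r3 • p3) := by
    intro a b c hh
    simp only [smul_smul] at hh
    have := li _ _ _ hh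
    simpa [s1.ne', s2.ne', s3.ne'] using this
  have sc : ∀ {r : ℝ} {p : V}, 0 < r → (∀ t, r < t → t • p ∉ K) → ∀ t : ℝ, 1 < t → t • r • p ∉ K := by
    intro r p hr hu t ht
    rw [smul_smul]; exact hu _ (by nlinarith)
  have v1 := sc s1 u1
  have v2 := sc s2 u2
  have v3 := sc s3 u3
  have G1 := G_scale K s1.ne' s2.ne' s3.ne' p1 p2 p3
  have G2' := G_scale K s2.ne' s3.ne' s1.ne' p2 p3 p1
  have G3 := G_scale K s3.ne' s1.ne' s2.ne' p3 p1 p2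
  have K1 := G2_scale K s1.ne' s2.ne' p1 p2
  have K2 := G2_scale K s2.ne' s3.ne' p2 p3
  have K3 := G2_scale K s3.ne' s1.ne' p3 p1
  rw [g1, mul_zero] at G1
  rw [g2, mul_zero] at G2'
  rw [g3, mul_zero] at G3
  rw [k1, mul_zero] at K1
  rw [k2, mul_zero] at K2
  rw [k3, mul_zero] at K3
  generalize r1 • p1 = q1 at *
  generalize r2 • p2 = q2 at *
  generalize r3 • p3 = q3 at *
  have hinj : Function.Injective ((T3 q1 q2 q3 : V →L[ℝ] V) : V →ₗ[ℝ] V) := li'.inj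
  refine ⟨LinearEquiv.ofInjectiveEndo ((T3 q1 q2 q3 : V →L[ℝ] V) : V →ₗ[ℝ] V) hinj, ?_⟩
  have hb : Body (T3 q1 q2 q3 ⁻¹' K) := h.comap ((T3 q1 q2 q3 : V →L[ℝ] V) : V →ₗ[ℝ] V) hinj
  have he : (LinearEquiv.ofInjectiveEndo ((T3 q1 q2 q3 : V →L[ℝ] V) : V →ₗ[ℝ] V) hinj) ⁻¹' K = T3 q1 q2 q3 ⁻¹' K := by
    ext y; simp
  rw [he]
  have c1 : sec1 (T3 q1 q2 q3 ⁻¹' K) = T2 q2 q3 ⁻¹' K := by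
    ext y; rw [mem_sec1]; simp [T3_apply, T2_apply]
  have c2 : sec2 (T3 q1 q2 q3 ⁻¹' K) = T2 q3 q1 ⁻¹' K := by
    ext y; rw [mem_sec2]; simp [T3_apply, T2_apply, add_comm]
  have c3 : sec3 (T3 q1 q2 q3 ⁻¹' K) = T2 q1 q2 ⁻¹' K := by
    ext y; rw [mem_sec3]; simp [T3_apply, T2_apply]
  have mk : ∀ {a b : V}, LI2 a b → G2 K a b = 0 → a ∈ K → b ∈ K → (∀ t : ℝ, 1 < t → t • a ∉ K) →
      (∀ t : ℝ, 1 < t → t • b ∉ K) → Equi2 (T2 a b ⁻¹' K) := by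
    intro a b hl hg ha hb na nb
    refine equi2_of (h.comap ((T2 a b : V2 →L[ℝ] V) : V2 →ₗ[ℝ] V) hl.inj) hg ?_ ?_ ?_ ?_
    · simpa [T2_apply] using ha
    · simpa [T2_apply] using hb
    · intro t ht; simpa [T2_apply] using na t ht
    · intro t ht; simpa [T2_apply] using nb t ht
  refine ⟨hb, oct_of hb G1 ?_ ?_, ?_, ?_, ?_⟩
  · rw [G_cyc]; exact G2'
  · rw [G_cyc']; exact G3
  · rw [c1]; exact mk li'.perm.two K2 t2 t3 v2 v3
  · rw [c2]; exact mk li'.perm.perm.two K3 t3 t1 v3 v1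
  · rw [c3]; exact mk li'.two K1 t1 t2 v1 v2

end Mahler

end

section
open MeasureTheory
open scoped RealInnerProductSpace
set_option linter.all false
namespace Mahler

def Pi3 : (Fin 3 → ℝ) ≃ₗ[ℝ] V where
  toFun f := (f 0, f 1, f 2)
  invFun v := ![v.1, v.2.1, v.2.2]
  map_add' f g := rfl
  map_smul' c f := rfl
  left_inv f := by ext i; fin_cases i <;> rfl
  right_inv v := rfl

theorem Pi3_apply (f : Fin 3 → ℝ) : Pi3 f = (f 0, f 1, f 2) := rfl

theorem mp_Pi3 : MeasurePreserving Pi3 := by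
  have h1 := volume_preserving_piFinSuccAbove (fun _ : Fin 3 => ℝ) 0
  have h2 := volume_preserving_piFinTwo (fun _ : Fin 2 => ℝ)
  have h3 := ((MeasurePreserving.id (volume : Measure ℝ)).prod h2).comp h1
  exact h3

abbrev E3' := EuclideanSpace ℝ (Fin 3)

noncomputable def Th : E3' ≃ₗ[ℝ] V := (WithLp.linearEquiv 2 ℝ (Fin 3 → ℝ)).trans Pi3

theorem Th_apply (x : E3') : Th x = (x 0, x 1, x 2) := rfl

theorem mp_Th : MeasurePreserving Th := mp_Pi3.comp (PiLp.volume_preserving_ofLp (Fin 3))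

theorem Th_dot (x y : E3') : Dot.dot (Th x) (Th y) = ⟪x, y⟫ := by
  rw [dot3, Th_apply, Th_apply]
  simp [PiLp.inner_apply, Fin.sum_univ_three]
  ring

theorem Th_vol (S : Set V) : volume.real (Th ⁻¹' S) = volume.real S := by
  rw [measureReal_def, measureReal_def, mp_Th.measure_preimage_emb
    (Th.toContinuousLinearEquiv.toHomeomorph.measurableEmbedding) S]

theorem Pi3_vol (S : Set V) : volume.real (Pi3 ⁻¹' S) = volume.real S := by
  rw [measureReal_def, measureReal_def, mp_Pi3.measure_preimage_emb
    (Pi3.toContinuousLinearEquiv.toHomeomorph.measurableEmbedding) S]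

theorem Pi3_dot (f g : Fin 3 → ℝ) : Dot.dot (Pi3 f) (Pi3 g) = f ⬝ᵥ g := by
  rw [dot3, Pi3_apply, Pi3_apply]
  simp [dotProduct, Fin.sum_univ_three]
  ring

theorem exists_adj (e : V ≃ₗ[ℝ] V) : ∃ B : V ≃ₗ[ℝ] V, (∀ x y, Dot.dot (e x) (B y) = Dot.dot x y) ∧
    LinearMap.det (B : V →ₗ[ℝ] V) * LinearMap.det (e : V →ₗ[ℝ] V) = 1 := by
  let e' : (Fin 3 → ℝ) ≃ₗ[ℝ] (Fin 3 → ℝ) := (Pi3.trans e).trans Pi3.symm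
  let M := LinearMap.toMatrix' (e' : (Fin 3 → ℝ) →ₗ[ℝ] (Fin 3 → ℝ))
  have hdM : M.det = LinearMap.det (e : V →ₗ[ℝ] V) := by
    have := LinearMap.det_conj (e : V →ₗ[ℝ] V) Pi3.symm
    rw [← this, ← LinearMap.det_toMatrix']
    rfl
  have hd : LinearMap.det (e : V →ₗ[ℝ] V) ≠ 0 := (LinearEquiv.isUnit_det' e).ne_zero
  have hu : IsUnit M.det := by rw [hdM]; exact hd.isUnit
  let N := (M⁻¹).transpose
  have hN : N.det = (M.det)⁻¹ := by simp [N, Matrix.det_nonsing_inv]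
  let B0 : V →ₗ[ℝ] V := (Pi3 : (Fin 3 → ℝ) →ₗ[ℝ] V) ∘ₗ (Matrix.toLin' N) ∘ₗ (Pi3.symm : V →ₗ[ℝ] (Fin 3 → ℝ))
  have hdB : LinearMap.det B0 = N.det := by
    have := LinearMap.det_conj (Matrix.toLin' N) Pi3
    rw [LinearMap.det_toLin'] at this
    exact this
  have hdot : ∀ x y, Dot.dot (e x) (B0 y) = Dot.dot x y := by
    intro x y
    obtain ⟨f, rfl⟩ := Pi3.surjective x
    obtain ⟨g, rfl⟩ := Pi3.surjective y
    have h1 : e (Pi3 f) = Pi3 (M.mulVec f) := by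
      have : M.mulVec f = e' f := by
        rw [← Matrix.toLin'_apply, Matrix.toLin'_toMatrix']; rfl
      rw [this]; simp [e']
    have h2 : B0 (Pi3 g) = Pi3 (N.mulVec g) := by
      simp [B0]
    rw [h1, h2, Pi3_dot, Pi3_dot, Matrix.dotProduct_mulVec, Matrix.vecMul_transpose, Matrix.mulVec_mulVec,
      Matrix.nonsing_inv_mul _ hu, Matrix.one_mulVec]
  have hB : LinearMap.det B0 ≠ 0 := by rw [hdB, hN, hdM]; exact inv_ne_zero hd
  refine ⟨LinearEquiv.ofIsUnitDet (f := B0) (v := Module.finBasis ℝ V) (v' := Module.finBasis ℝ V) ?_, ?_, ?_⟩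
  · rw [LinearMap.det_toMatrix]; exact hB.isUnit
  · intro x y; exact hdot x y
  · have : ((LinearEquiv.ofIsUnitDet (f := B0) (v := Module.finBasis ℝ V) (v' := Module.finBasis ℝ V) 
      (by rw [LinearMap.det_toMatrix]; exact hB.isUnit) : V ≃ₗ[ℝ] V) : V →ₗ[ℝ] V) = B0 := rfl
    rw [this, hdB, hN, hdM, inv_mul_cancel₀ hd]

theorem vol_lin (e : V ≃ₗ[ℝ] V) (S : Set V) :
    volume.real (e ⁻¹' S) = |(LinearMap.det (e : V →ₗ[ℝ] V))⁻¹| * volume.real S := by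
  have hd : LinearMap.det (e : V →ₗ[ℝ] V) ≠ 0 := (LinearEquiv.isUnit_det' e).ne_zero
  have := Measure.addHaar_preimage_linearMap (volume : Measure V) hd S
  rw [measureReal_def, measureReal_def]
  have e1 : (e : V → V) ⁻¹' S = ((e : V →ₗ[ℝ] V) : V → V) ⁻¹' S := rfl
  rw [e1, this, ENNReal.toReal_mul, ENNReal.toReal_ofReal (abs_nonneg _)]

theorem vol_inv (e : V ≃ₗ[ℝ] V) (K : Set V) :
    volume.real (e ⁻¹' K) * volume.real (pol (e ⁻¹' K)) = volume.real K * volume.real (pol K) := by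
  obtain ⟨B, hB, hd⟩ := exists_adj e
  rw [pol_preimage e B hB, vol_lin, vol_lin]
  have : |(LinearMap.det (e : V →ₗ[ℝ] V))⁻¹| * |(LinearMap.det (B : V →ₗ[ℝ] V))⁻¹| = 1 := by
    rw [← abs_mul, ← mul_inv, mul_comm, hd]; simp
  linear_combination (volume.real K * volume.real (pol K)) * this

theorem vol_box : volume.real (box3 1 1 1) = 8 := by
  have : box3 1 1 1 = Set.Icc (-1:ℝ) 1 ×ˢ (Set.Icc (-1:ℝ) 1 ×ˢ Set.Icc (-1:ℝ) 1) := by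
    ext x; simp only [box3, abs_le, Set.mem_setOf_eq, Set.mem_prod, Set.mem_Icc]
  rw [this, measureReal_def, Measure.volume_eq_prod, Measure.prod_prod, Measure.volume_eq_prod, Measure.prod_prod]
  simp only [Real.volume_Icc, ENNReal.toReal_mul]
  rw [ENNReal.toReal_ofReal (by norm_num)]
  norm_num

theorem pol_box : pol (box3 1 1 1) = {y : V | |y.1| + |y.2.1| + |y.2.2| ≤ 1} := by
  ext y
  simp only [mem_pol, Set.mem_setOf_eq, dot3]
  constructor
  · intro h
    obtain ⟨a, ha⟩ := exists_sg y.1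
    obtain ⟨b, hb⟩ := exists_sg y.2.1
    obtain ⟨c, hc⟩ := exists_sg y.2.2
    have := h (sg a, sg b, sg c) (by simp [box3, abs_sg])
    simp only [ha, hb, hc] at this
    linarith
  · rintro h x ⟨h1, h2, h3⟩
    have k : ∀ a b : ℝ, |a| ≤ 1 → a * b ≤ |b| := fun a b h => by
      calc a * b ≤ |a * b| := le_abs_self _
        _ = |a| * |b| := abs_mul _ _
        _ ≤ 1 * |b| := by gcongr
        _ = |b| := one_mul _
    have := k _ y.1 h1
    have := k _ y.2.1 h2
    have := k _ y.2.2 h3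
    linarith

theorem vol_cross : volume.real {y : V | |y.1| + |y.2.1| + |y.2.2| ≤ 1} = 4 / 3 := by
  rw [← Pi3_vol]
  have h := MeasureTheory.volume_sum_rpow_le (Fin 3) (le_refl (1:ℝ)) 1
  have e : Pi3 ⁻¹' {y : V | |y.1| + |y.2.1| + |y.2.2| ≤ 1} =
      {x : Fin 3 → ℝ | (∑ i, |x i| ^ (1:ℝ)) ^ (1 / (1:ℝ)) ≤ 1} := by
    ext f; simp [Pi3_apply, Fin.sum_univ_three]
  rw [e, measureReal_def, h]
  have g2 : Real.Gamma (1 / 1 + 1) = 1 := by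
    norm_num
  have g4 : Real.Gamma (((Fintype.card (Fin 3) : ℕ) : ℝ) / 1 + 1) = 6 := by
    rw [div_one, Real.Gamma_nat_eq_factorial]; norm_num [Nat.factorial]
  rw [g2, g4]
  simp
  rw [ENNReal.toReal_ofReal (by norm_num)]
  norm_num

theorem Para.prod {K : Set V} (h : Para K) : volume.real K * volume.real (pol K) = 32 / 3 := by
  obtain ⟨e, rfl⟩ := h
  rw [vol_inv, pol_box, vol_box, vol_cross]; norm_num

theorem main_ge {K : Set V} (h : Body K) : 32 / 3 ≤ volume.real K * volume.real (pol K) := by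
  obtain ⟨e, he⟩ := equip h
  rw [← vol_inv e]; exact he.mahler

theorem main_eq {K : Set V} (h : Body K) :
    volume.real K * volume.real (pol K) = 32 / 3 ↔ Para K ∨ Para (pol K) := by
  constructor
  · intro hk
    obtain ⟨e, he⟩ := equip h
    rw [← vol_inv e] at hk
    have h3 : Eq3 (e ⁻¹' K) := { he with eq := hk }
    rcases h3.para with k | k
    · exact Or.inl (k.pre e)
    · right
      obtain ⟨B, hB, _⟩ := exists_adj e
      rw [pol_preimage e B hB] at k
      exact k.pre B
  · rintro (k | k)
    · exact k.prod
    · have := k.prod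
      rw [pol_pol h] at this
      linarith

theorem para_iff (K : Set E3') : Para (Th.symm ⁻¹' K) ↔ ∃ T : E3' ≃ₗ[ℝ] E3', K = T '' {x | ∀ i, |x i| ≤ 1} := by
  have hc : ({x | ∀ i, |x i| ≤ 1} : Set E3') = Th ⁻¹' box3 1 1 1 := by
    ext x; simp [box3, Th_apply, Fin.forall_fin_succ]
  rw [hc]
  constructor
  · rintro ⟨e, he⟩
    refine ⟨(Th.trans e.symm).trans Th.symm, ?_⟩
    ext x
    have := Set.ext_iff.1 he (Th x)
    simp only [Set.mem_preimage, LinearEquiv.symm_apply_apply] at this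
    rw [LinearEquiv.image_eq_preimage_symm]
    rw [this]
    simp
  · rintro ⟨T, rfl⟩
    refine ⟨(Th.symm.trans T.symm).trans Th, ?_⟩
    ext x
    rw [LinearEquiv.image_eq_preimage_symm]
    simp

theorem final (K : Set E3')
    (hKcomp : IsCompact K) (hKconv : Convex ℝ K) (hKsymm : K = -K)
    (hKint : (interior K).Nonempty)
    (Kp : Set E3')
    (hKp : Kp = {y | ∀ x ∈ K, ⟪x, y⟫ ≤ 1}) :
    32 / 3 ≤ (volume K).toReal * (volume Kp).toReal ∧
    ((volume K).toReal * (volume Kp).toReal = 32 / 3 ↔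
      ∃ T : E3' ≃ₗ[ℝ] E3',
        K = T '' {x | ∀ i, |x i| ≤ 1} ∨ Kp = T '' {x | ∀ i, |x i| ≤ 1}) := by
  have hs : ∀ x ∈ K, -x ∈ K := fun x hx => by rw [hKsymm] at hx; simpa using hx
  have h0 : (0 : E3') ∈ interior K := by
    obtain ⟨x, hx⟩ := hKint
    have h1 : -x ∈ K := hs x (interior_subset hx)
    have := hKconv.combo_interior_self_mem_interior hx h1 (a := 1/2) (b := 1/2) (by norm_num) (by norm_num) (by norm_num)
    simpa using this
  have hB : Body K := ⟨hKcomp, hKconv, hs, h0⟩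
  have hV : Body (Th.symm ⁻¹' K) := hB.preimage Th.symm
  have v1 : volume.real (Th.symm ⁻¹' K) = (volume K).toReal := by
    rw [← Th_vol, ← measureReal_def]; congr 1; ext x; simp
  have hp : pol (Th.symm ⁻¹' K) = Th.symm ⁻¹' Kp := by
    ext y
    obtain ⟨y, rfl⟩ := Th.surjective y
    rw [mem_pol, hKp]
    simp only [Set.mem_preimage, LinearEquiv.symm_apply_apply, Set.mem_setOf_eq]
    constructor
    · intro h x hx
      have := h (Th x) (by simpa using hx)
      rwa [Th_dot] at this
    · intro h x hx
      obtain ⟨x, rfl⟩ := Th.surjective x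
      rw [Th_dot]
      exact h x (by simpa using hx)
  have v2 : volume.real (pol (Th.symm ⁻¹' K)) = (volume Kp).toReal := by
    rw [hp, ← Th_vol, ← measureReal_def]; congr 1; ext x; simp
  rw [← v1, ← v2]
  refine ⟨main_ge hV, ?_⟩
  rw [main_eq hV, hp, para_iff, para_iff, exists_or]

end Mahler

end


open MeasureTheory
open scoped RealInnerProductSpace

/-- The three-dimensional symmetric Mahler conjecture (Iriyeh–Shibata): every centrally
symmetric convex body `K ⊂ ℝ³` satisfies `|K| |K°| ≥ 32/3`, with equality iff `K` or `K°`
is a parallelepiped (a linear image of the cube `[-1,1]³`). -/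
theorem mahler_dim3 (K : Set (EuclideanSpace ℝ (Fin 3)))
    (hKcomp : IsCompact K) (hKconv : Convex ℝ K) (hKsymm : K = -K)
    (hKint : (interior K).Nonempty)
    (Kp : Set (EuclideanSpace ℝ (Fin 3)))
    (hKp : Kp = {y | ∀ x ∈ K, ⟪x, y⟫ ≤ 1}) :
    32 / 3 ≤ (volume K).toReal * (volume Kp).toReal ∧
    ((volume K).toReal * (volume Kp).toReal = 32 / 3 ↔
      ∃ T : EuclideanSpace ℝ (Fin 3) ≃ₗ[ℝ] EuclideanSpace ℝ (Fin 3),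
        K = T '' {x | ∀ i, |x i| ≤ 1} ∨ Kp = T '' {x | ∀ i, |x i| ≤ 1}) := by
  exact Mahler.final K hKcomp hKconv hKsymm hKint Kp hKp
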